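/- For every integer j ≥ 21 and every positive integer m, the number m + j is the sum of exactly j positive fourth powers if and only if m + 21 is the sum of exactly 21 positive fourth powers. -/

import Mathlib

/-- A positive integer `n` is `(j,k)`-representable if it is a sum of exactly `j`
positive `k`-th powers. -/
def IsRepr (n j k : ℕ) : Prop :=
  ∃ a : Fin j → ℕ, (∀ i, 0 < a i) ∧ ∑ i, (a i) ^ k = n

namespace Biquad
open Finset

/-- The additive character `x ↦ exp (2πix)` of the reals. -/
noncomputable def ex (x : ℝ) : ℂ := Complex.exp (((2 * Real.pi * x : ℝ) : ℂ) * Complex.I)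

lemma ex_add (x y : ℝ) : ex (x + y) = ex x * ex y := by
  simp only [ex, ← Complex.exp_add]
  congr 1
  push_cast
  ring

@[simp] lemma ex_zero : ex 0 = 1 := by simp [ex]

@[simp] lemma norm_ex (x : ℝ) : ‖ex x‖ = 1 := Complex.norm_exp_ofReal_mul_I _

@[simp] lemma ex_int (k : ℤ) : ex k = 1 := by
  rw [ex, Complex.exp_eq_one_iff]
  exact ⟨k, by push_cast; ring⟩

lemma ex_add_int (x : ℝ) (k : ℤ) : ex (x + k) = ex x := by simp [ex_add]

lemma conj_ex (x : ℝ) : (starRingEnd ℂ) (ex x) = ex (-x) := by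
  rw [ex, ← Complex.exp_conj, ex, map_mul, Complex.conj_ofReal, Complex.conj_I]
  congr 1
  push_cast
  ring

lemma ex_nat_mul (n : ℕ) (x : ℝ) : ex (n * x) = ex x ^ n := by
  rw [ex, ex, ← Complex.exp_nat_mul]
  congr 1
  push_cast
  ring

lemma norm_ex_sub_one (x : ℝ) : ‖ex x - 1‖ = 2 * |Real.sin (Real.pi * x)| := by
  have := Complex.norm_exp_I_mul_ofReal_sub_one (2 * Real.pi * x)
  rw [ex, mul_comm, this, Real.norm_eq_abs, abs_mul, abs_two]
  congr 3
  ring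

lemma norm_ex_sub_one_le (x : ℝ) : ‖ex x - 1‖ ≤ 2 * Real.pi * |x| := by
  rw [norm_ex_sub_one, mul_assoc]
  gcongr
  calc |Real.sin (Real.pi * x)| ≤ |Real.pi * x| := Real.abs_sin_le_abs
    _ = Real.pi * |x| := by rw [abs_mul, abs_of_pos Real.pi_pos]

/-- The distance of a real number to the nearest integer. -/
noncomputable def nd (x : ℝ) : ℝ := |x - round x|

lemma nd_nonneg (x : ℝ) : 0 ≤ nd x := abs_nonneg _

lemma nd_le_half (x : ℝ) : nd x ≤ 1 / 2 := abs_sub_round x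

lemma nd_le (x : ℝ) (k : ℤ) : nd x ≤ |x - k| := round_le x k

lemma nd_add_int (x : ℝ) (k : ℤ) : nd (x + k) = nd x := by
  simp [nd, round_add_intCast]

lemma nd_neg (x : ℝ) : nd (-x) = nd x := by
  apply le_antisymm
  · calc nd (-x) ≤ |-x - ((-round x : ℤ) : ℝ)| := nd_le _ _
      _ = nd x := by rw [nd, ← abs_neg]; congr 1; push_cast; ring
  · calc nd x ≤ |x - ((-round (-x) : ℤ) : ℝ)| := nd_le _ _
      _ = nd (-x) := by rw [nd, ← abs_neg]; congr 1; push_cast; ring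

lemma nd_add_le (x y : ℝ) : nd (x + y) ≤ nd x + nd y := by
  calc nd (x + y) ≤ |x + y - ((round x + round y : ℤ) : ℝ)| := nd_le _ _
    _ = |(x - round x) + (y - round y)| := by congr 1; push_cast; ring
    _ ≤ _ := abs_add_le _ _

lemma nd_le_abs (x : ℝ) : nd x ≤ |x| := by simpa using nd_le x 0

lemma four_nd_le (x : ℝ) : 4 * nd x ≤ ‖ex x - 1‖ := by
  have h : ex x = ex (x - round x) := by
    rw [← ex_add_int (x - round x) (round x)]; congr 1; ring
  have hx := nd_le_half x
  rw [h, norm_ex_sub_one, nd] at *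
  set y := x - round x
  have h1 : |Real.sin (Real.pi * y)| = Real.sin (Real.pi * |y|) := by
    rcases abs_cases y with ⟨h, h0⟩ | ⟨h, h0⟩
    · rw [h, abs_of_nonneg]
      apply Real.sin_nonneg_of_nonneg_of_le_pi <;> nlinarith [Real.pi_pos]
    · rw [h, abs_of_nonpos]
      · rw [mul_neg, Real.sin_neg]
      · apply Real.sin_nonpos_of_nonpos_of_neg_pi_le <;> nlinarith [Real.pi_pos]
  have h2 : 2 / Real.pi * (Real.pi * |y|) ≤ Real.sin (Real.pi * |y|) :=
    Real.mul_le_sin (by positivity) (by nlinarith [Real.pi_pos])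
  have h3 : 2 / Real.pi * (Real.pi * |y|) = 2 * |y| := by
    field_simp
  rw [h1]
  linarith

lemma norm_geom_le (x : ℝ) (hx : nd x ≠ 0) (y : ℝ) (n : ℕ) :
    ‖∑ k ∈ range n, ex (x * k + y)‖ ≤ 1 / (2 * nd x) := by
  have hpos : 0 < nd x := lt_of_le_of_ne (nd_nonneg x) hx.symm
  have h4 := four_nd_le x
  have h0 : ex x - 1 ≠ 0 := by
    intro h
    rw [h, norm_zero] at h4
    linarith
  have h1 : ∑ k ∈ range n, ex (x * k + y) = ((ex x ^ n - 1) / (ex x - 1)) * ex y := by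
    rw [← geom_sum_eq (sub_ne_zero.mp h0), sum_mul]
    refine sum_congr rfl fun k _ => ?_
    rw [ex_add, mul_comm x, ex_nat_mul]
  rw [h1, norm_mul, norm_ex, mul_one, norm_div, div_le_div_iff₀ (by linarith) (by linarith)]
  have : ‖ex x ^ n - 1‖ ≤ 2 := by
    calc ‖ex x ^ n - 1‖ ≤ ‖ex x ^ n‖ + ‖(1 : ℂ)‖ := norm_sub_le _ _
      _ = 2 := by rw [norm_pow]; norm_num
  nlinarith

/-- Partial summation: bounded partial sums against a sequence of bounded variation. -/
lemma norm_sum_mul_le_of_partial {g h : ℕ → ℂ} {M : ℕ} {E : ℝ}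
    (hE : ∀ k ≤ M, ‖∑ u ∈ range k, g u‖ ≤ E) :
    ‖∑ u ∈ range M, g u * h u‖ ≤ E * (‖h M‖ + ∑ u ∈ range M, ‖h (u + 1) - h u‖) := by
  have key : ∀ m : ℕ, ∑ u ∈ range m, g u * h u
      = (∑ u ∈ range m, g u) * h m
        - ∑ u ∈ range m, (∑ v ∈ range (u + 1), g v) * (h (u + 1) - h u) := by
    intro m
    induction m with
    | zero => simp
    | succ m ih =>
      rw [sum_range_succ, ih, sum_range_succ (fun u => (∑ v ∈ range (u + 1), g v) * _),
        sum_range_succ g]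
      ring
  rw [key, mul_add, mul_sum]
  refine (norm_sub_le _ _).trans (add_le_add ?_ ?_)
  · rw [norm_mul]
    exact mul_le_mul_of_nonneg_right (hE M le_rfl) (norm_nonneg _)
  · refine (norm_sum_le _ _).trans (sum_le_sum fun u hu => ?_)
    rw [norm_mul]
    exact mul_le_mul_of_nonneg_right (hE _ (by have := mem_range.mp hu; omega)) (norm_nonneg _)

end Biquad

namespace Biquad
open Finset

lemma exists_four_of_mul_eq {a b c d : ℕ} (ha : 0 < a) (hc : 0 < c) (h : a * b = c * d) :
    ∃ w x y z : ℕ, a = w * x ∧ b = y * z ∧ c = w * y ∧ d = x * z := by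
  obtain ⟨x, hx⟩ := Nat.gcd_dvd_left a c
  obtain ⟨y, hy⟩ := Nat.gcd_dvd_right a c
  have hg : 0 < Nat.gcd a c := Nat.gcd_pos_of_pos_left _ ha
  have hxy : Nat.Coprime x y := by
    have := Nat.coprime_div_gcd_div_gcd hg
    rwa [Nat.div_eq_of_eq_mul_right hg hx, Nat.div_eq_of_eq_mul_right hg hy] at this
  have h1 : x * b = y * d := by
    apply Nat.eq_of_mul_eq_mul_left hg
    calc Nat.gcd a c * (x * b) = (Nat.gcd a c * x) * b := by ring
      _ = (Nat.gcd a c * y) * d := by rw [← hx, ← hy, h]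
      _ = _ := by ring
  obtain ⟨z, hz⟩ : y ∣ b := hxy.symm.dvd_of_dvd_mul_left (Dvd.intro d h1.symm)
  refine ⟨Nat.gcd a c, x, y, z, hx, hz, hy, ?_⟩
  have hy0 : 0 < y := Nat.pos_of_ne_zero fun h0 => by rw [h0, mul_zero] at hy; omega
  apply Nat.eq_of_mul_eq_mul_left hy0
  rw [← h1, hz]
  ring

lemma sum_inv_Icc_le (B : ℕ) : ∑ x ∈ Icc 1 B, (1 : ℝ) / x ≤ 1 + Real.log B := by
  have := harmonic_le_one_add_log B
  rw [harmonic_eq_sum_Icc] at this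
  push_cast at this
  simpa [one_div] using this

/-- The quadruples `((a, b), (c, d))` with `a, c ∈ [1, B]`, `b, d ∈ [1, C]` and `ab = cd`. -/
def mulQuads (B C : ℕ) : Finset ((ℕ × ℕ) × (ℕ × ℕ)) :=
  ((Icc 1 B ×ˢ Icc 1 C) ×ˢ (Icc 1 B ×ˢ Icc 1 C)).filter fun p => p.1.1 * p.1.2 = p.2.1 * p.2.2

lemma sum_inv_max_sq_le (B : ℕ) :
    ∑ p ∈ Icc 1 B ×ˢ Icc 1 B, (1 : ℝ) / (max p.1 p.2 : ℕ) ^ 2 ≤ 2 * ∑ x ∈ Icc 1 B, (1 : ℝ) / x := by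
  have h1 : ∀ p ∈ Icc 1 B ×ˢ Icc 1 B, (1 : ℝ) / (max p.1 p.2 : ℕ) ^ 2
      ≤ (if p.2 ≤ p.1 then (1 : ℝ) / (p.1 : ℝ) ^ 2 else 0)
        + (if p.1 ≤ p.2 then (1 : ℝ) / (p.2 : ℝ) ^ 2 else 0) := by
    intro p _
    rcases le_total p.1 p.2 with h | h
    · rw [max_eq_right h, if_pos h]
      have : (0 : ℝ) ≤ (if p.2 ≤ p.1 then (1 : ℝ) / (p.1 : ℝ) ^ 2 else 0) := by positivity
      linarith
    · rw [max_eq_left h, if_pos h]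
      have : (0 : ℝ) ≤ (if p.1 ≤ p.2 then (1 : ℝ) / (p.2 : ℝ) ^ 2 else 0) := by positivity
      linarith
  have h2 : ∀ x ∈ Icc 1 B, ∑ y ∈ Icc 1 B, (if y ≤ x then (1 : ℝ) / (x : ℝ) ^ 2 else 0)
      ≤ 1 / (x : ℝ) := by
    intro x hx
    have hx1 : 1 ≤ x := (mem_Icc.mp hx).1
    have hx0 : (0 : ℝ) < x := by exact_mod_cast hx1
    rw [← sum_filter, sum_const, nsmul_eq_mul]
    have hc : ((Icc 1 B).filter fun y => y ≤ x).card ≤ x := by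
      calc _ ≤ (Icc 1 x).card := card_le_card fun y hy => by
            simp only [mem_filter, mem_Icc] at hy ⊢
            exact ⟨hy.1.1, hy.2⟩
        _ = x := by simp
    calc _ ≤ (x : ℝ) * (1 / (x : ℝ) ^ 2) := by gcongr
      _ = _ := by field_simp
  calc _ ≤ ∑ p ∈ Icc 1 B ×ˢ Icc 1 B, ((if p.2 ≤ p.1 then (1 : ℝ) / (p.1 : ℝ) ^ 2 else 0)
        + (if p.1 ≤ p.2 then (1 : ℝ) / (p.2 : ℝ) ^ 2 else 0)) := sum_le_sum h1
    _ = ∑ x ∈ Icc 1 B, ∑ y ∈ Icc 1 B, (if y ≤ x then (1 : ℝ) / (x : ℝ) ^ 2 else 0)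
        + ∑ x ∈ Icc 1 B, ∑ y ∈ Icc 1 B, (if y ≤ x then (1 : ℝ) / (x : ℝ) ^ 2 else 0) := by
      rw [sum_add_distrib, sum_product, sum_product_right]
    _ ≤ _ := by
      rw [two_mul]
      exact add_le_add (sum_le_sum h2) (sum_le_sum h2)

lemma card_mulQuads_le (B C : ℕ) :
    ((mulQuads B C).card : ℝ) ≤ 2 * (B : ℝ) * C * (1 + Real.log B) := by
  let S : Finset (Σ _ : ℕ × ℕ, ℕ × ℕ) := (Icc 1 B ×ˢ Icc 1 B).sigma fun p =>
    Icc 1 (B / max p.1 p.2) ×ˢ Icc 1 (C / max p.1 p.2)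
  have h1 : (mulQuads B C).card ≤ S.card := by
    apply card_le_card_of_surjOn
      (fun s : Σ _ : ℕ × ℕ, ℕ × ℕ => ((s.2.1 * s.1.1, s.1.2 * s.2.2), (s.2.1 * s.1.2, s.1.1 * s.2.2)))
    rintro ⟨⟨a, b⟩, ⟨c, d⟩⟩ hp
    simp only [mulQuads, coe_filter, mem_product, mem_Icc, Set.mem_ofPred_eq] at hp
    obtain ⟨⟨⟨⟨ha, ha'⟩, hb, hb'⟩, ⟨hc, hc'⟩, hd, hd'⟩, h⟩ := hp
    obtain ⟨w, x, y, z, rfl, rfl, rfl, rfl⟩ := exists_four_of_mul_eq ha hc h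
    have hw : 0 < w := Nat.pos_of_mul_pos_right ha
    have hx : 0 < x := Nat.pos_of_mul_pos_left ha
    have hy : 0 < y := Nat.pos_of_mul_pos_right hb
    have hz : 0 < z := Nat.pos_of_mul_pos_left hb
    have hm : 0 < max x y := lt_max_of_lt_left hx
    refine ⟨⟨(x, y), (w, z)⟩, ?_, rfl⟩
    simp only [S, coe_sigma, Set.mem_sigma_iff, coe_product, coe_Icc, Set.mem_prod, Set.mem_Icc]
    refine ⟨⟨⟨hx, ?_⟩, hy, ?_⟩, ⟨hw, ?_⟩, hz, ?_⟩
    · nlinarith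
    · nlinarith
    · rw [Nat.le_div_iff_mul_le hm]
      rcases le_total x y with h | h
      · rwa [max_eq_right h]
      · rwa [max_eq_left h]
    · rw [Nat.le_div_iff_mul_le hm]
      rcases le_total x y with h | h
      · rw [max_eq_right h]; linarith
      · rw [max_eq_left h]; linarith
  have h2 : (S.card : ℝ) ≤ ∑ p ∈ Icc 1 B ×ˢ Icc 1 B, ((B : ℝ) * C) * (1 / (max p.1 p.2 : ℕ) ^ 2) := by
    rw [card_sigma, Nat.cast_sum]
    refine sum_le_sum fun p _ => ?_
    simp only [card_product, Nat.card_Icc, Nat.add_sub_cancel, Nat.cast_mul]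
    calc (((B / max p.1 p.2 : ℕ)) : ℝ) * ((C / max p.1 p.2 : ℕ) : ℝ)
        ≤ ((B : ℝ) / (max p.1 p.2 : ℕ)) * ((C : ℝ) / (max p.1 p.2 : ℕ)) := by
          gcongr <;> exact Nat.cast_div_le
      _ = _ := by rw [div_mul_div_comm, ← sq, mul_one_div]
  rw [← mul_sum] at h2
  calc ((mulQuads B C).card : ℝ) ≤ S.card := by exact_mod_cast h1
    _ ≤ _ := h2
    _ ≤ ((B : ℝ) * C) * (2 * (1 + Real.log B)) := by
      gcongr
      exact (sum_inv_max_sq_le B).trans (by linarith [sum_inv_Icc_le B])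
    _ = _ := by ring

/-- The tuples of `k` positive integers with product at most `Y`. -/
def prodTuples (k Y : ℕ) : Finset (Fin k → ℕ) :=
  (Fintype.piFinset fun _ => Icc 1 Y).filter fun x => ∏ i, x i ≤ Y

lemma mem_prodTuples {k Y : ℕ} {x : Fin k → ℕ} :
    x ∈ prodTuples k Y ↔ (∀ i, 1 ≤ x i) ∧ ∏ i, x i ≤ Y := by
  simp only [prodTuples, mem_filter, Fintype.mem_piFinset, mem_Icc]
  refine ⟨fun h => ⟨fun i => (h.1 i).1, h.2⟩, fun h => ⟨fun i => ⟨h.1 i, ?_⟩, h.2⟩⟩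
  refine le_trans ?_ h.2
  exact Nat.le_of_dvd (prod_pos fun j _ => h.1 j) (dvd_prod_of_mem x (mem_univ i))

lemma card_prodTuples_le (k : ℕ) : ∀ Y : ℕ, 1 ≤ Y →
    ((prodTuples (k + 1) Y).card : ℝ) ≤ Y * (1 + Real.log Y) ^ k := by
  induction k with
  | zero =>
    intro Y _
    have : (prodTuples 1 Y).card ≤ (Icc 1 Y).card := by
      apply card_le_card_of_injOn (fun x => x 0)
      · intro x hx
        have := mem_prodTuples.mp hx
        simp only [Finset.univ_unique, Fin.default_eq_zero, Fin.isValue, prod_singleton] at this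
        simpa using ⟨this.1 0, this.2⟩
      · intro x _ y _ h
        ext i
        rw [Subsingleton.elim i 0]
        exact h
    simpa using this
  | succ k ih =>
    intro Y hY
    let S : Finset (Σ _ : ℕ, Fin (k + 1) → ℕ) :=
      (Icc 1 Y).sigma fun x => prodTuples (k + 1) (Y / x)
    have h1 : (prodTuples (k + 1 + 1) Y).card ≤ S.card := by
      apply card_le_card_of_injOn (fun x => ⟨x 0, Fin.tail x⟩)
      · intro x hx
        obtain ⟨hx1, hx2⟩ := mem_prodTuples.mp hx
        rw [Fin.prod_univ_succ] at hx2
        have h3 : 1 ≤ ∏ i : Fin (k + 1), x i.succ :=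
          Nat.succ_le_of_lt (prod_pos fun j _ => hx1 _)
        simp only [S, coe_sigma, Set.mem_sigma_iff, coe_Icc, Set.mem_Icc, mem_coe]
        refine ⟨⟨hx1 0, by nlinarith⟩, mem_prodTuples.mpr ⟨fun i => hx1 _, ?_⟩⟩
        rw [Nat.le_div_iff_mul_le (hx1 0), mul_comm]
        exact hx2
      · intro x _ y _ h
        simp only [Sigma.mk.injEq, heq_eq_eq] at h
        rw [← Fin.cons_self_tail x, ← Fin.cons_self_tail y, h.1, h.2]
    have h2 : (S.card : ℝ) ≤ ∑ x ∈ Icc 1 Y, (Y * (1 + Real.log Y) ^ k) * (1 / (x : ℝ)) := by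
      rw [card_sigma, Nat.cast_sum]
      refine sum_le_sum fun x hx => ?_
      obtain ⟨hx1, hx2⟩ := mem_Icc.mp hx
      have hd : 1 ≤ Y / x := (Nat.le_div_iff_mul_le hx1).mpr (by omega)
      have hx0 : (0 : ℝ) < x := by exact_mod_cast hx1
      have hd0 : (1 : ℝ) ≤ (Y / x : ℕ) := by exact_mod_cast hd
      have hlog : 0 ≤ Real.log (Y / x : ℕ) := Real.log_nonneg hd0
      have hle : ((Y / x : ℕ) : ℝ) ≤ Y / x := Nat.cast_div_le
      have hle2 : ((Y / x : ℕ) : ℝ) ≤ Y := by exact_mod_cast Nat.div_le_self Y x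
      calc _ ≤ ((Y / x : ℕ) : ℝ) * (1 + Real.log (Y / x : ℕ)) ^ k := ih _ hd
        _ ≤ (Y / x) * (1 + Real.log Y) ^ k := by gcongr
        _ = _ := by ring
    have hl : 0 ≤ Real.log Y := Real.log_nonneg (by exact_mod_cast hY)
    rw [← mul_sum] at h2
    calc _ ≤ (S.card : ℝ) := by exact_mod_cast h1
      _ ≤ _ := h2
      _ ≤ Y * (1 + Real.log Y) ^ k * (1 + Real.log Y) := by
        gcongr; exact sum_inv_Icc_le Y
      _ = _ := by ring

/-- The sextuples `((a, b, c), (d, e, f))` in `[1, H]⁶` with `abc = def`. -/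
def mulSexts (H : ℕ) : Finset ((ℕ × ℕ × ℕ) × (ℕ × ℕ × ℕ)) :=
  ((Icc 1 H ×ˢ Icc 1 H ×ˢ Icc 1 H) ×ˢ (Icc 1 H ×ˢ Icc 1 H ×ˢ Icc 1 H)).filter
    fun p => p.1.1 * p.1.2.1 * p.1.2.2 = p.2.1 * p.2.2.1 * p.2.2.2

lemma card_mulSexts_le {H : ℕ} (hH : 1 ≤ H) :
    ((mulSexts H).card : ℝ) ≤ (H : ℝ) ^ 3 * (1 + Real.log H) ^ 6 := by
  have h1 : (mulSexts H).card ≤ (prodTuples 3 H ×ˢ prodTuples 3 H ×ˢ prodTuples 3 H).card := by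
    apply card_le_card_of_surjOn
      (fun v : (Fin 3 → ℕ) × (Fin 3 → ℕ) × (Fin 3 → ℕ) =>
        ((v.1 0 * (v.1 1 * v.1 2), v.2.1 0 * (v.2.1 1 * v.2.1 2), v.2.2 0 * (v.2.2 1 * v.2.2 2)),
          (v.1 0 * (v.2.1 0 * v.2.2 0), v.1 1 * (v.2.1 1 * v.2.2 1),
            v.1 2 * (v.2.1 2 * v.2.2 2))))
    rintro ⟨⟨a, b, c⟩, ⟨d, e, f⟩⟩ hp
    simp only [mulSexts, coe_filter, mem_product, mem_Icc, Set.mem_ofPred_eq] at hp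
    obtain ⟨⟨⟨⟨ha, ha'⟩, ⟨hb, hb'⟩, hc, hc'⟩, ⟨hd, hd'⟩, ⟨he, he'⟩, hf, hf'⟩, h⟩ := hp
    rw [mul_assoc, mul_assoc] at h
    obtain ⟨w, x, y, z, rfl, h2, rfl, h3⟩ := exists_four_of_mul_eq ha hd h
    have hw : 0 < w := Nat.pos_of_mul_pos_right ha
    have hx : 0 < x := Nat.pos_of_mul_pos_left ha
    have hy : 0 < y := Nat.pos_of_mul_pos_left hd
    obtain ⟨k, l, m, n, rfl, rfl, rfl, rfl⟩ := exists_four_of_mul_eq hb hy h2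
    have hk : 0 < k := Nat.pos_of_mul_pos_right hb
    have hl : 0 < l := Nat.pos_of_mul_pos_left hb
    have hm : 0 < m := Nat.pos_of_mul_pos_right hc
    have hn : 0 < n := Nat.pos_of_mul_pos_left hc
    have h4 : e * f = x * (l * n) := h3
    obtain ⟨p, q, r, s, rfl, rfl, rfl, h5⟩ := exists_four_of_mul_eq he hx h4
    have hp : 0 < p := Nat.pos_of_mul_pos_right he
    have hq : 0 < q := Nat.pos_of_mul_pos_left he
    have hr : 0 < r := Nat.pos_of_mul_pos_right hf
    have hs : 0 < s := Nat.pos_of_mul_pos_left hf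
    obtain ⟨α, β, γ, δ, rfl, rfl, rfl, rfl⟩ := exists_four_of_mul_eq hl hq h5
    have hα : 0 < α := Nat.pos_of_mul_pos_right hl
    have hβ : 0 < β := Nat.pos_of_mul_pos_left hl
    have hγ : 0 < γ := Nat.pos_of_mul_pos_right hn
    have hδ : 0 < δ := Nat.pos_of_mul_pos_left hn
    refine ⟨(![w, p, r], ![k, α, β], ![m, γ, δ]), ?_, by simp⟩
    simp only [coe_product, Set.mem_prod, mem_coe, mem_prodTuples, Fin.forall_fin_succ,
      Fin.prod_univ_succ]
    simp
    omega
  have h2 := card_prodTuples_le 2 H hH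
  rw [card_product, card_product] at h1
  calc _ ≤ ((prodTuples 3 H).card : ℝ) * ((prodTuples 3 H).card * (prodTuples 3 H).card) := by
        exact_mod_cast h1
    _ ≤ (H * (1 + Real.log H) ^ 2) * ((H * (1 + Real.log H) ^ 2) * (H * (1 + Real.log H) ^ 2)) := by
      gcongr
    _ = _ := by ring

end Biquad

namespace Biquad
open Finset

/-- An exponential sum over an initial segment. -/
noncomputable def expSum (g : ℕ → ℝ) (n : ℕ) : ℂ := ∑ t ∈ range n, ex (g t)

/-- The difference operator on phases. -/
def dif (h : ℕ) (g : ℕ → ℝ) : ℕ → ℝ := fun t => g (t + h) - g t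

lemma norm_expSum_le (g : ℕ → ℝ) (n : ℕ) : ‖expSum g n‖ ≤ n := by
  refine (norm_sum_le _ _).trans ?_
  simp

lemma sum_lt_pairs (F : ℕ → ℕ → ℂ) (n : ℕ) :
    ∑ p ∈ (range n ×ˢ range n).filter (fun p => p.2 < p.1), F p.1 p.2
      = ∑ h ∈ Ico 1 n, ∑ t ∈ range (n - h), F (t + h) t := by
  rw [sum_sigma']
  refine sum_nbij' (fun p => ⟨p.1 - p.2, p.2⟩) (fun s => (s.2 + s.1, s.2)) ?_ ?_ ?_ ?_ ?_
  · intro p hp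
    simp only [mem_filter, mem_product, mem_range, mem_sigma, mem_Ico] at hp ⊢
    omega
  · intro s hs
    simp only [mem_filter, mem_product, mem_range, mem_sigma, mem_Ico] at hs ⊢
    omega
  · intro p hp
    simp only [mem_filter, mem_product, mem_range] at hp
    ext
    · simp only; omega
    · rfl
  · intro s hs
    simp
  · intro p hp
    simp only [mem_filter, mem_product, mem_range] at hp
    simp only
    rw [Nat.add_sub_cancel' hp.2.le]

/-- The Weyl–van der Corput inequality. -/
lemma norm_expSum_sq_le (g : ℕ → ℝ) (n : ℕ) :
    ‖expSum g n‖ ^ 2 ≤ n + 2 * ∑ h ∈ Ico 1 n, ‖expSum (dif h g) (n - h)‖ := by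
  have h0 : ((‖expSum g n‖ ^ 2 : ℝ) : ℂ)
      = ∑ p ∈ range n ×ˢ range n, ex (g p.1 - g p.2) := by
    rw [← Complex.normSq_eq_norm_sq, ← Complex.mul_conj, expSum, map_sum, sum_mul_sum, sum_product]
    refine sum_congr rfl fun s _ => sum_congr rfl fun t _ => ?_
    rw [conj_ex, ← ex_add, sub_eq_add_neg]
  have h1 : ∑ p ∈ range n ×ˢ range n, ex (g p.1 - g p.2)
      = (∑ p ∈ (range n ×ˢ range n).filter (fun p => p.2 < p.1), ex (g p.1 - g p.2))
        + ((∑ p ∈ (range n ×ˢ range n).filter (fun p => p.1 < p.2), ex (g p.1 - g p.2))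
        + ∑ p ∈ (range n ×ˢ range n).filter (fun p => p.1 = p.2), ex (g p.1 - g p.2)) := by
    rw [← sum_filter_add_sum_filter_not (range n ×ˢ range n) (fun p => p.2 < p.1)]
    congr 1
    rw [← sum_filter_add_sum_filter_not _ (fun p => p.1 < p.2), filter_filter, filter_filter]
    congr 2
    · ext p; simp only [mem_filter]; constructor
      · tauto
      · rintro ⟨h, h'⟩; exact ⟨h, by omega, h'⟩
    · ext p; simp only [mem_filter]; constructor
      · rintro ⟨h, h'⟩; exact ⟨h, by omega⟩
      · rintro ⟨h, h'⟩; exact ⟨h, by omega, by omega⟩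
  have h2 : ‖∑ p ∈ (range n ×ˢ range n).filter (fun p => p.1 = p.2), ex (g p.1 - g p.2)‖ ≤ n := by
    refine (norm_sum_le _ _).trans ?_
    simp only [norm_ex, sum_const, nsmul_eq_mul, mul_one]
    have : ((range n ×ˢ range n).filter (fun p => p.1 = p.2)).card ≤ (range n).card := by
      apply card_le_card_of_injOn (fun p => p.1)
      · intro p hp
        simp only [coe_filter, mem_product, mem_range, Set.mem_ofPred_eq] at hp
        simpa using hp.1.1
      · intro p hp q hq h
        simp only [coe_filter, mem_product, mem_range, Set.mem_ofPred_eq] at hp hq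
        ext
        · exact h
        · rw [← hp.2, ← hq.2]; exact h
    rw [card_range] at this
    exact_mod_cast this
  have h3 : ‖∑ p ∈ (range n ×ˢ range n).filter (fun p => p.2 < p.1), ex (g p.1 - g p.2)‖
      ≤ ∑ h ∈ Ico 1 n, ‖expSum (dif h g) (n - h)‖ := by
    rw [sum_lt_pairs (fun s t => ex (g s - g t))]
    exact norm_sum_le _ _
  have h4 : ∑ p ∈ (range n ×ˢ range n).filter (fun p => p.1 < p.2), ex (g p.1 - g p.2)
      = (starRingEnd ℂ)
        (∑ p ∈ (range n ×ˢ range n).filter (fun p => p.2 < p.1), ex (g p.1 - g p.2)) := by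
    rw [map_sum]
    refine sum_nbij' Prod.swap Prod.swap ?_ ?_ ?_ ?_ ?_
    · intro p hp; simp only [mem_filter, mem_product, Prod.fst_swap, Prod.snd_swap] at hp ⊢; tauto
    · intro p hp; simp only [mem_filter, mem_product, Prod.fst_swap, Prod.snd_swap] at hp ⊢; tauto
    · intro p _; simp
    · intro p _; simp
    · intro p _
      rw [conj_ex]
      simp
  have h5 : ‖expSum g n‖ ^ 2 = ‖((‖expSum g n‖ ^ 2 : ℝ) : ℂ)‖ := by
    rw [Complex.norm_real, Real.norm_of_nonneg (by positivity)]
  rw [h5, h0, h1]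
  refine (norm_add_le _ _).trans ?_
  have h6 := norm_add_le
    (∑ p ∈ (range n ×ˢ range n).filter (fun p => p.1 < p.2), ex (g p.1 - g p.2))
    (∑ p ∈ (range n ×ˢ range n).filter (fun p => p.1 = p.2), ex (g p.1 - g p.2))
  have h7 : ‖∑ p ∈ (range n ×ˢ range n).filter (fun p => p.1 < p.2), ex (g p.1 - g p.2)‖
      = ‖∑ p ∈ (range n ×ˢ range n).filter (fun p => p.2 < p.1), ex (g p.1 - g p.2)‖ := by
    rw [h4, Complex.norm_conj]
  linarith

/-- One differencing step followed by squaring. -/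
lemma sq_sum_sqrt_step {ι : Type*} (s : Finset ι) (w v : ι → ℝ) (X : ℝ)
    (h : ∀ i ∈ s, w i ^ 2 ≤ X + 2 * v i) :
    (∑ i ∈ s, w i) ^ 2 ≤ s.card * (s.card * X) + 2 * s.card * ∑ i ∈ s, v i := by
  calc (∑ i ∈ s, w i) ^ 2 ≤ s.card * ∑ i ∈ s, w i ^ 2 := sq_sum_le_card_mul_sum_sq
    _ ≤ s.card * ∑ i ∈ s, (X + 2 * v i) := by gcongr with i hi; exact h i hi
    _ = _ := by rw [sum_add_distrib, sum_const, nsmul_eq_mul, ← mul_sum]; ring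

/-- Weyl's inequality before the third difference is evaluated. -/
lemma norm_expSum_pow_eight_le (g : ℕ → ℝ) (X : ℕ) (hX : 1 ≤ X) :
    ‖expSum g X‖ ^ 8 ≤ 1000 * (X : ℝ) ^ 7
      + 1024 * (X : ℝ) ^ 4 * ∑ h ∈ Icc 1 X ×ˢ Icc 1 X ×ˢ Icc 1 X,
        ‖expSum (dif h.2.2 (dif h.2.1 (dif h.1 g))) (X - h.1 - h.2.1 - h.2.2)‖ := by
  obtain ⟨x, hx⟩ : ∃ x : ℝ, x = X := ⟨_, rfl⟩
  rw [← hx]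
  have hx1 : 1 ≤ x := by rw [hx]; exact_mod_cast hX
  have step : ∀ (g : ℕ → ℝ) (n : ℕ), n ≤ X →
      ‖expSum g n‖ ^ 2 ≤ x + 2 * ∑ h ∈ Icc 1 X, ‖expSum (dif h g) (n - h)‖ := by
    intro g n hn
    refine (norm_expSum_sq_le g n).trans ?_
    gcongr
    · rw [hx]; exact_mod_cast hn
    · intro h hh
      simp only [mem_Ico, mem_Icc] at hh ⊢
      omega
  have h1 : ‖expSum g X‖ ^ 2 ≤ x + 2 * ∑ h ∈ Icc 1 X, ‖expSum (dif h g) (X - h)‖ := by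
    refine (norm_expSum_sq_le g X).trans ?_
    rw [← hx]
    gcongr
    intro h hh
    simp only [mem_Ico, mem_Icc] at hh ⊢
    omega
  set S1 := ∑ h ∈ Icc 1 X, ‖expSum (dif h g) (X - h)‖ with hS1
  have h2 := sq_sum_sqrt_step (Icc 1 X) (fun h => ‖expSum (dif h g) (X - h)‖) _ x
    (fun h _ => step (dif h g) (X - h) (Nat.sub_le _ _))
  rw [← hS1, Nat.card_Icc, Nat.add_sub_cancel, ← hx, ← sum_product'] at h2
  set S2 := ∑ h ∈ Icc 1 X ×ˢ Icc 1 X, ‖expSum (dif h.2 (dif h.1 g)) (X - h.1 - h.2)‖ with hS2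
  have h3 := sq_sum_sqrt_step (Icc 1 X ×ˢ Icc 1 X)
    (fun h => ‖expSum (dif h.2 (dif h.1 g)) (X - h.1 - h.2)‖) _ x
    (fun h _ => step (dif h.2 (dif h.1 g)) (X - h.1 - h.2) (by omega))
  rw [← hS2, card_product, Nat.card_Icc, Nat.add_sub_cancel, Nat.cast_mul, ← hx, sum_product,
    sum_congr rfl (fun a _ => (sum_product' (Icc 1 X) (Icc 1 X) (fun b c =>
      ‖expSum (dif c (dif b (dif a g))) (X - a - b - c)‖)).symm)] at h3
  rw [sum_product]
  set S3 := ∑ a ∈ Icc 1 X, ∑ p ∈ Icc 1 X ×ˢ Icc 1 X,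
    ‖expSum (dif p.2 (dif p.1 (dif a g))) (X - a - p.1 - p.2)‖ with hS3
  have hS1n : 0 ≤ S1 := sum_nonneg fun _ _ => norm_nonneg _
  have hS2n : 0 ≤ S2 := sum_nonneg fun _ _ => norm_nonneg _
  set N := ‖expSum g X‖
  have e1 : N ^ 4 ≤ 10 * x ^ 3 + 16 * x * S2 := by
    calc N ^ 4 = (N ^ 2) ^ 2 := by ring
      _ ≤ (x + 2 * S1) ^ 2 := by gcongr
      _ ≤ 2 * x ^ 2 + 8 * S1 ^ 2 := by nlinarith [sq_nonneg (x - 2 * S1)]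
      _ ≤ 2 * x ^ 2 + 8 * (x * (x * x) + 2 * x * S2) := by gcongr
      _ ≤ _ := by nlinarith [sq_nonneg x, mul_nonneg (sq_nonneg x) (sub_nonneg.mpr hx1)]
  calc N ^ 8 = (N ^ 4) ^ 2 := by ring
    _ ≤ (10 * x ^ 3 + 16 * x * S2) ^ 2 := by gcongr
    _ ≤ 200 * x ^ 6 + 512 * x ^ 2 * S2 ^ 2 := by nlinarith [sq_nonneg (10 * x ^ 3 - 16 * x * S2)]
    _ ≤ 200 * x ^ 6 + 512 * x ^ 2 * (x * x * (x * x * x) + 2 * (x * x) * S3) := by gcongr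
    _ = 200 * x ^ 6 + 512 * x ^ 7 + 1024 * x ^ 4 * S3 := by ring
    _ ≤ _ := by
      have : x ^ 6 ≤ x ^ 7 := pow_le_pow_right₀ hx1 (by norm_num)
      have : 0 ≤ x ^ 7 := by positivity
      linarith

end Biquad

namespace Biquad
open Finset

/-- The minimum of `X` and `1 / (2‖x‖)`. -/
noncomputable def mn (X x : ℝ) : ℝ := (max (1 / X) (2 * nd x))⁻¹

lemma mn_nonneg {X : ℝ} (hX : 0 < X) (x : ℝ) : 0 ≤ mn X x := by
  unfold mn; positivity

lemma mn_le {X : ℝ} (hX : 0 < X) (x : ℝ) : mn X x ≤ X := by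
  unfold mn
  rw [inv_le_comm₀ (by positivity) hX, ← one_div]
  exact le_max_left _ _

lemma mn_le_of_le {X : ℝ} {x y : ℝ} (hy : 0 < y) (h : y ≤ nd x) :
    mn X x ≤ 1 / (2 * y) := by
  unfold mn
  rw [one_div (2 * y)]
  apply inv_anti₀ (by positivity)
  exact le_max_of_le_right (by linarith)

lemma norm_expSum_linear_le {n : ℕ} {X : ℝ} (hX : 0 < X) (hn : n ≤ X) (x y : ℝ) :
    ‖expSum (fun t => x * t + y) n‖ ≤ mn X x := by
  unfold mn
  rcases le_total (1 / X) (2 * nd x) with h | h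
  · rw [max_eq_right h]
    have hp : 0 < 2 * nd x := lt_of_lt_of_le (by positivity) h
    have := norm_geom_le x (by linarith) y n
    rwa [one_div] at this
  · rw [max_eq_left h, one_div, inv_inv]
    exact (norm_expSum_le _ _).trans hn

lemma nd_eq_abs {x : ℝ} (h : |x| ≤ 1 / 2) : nd x = |x| := by
  refine le_antisymm (nd_le_abs x) ?_
  unfold nd
  by_cases h0 : round x = 0
  · simp [h0]
  · have h1 : (1 : ℝ) ≤ |(round x : ℝ)| := by
      exact_mod_cast Int.one_le_abs h0
    have := abs_sub_abs_le_abs_sub (round x : ℝ) x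
    rw [abs_sub_comm] at this
    linarith

lemma sum_Icc_natAbs (G : ℕ → ℝ) (q : ℕ) :
    ∑ v ∈ Icc (-(q : ℤ)) q, G v.natAbs = G 0 + 2 * ∑ j ∈ Icc 1 q, G j := by
  induction q with
  | zero => simp
  | succ q ih =>
    have : Icc (-((q + 1 : ℕ) : ℤ)) ((q + 1 : ℕ) : ℤ)
        = insert (-((q + 1 : ℕ) : ℤ)) (insert ((q + 1 : ℕ) : ℤ) (Icc (-(q : ℤ)) q)) := by
      ext v
      simp only [mem_insert, mem_Icc]
      omega
    rw [this, sum_insert (by simp; omega), sum_insert (by simp), ih, sum_Icc_succ_top (by omega),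
      Int.natAbs_neg, Int.natAbs_natCast]
    ring

lemma sum_zmod_valMinAbs_le {q : ℕ} [NeZero q] {G : ℕ → ℝ} (hG : ∀ j, 0 ≤ G j) :
    ∑ z : ZMod q, G z.valMinAbs.natAbs ≤ G 0 + 2 * ∑ j ∈ Icc 1 q, G j := by
  rw [← sum_Icc_natAbs]
  calc ∑ z : ZMod q, G z.valMinAbs.natAbs
      = ∑ v ∈ univ.image (fun z : ZMod q => z.valMinAbs), G v.natAbs := by
        rw [sum_image]
        intro x _ y _ h
        exact ZMod.injective_valMinAbs h
    _ ≤ _ := by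
      apply sum_le_sum_of_subset_of_nonneg
      · intro v hv
        obtain ⟨z, -, rfl⟩ := mem_image.mp hv
        have := ZMod.natAbs_valMinAbs_le z
        rw [mem_Icc]
        omega
      · intro v _ _
        exact hG _

lemma sum_range_cast_zmod {q : ℕ} [NeZero q] (F : ZMod q → ℝ) :
    ∑ k ∈ range q, F (k : ZMod q) = ∑ z : ZMod q, F z := by
  refine sum_nbij' (fun k => (k : ZMod q)) (fun z => z.val) ?_ ?_ ?_ ?_ ?_
  · simp
  · intro z _; simpa using ZMod.val_lt z
  · intro k hk; exact ZMod.val_cast_of_lt (mem_range.mp hk)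
  · intro z _; simp
  · simp

/-- A block of `q` consecutive multiples of `α`. -/
lemma sum_block_le {q : ℕ} (hq : 0 < q) {a : ℤ} (ha : IsUnit (a : ZMod q)) {α : ℝ}
    (hα : |α - a / q| ≤ 1 / (q : ℝ) ^ 2) {X : ℝ} (hX : 0 < X) (s : ℕ) :
    ∑ k ∈ range q, mn X (α * (s + k : ℕ)) ≤ 5 * X + q * (1 + Real.log q) := by
  have : NeZero q := ⟨hq.ne'⟩
  have hq0 : (0 : ℝ) < q := by exact_mod_cast hq
  let G : ℕ → ℝ := fun j => if j ≤ 2 then X else q / (2 * ((j - 2 : ℕ) : ℝ))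
  have hG : ∀ j, 0 ≤ G j := by
    intro j
    simp only [G]
    split_ifs <;> positivity
  set m : ℤ := round (α * s * q) with hm
  have key : ∀ k ∈ range q, mn X (α * (s + k : ℕ))
      ≤ G ((m : ZMod q) + (a : ZMod q) * (k : ZMod q)).valMinAbs.natAbs := by
    intro k hk
    set z : ZMod q := (m : ZMod q) + (a : ZMod q) * (k : ZMod q) with hz
    simp only [G]
    split_ifs with h
    · exact mn_le hX _
    · push Not at h
      have hj : (1 : ℝ) ≤ ((z.valMinAbs.natAbs - 2 : ℕ) : ℝ) := by
        exact_mod_cast (by omega : 1 ≤ z.valMinAbs.natAbs - 2)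
      obtain ⟨l, hl⟩ : (q : ℤ) ∣ (m + a * k) - z.valMinAbs := by
        rw [← ZMod.intCast_eq_intCast_iff_dvd_sub]
        simp [hz]
      have e1 : ((m : ℝ) + a * k) = z.valMinAbs + q * l := by
        have : m + a * k = z.valMinAbs + q * l := by linarith
        exact_mod_cast this
      have e2 : nd ((z.valMinAbs : ℝ) / q) = |(z.valMinAbs : ℝ)| / q := by
        rw [nd_eq_abs, abs_div, abs_of_pos hq0]
        rw [abs_div, abs_of_pos hq0, div_le_iff₀ hq0]
        have := ZMod.natAbs_valMinAbs_le z
        have h2 : 2 * z.valMinAbs.natAbs ≤ q := by omega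
        have h3 : (2 : ℝ) * |(z.valMinAbs : ℝ)| ≤ q := by
          rw [← Int.cast_abs, Int.abs_eq_natAbs]
          exact_mod_cast h2
        linarith
      have e3 : |α * (s + k : ℕ) - ((m : ℝ) + a * k) / q| ≤ 2 / q := by
        have e4 : α * (s + k : ℕ) - ((m : ℝ) + a * k) / q
            = (α * s * q - m) / q + (α - a / q) * k := by
          push_cast; field_simp; ring
        have e5 : |α * s * q - m| ≤ 1 / 2 := abs_sub_round _
        have hk' : (k : ℝ) ≤ q := by exact_mod_cast (mem_range.mp hk).le
        rw [e4]
        calc _ ≤ |(α * s * q - m) / q| + |(α - a / q) * k| := abs_add_le _ _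
          _ = |α * s * q - m| / q + |α - a / q| * k := by
            rw [abs_div, abs_mul, abs_of_pos hq0, Nat.abs_cast]
          _ ≤ (1 / 2) / q + 1 / (q : ℝ) ^ 2 * q := by gcongr
          _ ≤ _ := by field_simp; norm_num
      have e6 : |(z.valMinAbs : ℝ)| / q ≤ nd (α * (s + k : ℕ)) + 2 / q := by
        have e7 : (z.valMinAbs : ℝ) / q + l
            = α * (s + k : ℕ) + (((m : ℝ) + a * k) / q - α * (s + k : ℕ)) := by
          rw [e1]; field_simp; ring
        rw [← e2, ← nd_add_int _ l, e7]
        refine (nd_add_le _ _).trans ?_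
        gcongr
        refine (nd_le_abs _).trans ?_
        rwa [abs_sub_comm]
      have e8 : ((z.valMinAbs.natAbs - 2 : ℕ) : ℝ) / q ≤ nd (α * (s + k : ℕ)) := by
        rw [Nat.cast_sub (by omega), Nat.cast_natAbs, Int.cast_abs, sub_div, Nat.cast_ofNat]
        linarith
      refine (mn_le_of_le (by positivity) e8).trans (le_of_eq ?_)
      field_simp
  have hbij : ∑ k ∈ range q, G ((m : ZMod q) + (a : ZMod q) * (k : ZMod q)).valMinAbs.natAbs
      = ∑ z : ZMod q, G z.valMinAbs.natAbs := by
    refine (sum_range_cast_zmod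
      (fun z : ZMod q => G ((m : ZMod q) + (a : ZMod q) * z).valMinAbs.natAbs)).trans ?_
    obtain ⟨u, hu⟩ := ha
    rw [← hu]
    exact Fintype.sum_equiv ((Units.mulLeft u).trans (Equiv.addLeft (m : ZMod q))) _ _
      (fun z => rfl)
  have hsum : ∑ j ∈ Icc 1 q, G j ≤ 2 * X + q / 2 * (1 + Real.log q) := by
    have h1 : ∀ j ∈ Icc 1 q, G j ≤ (if j ≤ 2 then X else 0)
        + (if 3 ≤ j then q / 2 * (1 / ((j - 2 : ℕ) : ℝ)) else 0) := by
      intro j _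
      simp only [G]
      by_cases h : j ≤ 2
      · rw [if_pos h, if_pos h, if_neg (by omega)]; simp
      · rw [if_neg h, if_neg h, if_pos (by omega), zero_add]
        apply le_of_eq; field_simp
    refine (sum_le_sum h1).trans ?_
    rw [sum_add_distrib, ← sum_filter, ← sum_filter, sum_const, nsmul_eq_mul, ← mul_sum]
    have h2 : (((Icc 1 q).filter fun j => j ≤ 2).card : ℝ) ≤ 2 := by
      have : ((Icc 1 q).filter fun j => j ≤ 2) ⊆ Icc 1 2 := by
        intro j hj
        simp only [mem_filter, mem_Icc] at hj ⊢
        omega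
      exact_mod_cast (card_le_card this)
    have h3 : ∑ j ∈ (Icc 1 q).filter (fun j => 3 ≤ j), (1 : ℝ) / ((j - 2 : ℕ) : ℝ)
        ≤ 1 + Real.log q := by
      refine le_trans ?_ (sum_inv_Icc_le q)
      rw [← sum_image (g := fun j => j - 2) (f := fun i : ℕ => (1 : ℝ) / i)]
      · apply sum_le_sum_of_subset_of_nonneg
        · intro i hi
          simp only [mem_image, mem_filter, mem_Icc] at hi ⊢
          omega
        · intros; positivity
      · intro i hi j hj h
        simp only [coe_filter, mem_Icc, Set.mem_ofPred_eq] at hi hj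
        simp only at h
        omega
    gcongr
  calc _ ≤ ∑ k ∈ range q, G ((m : ZMod q) + (a : ZMod q) * (k : ZMod q)).valMinAbs.natAbs :=
        sum_le_sum key
    _ = _ := hbij
    _ ≤ _ := sum_zmod_valMinAbs_le hG
    _ ≤ X + 2 * (2 * X + q / 2 * (1 + Real.log q)) := by
      have : G 0 = X := by simp [G]
      rw [this]; gcongr
    _ = _ := by ring

lemma sum_range_mul_eq (f : ℕ → ℝ) (B q : ℕ) :
    ∑ k ∈ range (B * q), f k = ∑ b ∈ range B, ∑ r ∈ range q, f (b * q + r) := by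
  induction B with
  | zero => simp
  | succ B ih => rw [add_mul, one_mul, sum_range_add, ih, sum_range_succ]

lemma sum_mn_le {q : ℕ} (hq : 0 < q) {a : ℤ} (ha : IsUnit (a : ZMod q)) {α : ℝ}
    (hα : |α - a / q| ≤ 1 / (q : ℝ) ^ 2) {X : ℝ} (hX : 0 < X) (N : ℕ) :
    ∑ k ∈ Icc 1 N, mn X (α * k) ≤ (N / q + 1) * (5 * X + q * (1 + Real.log q)) := by
  have hlog : 0 ≤ Real.log q := Real.log_nonneg (by exact_mod_cast hq)
  have h1 : ∑ k ∈ Icc 1 N, mn X (α * k) = ∑ k ∈ range N, mn X (α * (k + 1 : ℕ)) := by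
    rw [range_eq_Ico, sum_Ico_add' (fun k : ℕ => mn X (α * k)) 0 N 1]
    rfl
  rw [h1]
  calc ∑ k ∈ range N, mn X (α * (k + 1 : ℕ))
      ≤ ∑ k ∈ range ((N / q + 1) * q), mn X (α * (k + 1 : ℕ)) := by
        apply sum_le_sum_of_subset_of_nonneg
        · rw [range_subset_range]
          have := Nat.lt_mul_div_succ N hq
          rw [mul_comm] at this
          omega
        · intros; exact mn_nonneg hX _
    _ = ∑ b ∈ range (N / q + 1), ∑ r ∈ range q, mn X (α * (b * q + 1 + r : ℕ)) := by
      rw [sum_range_mul_eq]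
      refine sum_congr rfl fun b _ => sum_congr rfl fun r _ => ?_
      rw [add_right_comm]
    _ ≤ ∑ b ∈ range (N / q + 1), (5 * X + q * (1 + Real.log q)) := by
      gcongr with b _
      exact sum_block_le hq ha hα hX _
    _ = ((N / q : ℕ) + 1) * (5 * X + q * (1 + Real.log q)) := by
      rw [sum_const, card_range, nsmul_eq_mul]; push_cast; ring
    _ ≤ _ := by
      gcongr
      exact Nat.cast_div_le

/-- Cauchy's inequality over the fibres of a map. -/
lemma sq_sum_comp_le {ι κ : Type*} [DecidableEq κ] (S : Finset ι) (K : Finset κ) (f : ι → κ)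
    (hf : ∀ i ∈ S, f i ∈ K) (w : κ → ℝ) :
    (∑ i ∈ S, w (f i)) ^ 2
      ≤ (((S ×ˢ S).filter fun p => f p.1 = f p.2).card : ℝ) * ∑ k ∈ K, w k ^ 2 := by
  have h1 : ∑ i ∈ S, w (f i) = ∑ k ∈ K, ((S.filter fun i => f i = k).card : ℝ) * w k := by
    rw [← sum_fiberwise_of_maps_to hf]
    refine sum_congr rfl fun k _ => ?_
    rw [sum_congr rfl (g := fun _ => w k), sum_const, nsmul_eq_mul]
    intro i hi
    rw [(mem_filter.mp hi).2]
  have h2 : (((S ×ˢ S).filter fun p => f p.1 = f p.2).card : ℝ)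
      = ∑ k ∈ K, ((S.filter fun i => f i = k).card : ℝ) ^ 2 := by
    have : ((S ×ˢ S).filter fun p => f p.1 = f p.2).card
        = ∑ k ∈ K, (S.filter fun i => f i = k).card ^ 2 := by
      rw [card_eq_sum_card_fiberwise (f := fun p => f p.1) (t := K)]
      · refine sum_congr rfl fun k _ => ?_
        rw [sq, ← card_product]
        congr 1
        ext p
        simp only [mem_filter, mem_product]
        constructor
        · rintro ⟨⟨⟨h1, h2⟩, h3⟩, h4⟩; exact ⟨⟨h1, h4⟩, h2, h3 ▸ h4⟩
        · rintro ⟨⟨h1, h2⟩, h3, h4⟩; exact ⟨⟨⟨h1, h3⟩, h2.trans h4.symm⟩, h2⟩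
      · intro p hp
        simp only [coe_filter, mem_product, Set.mem_ofPred_eq] at hp
        exact hf _ hp.1.1
    exact_mod_cast this
  rw [h1, h2]
  exact sum_mul_sq_le_sq_mul_sq _ _ _

/-- Weyl's inequality for phases whose third differences are `D * α * (h₁h₂h₃)` times the
variable, up to a constant. -/
theorem weyl_bound {g : ℕ → ℝ} {α : ℝ} {D : ℕ} (hD : 0 < D)
    (hg : ∀ a b c : ℕ, ∃ y : ℝ, dif c (dif b (dif a g))
      = fun t : ℕ => (α * ((D * (a * b * c) : ℕ) : ℝ)) * (t : ℝ) + y)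
    {X q : ℕ} (hX : 1 ≤ X) (hq : 0 < q) {a : ℤ} (ha : IsUnit (a : ZMod q))
    (hα : |α - a / q| ≤ 1 / (q : ℝ) ^ 2) :
    ‖expSum g X‖ ^ 8 ≤ 1000 * (X : ℝ) ^ 7 + 1024 * (X : ℝ) ^ 4 *
      √((X : ℝ) ^ 3 * (1 + Real.log X) ^ 6 *
        (X * ((D * X ^ 3 / q + 1) * (5 * X + q * (1 + Real.log q))))) := by
  have hX0 : (0 : ℝ) < X := by exact_mod_cast hX
  refine (norm_expSum_pow_eight_le g X hX).trans ?_
  gcongr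
  set S := Icc 1 X ×ˢ Icc 1 X ×ˢ Icc 1 X with hS
  have h1 : ∑ h ∈ S, ‖expSum (dif h.2.2 (dif h.2.1 (dif h.1 g))) (X - h.1 - h.2.1 - h.2.2)‖
      ≤ ∑ h ∈ S, mn X (α * (D * (h.1 * h.2.1 * h.2.2) : ℕ)) := by
    gcongr with h hh
    obtain ⟨y, hy⟩ := hg h.1 h.2.1 h.2.2
    rw [hy]
    exact norm_expSum_linear_le hX0 (by exact_mod_cast (by omega)) _ _
  refine h1.trans (Real.le_sqrt_of_sq_le ?_)
  have h2 := sq_sum_comp_le S (Icc 1 (X ^ 3)) (fun h => h.1 * h.2.1 * h.2.2) (by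
    intro h hh
    simp only [hS, mem_product, mem_Icc] at hh ⊢
    obtain ⟨⟨h1, h1'⟩, ⟨h2, h2'⟩, h3, h3'⟩ := hh
    refine ⟨Nat.mul_pos (Nat.mul_pos h1 h2) h3, ?_⟩
    calc _ ≤ X * X * X := by gcongr
      _ = _ := by ring) (fun k => mn X (α * (D * k : ℕ)))
  refine h2.trans ?_
  have h3 : (((S ×ˢ S).filter fun p => p.1.1 * p.1.2.1 * p.1.2.2 = p.2.1 * p.2.2.1 * p.2.2.2).card : ℝ)
      ≤ (X : ℝ) ^ 3 * (1 + Real.log X) ^ 6 := card_mulSexts_le hX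
  have h4 : ∑ k ∈ Icc 1 (X ^ 3), mn X (α * (D * k : ℕ)) ^ 2
      ≤ X * ((D * X ^ 3 / q + 1) * (5 * X + q * (1 + Real.log q))) := by
    calc _ ≤ ∑ k ∈ Icc 1 (X ^ 3), X * mn X (α * (D * k : ℕ)) := by
          gcongr with k _
          rw [sq]
          exact mul_le_mul_of_nonneg_right (mn_le hX0 _) (mn_nonneg hX0 _)
      _ = X * ∑ k ∈ Icc 1 (X ^ 3), mn X (α * (D * k : ℕ)) := by rw [mul_sum]
      _ ≤ X * ∑ k ∈ Icc 1 (D * X ^ 3), mn X (α * k) := by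
        gcongr
        rw [← sum_image (g := fun k => D * k) (f := fun i : ℕ => mn X (α * i))]
        · apply sum_le_sum_of_subset_of_nonneg
          · intro i hi
            simp only [mem_image, mem_Icc] at hi ⊢
            obtain ⟨k, ⟨hk, hk'⟩, rfl⟩ := hi
            exact ⟨Nat.mul_pos hD hk, Nat.mul_le_mul_left _ hk'⟩
          · intros; exact mn_nonneg hX0 _
        · intro i _ j _ h
          exact Nat.eq_of_mul_eq_mul_left hD h
      _ ≤ _ := by
        gcongr
        have := sum_mn_le hq ha hα hX0 (D * X ^ 3)
        push_cast at this
        exact this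
  gcongr

end Biquad

namespace Biquad
open Finset

/-- `((20 t + c) ^ 4 - c ^ 4) / 80`. -/
def phi (c t : ℕ) : ℕ := 2000 * t ^ 4 + 400 * c * t ^ 3 + 30 * c ^ 2 * t ^ 2 + c ^ 3 * t

lemma phi_spec (c t : ℕ) : 80 * phi c t + c ^ 4 = (20 * t + c) ^ 4 := by
  unfold phi; ring

/-- The exponential sum over biquadrates of the integers `20 t + c`. -/
noncomputable def fS (c X : ℕ) (α : ℝ) : ℂ := ∑ t ∈ Ioc X (2 * X), ex (α * phi c t)

lemma fS_eq_expSum (c X : ℕ) (α : ℝ) :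
    fS c X α = expSum (fun t => α * phi c (X + 1 + t)) X := by
  unfold fS expSum
  rw [range_eq_Ico, ← Ico_add_one_add_one_eq_Ioc, show 2 * X + 1 = X + (X + 1) by ring]
  have := sum_Ico_add' (fun t => ex (α * phi c t)) 0 X (X + 1)
  rw [zero_add] at this
  rw [← this]
  simp [add_comm, add_left_comm]

lemma norm_fS_le (c X : ℕ) (α : ℝ) : ‖fS c X α‖ ≤ X := by
  rw [fS_eq_expSum]; exact norm_expSum_le _ _

lemma dif_dif_dif_phi (c X : ℕ) (α : ℝ) (h₁ h₂ h₃ : ℕ) :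
    ∃ y : ℝ, dif h₃ (dif h₂ (dif h₁ fun t => α * phi c (X + 1 + t)))
      = fun t : ℕ => (α * ((48000 * (h₁ * h₂ * h₃) : ℕ) : ℝ)) * (t : ℝ) + y := by
  refine ⟨dif h₃ (dif h₂ (dif h₁ fun t => α * phi c (X + 1 + t))) 0, ?_⟩
  funext t
  simp only [dif, phi]
  push_cast
  ring

/-- A common scale: `X = 10 ^ 80 * l ^ 30` with `l ≥ 1`. -/
structure Scale (X : ℕ) (l : ℝ) : Prop where
  one_le : 1 ≤ l
  eq : (X : ℝ) = 10 ^ 80 * l ^ 30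

lemma exists_scale {X : ℕ} (hX : 10 ^ 80 ≤ X) : ∃ l, Scale X l := by
  have h : (1 : ℝ) ≤ X / 10 ^ 80 := by
    rw [le_div_iff₀ (by positivity), one_mul]; exact_mod_cast hX
  refine ⟨(X / 10 ^ 80 : ℝ) ^ ((1 : ℝ) / 30), Real.one_le_rpow h (by norm_num), ?_⟩
  rw [← Real.rpow_natCast _ 30, ← Real.rpow_mul (by positivity)]
  norm_num
  rw [mul_div_cancel₀ _ (by norm_num)]

lemma log_ten_lt : Real.log 10 < 2.3027 := by
  rw [show (10 : ℝ) = 2 * 5 by norm_num, Real.log_mul (by norm_num) (by norm_num)]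
  have h2 := Real.log_two_lt_d9
  have h5 : Real.log 5 < 1.6095 := by
    rw [Real.log_lt_iff_lt_exp (by norm_num)]
    have h1 : (1.6095 : ℝ) = 1 + 0.6095 := by norm_num
    rw [h1, Real.exp_add]
    have h3 := Real.exp_one_gt_d9
    have h4 : (1.83942 : ℝ) < Real.exp 0.6095 := by
      refine lt_of_lt_of_le ?_ (Real.sum_le_exp_of_nonneg (by norm_num) 10)
      norm_num [sum_range_succ, Nat.factorial]
    calc (5 : ℝ) < 2.7182818283 * 1.83942 := by norm_num
      _ ≤ _ := by gcongr
  linarith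

namespace Scale
variable {X : ℕ} {l : ℝ}

lemma pos (h : Scale X l) : 0 < l := lt_of_lt_of_le one_pos h.one_le

lemma log_le (h : Scale X l) : 1 + Real.log X ≤ 186 * l := by
  rw [h.eq, Real.log_mul (by positivity) (by have := h.pos; positivity), Real.log_pow, Real.log_pow]
  have h1 := log_ten_lt
  have h2 := Real.log_le_sub_one_of_pos h.pos
  have := h.one_le
  push_cast
  linarith

lemma le_cast (h : Scale X l) : (10 : ℝ) ^ 80 ≤ X := by
  rw [h.eq]
  have := one_le_pow₀ h.one_le (n := 30)
  linarith

lemma cast_pos (h : Scale X l) : (0 : ℝ) < X := lt_of_lt_of_le (by positivity) h.le_cast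

lemma one_le_X (h : Scale X l) : 1 ≤ X := by
  have := h.cast_pos
  exact_mod_cast this

end Scale

/-- Weyl's inequality on the minor arcs. -/
lemma norm_fS_le_of_minor {X : ℕ} {l : ℝ} (h : Scale X l) (c : ℕ) {q : ℕ} {a : ℤ} {α : ℝ}
    (ha : IsUnit (a : ZMod q)) (hα : |α - a / q| ≤ 1 / (q : ℝ) ^ 2)
    (hq : (X : ℝ) / (10 ^ 4 * l) ≤ q) (hq' : (q : ℝ) ≤ 2 * 10 ^ 9 * X ^ 3 * l) :
    ‖fS c X α‖ ≤ X / (900 * l) := by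
  have hl := h.pos
  have h1l := h.one_le
  have hX := h.cast_pos
  have hq0 : (0 : ℝ) < q := lt_of_lt_of_le (by positivity) hq
  have hqn : 0 < q := by exact_mod_cast hq0
  have hlogX := h.log_le
  have hlogX0 : 0 ≤ Real.log X := Real.log_nonneg (by exact_mod_cast h.one_le_X)
  set L := 1 + Real.log X with hL
  have hL1 : 1 ≤ L := by linarith
  have hlX : 2 * 10 ^ 9 * l ≤ X := by
    rw [h.eq]
    have : l ≤ l ^ 30 := le_self_pow₀ h1l (by norm_num)
    nlinarith
  have hlogq : 1 + Real.log q ≤ 4 * L := by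
    have : Real.log q ≤ Real.log ((X : ℝ) ^ 4) := by
      apply Real.log_le_log hq0
      calc (q : ℝ) ≤ (2 * 10 ^ 9 * l) * X ^ 3 := by linarith
        _ ≤ X * X ^ 3 := by gcongr
        _ = _ := by ring
    rw [Real.log_pow] at this
    push_cast at this
    linarith
  have key := weyl_bound (by norm_num) (dif_dif_dif_phi c X α) h.one_le_X hqn ha hα
  rw [← fS_eq_expSum] at key
  have h2 : ((48000 : ℕ) * (X : ℝ) ^ 3 / q + 1) * (5 * X + q * (1 + Real.log q))
      ≤ 9 * 10 ^ 9 * X ^ 3 * l * L := by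
    calc _ ≤ ((48000 : ℕ) * (X : ℝ) ^ 3 / q + 1) * (5 * X + q * (4 * L)) := by gcongr
      _ = 240000 * X ^ 3 * (X / q) + 192000 * X ^ 3 * L + 5 * X + 4 * q * L := by
        field_simp; push_cast; ring
      _ ≤ 240000 * X ^ 3 * (10 ^ 4 * l) + 192000 * X ^ 3 * L + 5 * X
          + 4 * (2 * 10 ^ 9 * X ^ 3 * l) * L := by
        gcongr
        rw [div_le_iff₀ hq0]
        rw [div_le_iff₀ (by positivity)] at hq
        linarith
      _ ≤ 240000 * X ^ 3 * (10 ^ 4 * l) * 1 + 192000 * X ^ 3 * L + 5 * (X ^ 3 * 1) * 1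
          + 4 * (2 * 10 ^ 9 * X ^ 3 * l) * L := by
        have : (X : ℝ) ≤ X ^ 3 := le_self_pow₀ (by exact_mod_cast h.one_le_X) (by norm_num)
        linarith
      _ ≤ 240000 * X ^ 3 * (10 ^ 4 * l) * (L / 100) + 192000 * X ^ 3 * L * l + 5 * (X ^ 3 * l) * L
          + 4 * (2 * 10 ^ 9 * X ^ 3 * l) * L := by
        have hL100 : 1 ≤ L / 100 := by
          have : (100 : ℝ) ≤ Real.log X := by
            rw [Real.le_log_iff_exp_le hX]
            refine le_trans ?_ h.le_cast
            rw [show (100 : ℝ) = (100 : ℕ) * 1 by norm_num, Real.exp_nat_mul]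
            calc _ ≤ (6 : ℝ) ^ 100 := by
                  gcongr
                  linarith [Real.exp_one_lt_d9]
              _ ≤ _ := by norm_num
          linarith
        gcongr ?_ + ?_ + ?_ + ?_
        · gcongr
        · nlinarith [mul_nonneg (pow_nonneg hX.le 3) (by linarith : 0 ≤ L)]
        · gcongr
        · exact le_refl _
      _ ≤ _ := by
        have : 0 ≤ X ^ 3 * l * L := by positivity
        nlinarith
  have h3 : √((X : ℝ) ^ 3 * L ^ 6 *
        (X * (((48000 : ℕ) * X ^ 3 / q + 1) * (5 * X + q * (1 + Real.log q)))))
        ≤ 8.4 * 10 ^ 12 * X ^ 4 / (10 ^ 40 * l ^ 11) := by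
    apply Real.sqrt_le_iff.mpr
    refine ⟨by positivity, ?_⟩
    calc _ ≤ (X : ℝ) ^ 3 * L ^ 6 * (X * (9 * 10 ^ 9 * X ^ 3 * l * L)) := by gcongr
      _ = 9 * 10 ^ 9 * X ^ 7 * l * L ^ 7 := by ring
      _ ≤ 9 * 10 ^ 9 * X ^ 7 * l * (186 * l) ^ 7 := by gcongr
      _ = 9 * 10 ^ 9 * 186 ^ 7 * l ^ 8 * X ^ 7 := by ring
      _ ≤ _ := by
        rw [div_pow, le_div_iff₀ (by positivity)]
        calc _ = (9 * 10 ^ 9 * 186 ^ 7) * X ^ 7 * (10 ^ 80 * l ^ 30) := by ring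
          _ = (9 * 10 ^ 9 * 186 ^ 7) * X ^ 8 := by rw [← h.eq]; ring
          _ ≤ _ := by
            have : (0 : ℝ) ≤ X ^ 8 := by positivity
            nlinarith
  have h4 : ‖fS c X α‖ ^ 8 ≤ (X / (900 * l)) ^ 8 := by
    refine key.trans ?_
    calc _ ≤ 1000 * (X : ℝ) ^ 7 + 1024 * X ^ 4 * (8.4 * 10 ^ 12 * X ^ 4 / (10 ^ 40 * l ^ 11)) := by
          gcongr
      _ ≤ 1000 * (X : ℝ) ^ 7 * (X / (10 ^ 80 * l ^ 8)) +
          1024 * X ^ 4 * (8.4 * 10 ^ 12 * X ^ 4 / (10 ^ 40 * l ^ 8)) := by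
        gcongr ?_ + ?_
        · apply le_mul_of_one_le_right (by positivity)
          rw [one_le_div (by positivity), h.eq]
          gcongr
          · norm_num
        · gcongr
          norm_num
      _ = X ^ 8 / l ^ 8 * (1000 / 10 ^ 80 + 1024 * 8.4 * 10 ^ 12 / 10 ^ 40) := by
        field_simp
      _ ≤ X ^ 8 / l ^ 8 * (1 / 900 ^ 8) := by gcongr; norm_num
      _ = _ := by field_simp
  exact le_of_pow_le_pow_left₀ (by norm_num) (by positivity) h4

end Biquad

namespace Biquad
open Finset

lemma card_sq_le_card_image_mul {ι κ : Type*} [DecidableEq κ] (S : Finset ι) (f : ι → κ) :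
    (S.card : ℝ) ^ 2 ≤ (((S ×ˢ S).filter fun p => f p.1 = f p.2).card : ℝ) * (S.image f).card := by
  have := sq_sum_comp_le S (S.image f) f (fun i hi => mem_image_of_mem f hi) (fun _ => 1)
  simpa using this

/-- The norm form `x² + x y + y²`. -/
def qf (x y : ℕ) : ℕ := x ^ 2 + x * y + y ^ 2

lemma qf_spec (x y : ℕ) : x ^ 4 + y ^ 4 + (x + y) ^ 4 = 2 * qf x y ^ 2 := by
  unfold qf; ring

/-- Values of the norm form at pairs of integers of parity `e`. -/
def qVals (e K : ℕ) : Finset ℕ :=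
  (Icc 1 K ×ˢ Icc 1 K).image fun p => qf (2 * p.1 + e) (2 * p.2 + e)

lemma qf_collision {e x y x' y' : ℕ}
    (h : qf (2 * x + e) (2 * y + e) = qf (2 * x' + e) (2 * y' + e)) :
    (2 * ((x : ℤ) - x') + (y - y')) * (2 * (x + x') + (y + y') + 3 * e)
      = 3 * ((y' - y) * (y + y' + e)) := by
  unfold qf at h
  zify at h
  linarith

/-- Collisions of the norm form with increasing second coordinate. -/
def qColl (e K : ℕ) : Finset ((ℕ × ℕ) × (ℕ × ℕ)) :=
  ((Icc 1 K ×ˢ Icc 1 K) ×ˢ (Icc 1 K ×ˢ Icc 1 K)).filter fun p =>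
    qf (2 * p.1.1 + e) (2 * p.1.2 + e) = qf (2 * p.2.1 + e) (2 * p.2.2 + e) ∧ p.1.2 < p.2.2

lemma qColl_pos {e x y x' y' : ℕ} (hx : 1 ≤ x)
    (h : qf (2 * x + e) (2 * y + e) = qf (2 * x' + e) (2 * y' + e)) (hy : y < y') :
    0 < 2 * ((x : ℤ) - x') + (y - y') := by
  have h1 := qf_collision h
  have h2 : (0 : ℤ) < 3 * ((y' - y) * (y + y' + e)) := by
    have : (0 : ℤ) < y' - y := by omega
    have : (0 : ℤ) < y + y' + e := by omega
    positivity
  rw [← h1] at h2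
  exact pos_of_mul_pos_left h2 (by positivity)

set_option maxHeartbeats 1000000 in
lemma card_qColl_le {e K : ℕ} (he : e ≤ 1) (hK : 1 ≤ K) :
    ((qColl e K).card : ℝ) ≤ (20 * (K : ℝ) ^ 2 + 10 * K) * (1 + Real.log (2 * K)) := by
  have h1 : (qColl e K).card ≤ (mulQuads K (6 * K + 3)).card + (mulQuads (2 * K) (2 * K + 1)).card := by
    have hsub : qColl e K ⊆ ((qColl e K).filter fun p => 3 ∣ (2 * ((p.1.1 : ℤ) - p.2.1) + (p.1.2 - p.2.2)))
        ∪ ((qColl e K).filter fun p => 3 ∣ (2 * ((p.1.1 : ℤ) + p.2.1) + (p.1.2 + p.2.2) + 3 * e)) := by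
      intro p hp
      rw [mem_union, mem_filter, mem_filter]
      have hp' := hp
      rw [qColl, mem_filter] at hp'
      have h2 := qf_collision hp'.2.1
      have h3 : (3 : ℤ) ∣ (2 * ((p.1.1 : ℤ) - p.2.1) + (p.1.2 - p.2.2))
          * (2 * (p.1.1 + p.2.1) + (p.1.2 + p.2.2) + 3 * e) := by
        rw [h2]; exact dvd_mul_right _ _
      rcases Int.Prime.dvd_mul' Nat.prime_three h3 with h | h
      · exact Or.inl ⟨hp, by exact_mod_cast h⟩
      · exact Or.inr ⟨hp, by exact_mod_cast h⟩
    refine (card_le_card hsub).trans ((card_union_le _ _).trans (add_le_add ?_ ?_))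
    · refine card_le_card_of_injOn (fun p => (((2 * p.1.1 + p.1.2 - 2 * p.2.1 - p.2.2) / 3,
        2 * (p.1.1 + p.2.1) + (p.1.2 + p.2.2) + 3 * e), (p.2.2 - p.1.2, p.1.2 + p.2.2 + e))) ?_ ?_
      · intro p hp
        rw [mem_coe, mem_filter, qColl, mem_filter] at hp
        obtain ⟨⟨hm, hq, hlt⟩, h3⟩ := hp
        obtain ⟨⟨x, y⟩, ⟨x', y'⟩⟩ := p
        simp only [mem_product, mem_Icc] at hm hq hlt h3 ⊢
        have hpos := qColl_pos hm.1.1.1 hq hlt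
        have hc := qf_collision hq
        obtain ⟨c, hc3⟩ := h3
        have e1 : (2 * x + y - 2 * x' - y') / 3 = c.toNat := by omega
        have hcp : 0 < c := by omega
        lift c to ℕ using hcp.le
        rw [mem_coe, mulQuads, mem_filter]
        simp only [mem_product, mem_Icc]
        rw [e1, Int.toNat_natCast]
        refine ⟨⟨⟨⟨by omega, by omega⟩, by omega, by omega⟩, ⟨by omega, by omega⟩, by omega, by omega⟩, ?_⟩
        rw [hc3] at hc
        zify [hlt.le]
        linarith
      · intro p hp p' hp' heq
        rw [mem_coe, mem_filter, qColl, mem_filter] at hp hp'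
        obtain ⟨⟨hm, hq, hlt⟩, h3⟩ := hp
        obtain ⟨⟨hm', hq', hlt'⟩, h3'⟩ := hp'
        obtain ⟨⟨x, y⟩, ⟨x', y'⟩⟩ := p
        obtain ⟨⟨x1, y1⟩, ⟨x1', y1'⟩⟩ := p'
        simp only [mem_product, mem_Icc, Prod.mk.injEq] at hm hq hlt hm' hq' hlt' h3 h3' heq ⊢
        have hpos := qColl_pos hm.1.1.1 hq hlt
        have hpos' := qColl_pos hm'.1.1.1 hq' hlt'
        omega
    · refine card_le_card_of_injOn (fun p => ((2 * p.1.1 + p.1.2 - 2 * p.2.1 - p.2.2,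
        (2 * (p.1.1 + p.2.1) + (p.1.2 + p.2.2) + 3 * e) / 3), (p.2.2 - p.1.2, p.1.2 + p.2.2 + e))) ?_ ?_
      · intro p hp
        rw [mem_coe, mem_filter, qColl, mem_filter] at hp
        obtain ⟨⟨hm, hq, hlt⟩, h3⟩ := hp
        obtain ⟨⟨x, y⟩, ⟨x', y'⟩⟩ := p
        simp only [mem_product, mem_Icc] at hm hq hlt h3 ⊢
        have hpos := qColl_pos hm.1.1.1 hq hlt
        have hc := qf_collision hq
        obtain ⟨c, hc3⟩ := h3
        have e1 : (2 * (x + x') + (y + y') + 3 * e) / 3 = c.toNat := by omega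
        have hcp : 0 < c := by omega
        lift c to ℕ using hcp.le
        rw [mem_coe, mulQuads, mem_filter]
        simp only [mem_product, mem_Icc]
        rw [e1, Int.toNat_natCast]
        refine ⟨⟨⟨⟨by omega, by omega⟩, by omega, by omega⟩, ⟨by omega, by omega⟩, by omega, by omega⟩, ?_⟩
        rw [hc3] at hc
        have e2 : ((2 * x + y - 2 * x' - y' : ℕ) : ℤ) = 2 * ((x : ℤ) - x') + (y - y') := by omega
        zify [hlt.le]
        rw [e2]
        linarith
      · intro p hp p' hp' heq
        rw [mem_coe, mem_filter, qColl, mem_filter] at hp hp'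
        obtain ⟨⟨hm, hq, hlt⟩, h3⟩ := hp
        obtain ⟨⟨hm', hq', hlt'⟩, h3'⟩ := hp'
        obtain ⟨⟨x, y⟩, ⟨x', y'⟩⟩ := p
        obtain ⟨⟨x1, y1⟩, ⟨x1', y1'⟩⟩ := p'
        simp only [mem_product, mem_Icc, Prod.mk.injEq] at hm hq hlt hm' hq' hlt' h3 h3' heq ⊢
        have hpos := qColl_pos hm.1.1.1 hq hlt
        have hpos' := qColl_pos hm'.1.1.1 hq' hlt'
        omega
  have hK1 : (1 : ℝ) ≤ K := by exact_mod_cast hK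
  have hlog : 0 ≤ Real.log (2 * K) := Real.log_nonneg (by linarith)
  have hlog' : Real.log K ≤ Real.log (2 * K) := Real.log_le_log (by linarith) (by linarith)
  have h2 := card_mulQuads_le K (6 * K + 3)
  have h3 := card_mulQuads_le (2 * K) (2 * K + 1)
  push_cast at h2 h3
  calc ((qColl e K).card : ℝ) ≤ (mulQuads K (6 * K + 3)).card + (mulQuads (2 * K) (2 * K + 1)).card := by
        exact_mod_cast h1
    _ ≤ 2 * K * (6 * K + 3) * (1 + Real.log K) + 2 * (2 * K) * (2 * K + 1) * (1 + Real.log (2 * K)) :=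
      add_le_add h2 h3
    _ ≤ 2 * K * (6 * K + 3) * (1 + Real.log (2 * K))
        + 2 * (2 * K) * (2 * K + 1) * (1 + Real.log (2 * K)) := by gcongr
    _ = _ := by ring

lemma card_qVals_ge {e K : ℕ} (he : e ≤ 1) (hK : 1 ≤ K) :
    (K : ℝ) ^ 4 ≤ ((K : ℝ) ^ 2 + (40 * (K : ℝ) ^ 2 + 20 * K) * (1 + Real.log (2 * K)))
      * (qVals e K).card := by
  have h1 := card_sq_le_card_image_mul (Icc 1 K ×ˢ Icc 1 K)
    (fun p => qf (2 * p.1 + e) (2 * p.2 + e))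
  have h2 : (((Icc 1 K ×ˢ Icc 1 K) ×ˢ (Icc 1 K ×ˢ Icc 1 K)).filter fun p =>
      qf (2 * p.1.1 + e) (2 * p.1.2 + e) = qf (2 * p.2.1 + e) (2 * p.2.2 + e)).card
      ≤ K ^ 2 + 2 * (qColl e K).card := by
    have hsub : (((Icc 1 K ×ˢ Icc 1 K) ×ˢ (Icc 1 K ×ˢ Icc 1 K)).filter fun p =>
        qf (2 * p.1.1 + e) (2 * p.1.2 + e) = qf (2 * p.2.1 + e) (2 * p.2.2 + e))
        ⊆ ((Icc 1 K ×ˢ Icc 1 K).image fun p => (p, p)) ∪ (qColl e K ∪ (qColl e K).image Prod.swap) := by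
      intro p hp
      obtain ⟨⟨x, y⟩, ⟨x', y'⟩⟩ := p
      rw [mem_filter] at hp
      obtain ⟨hm, hq⟩ := hp
      rw [mem_union, mem_union]
      rcases lt_trichotomy y y' with h | h | h
      · right; left
        rw [qColl, mem_filter]
        exact ⟨hm, hq, h⟩
      · left
        subst h
        have hc := qf_collision hq
        simp only [mem_product, mem_Icc] at hm
        have : x = x' := by
          have h0 : (2 * ((x : ℤ) - x') + (y - y)) * (2 * (x + x') + (y + y) + 3 * e) = 0 := by
            rw [hc]; ring
          rcases mul_eq_zero.mp h0 with h | h <;> omega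
        subst this
        simp [hm]
      · right; right
        rw [mem_image]
        refine ⟨((x', y'), (x, y)), ?_, rfl⟩
        rw [qColl, mem_filter]
        rw [mem_product] at hm
        exact ⟨mem_product.mpr ⟨hm.2, hm.1⟩, hq.symm, h⟩
    refine (card_le_card hsub).trans ?_
    refine (card_union_le _ _).trans ?_
    refine add_le_add (card_image_le.trans (by simp [sq])) ?_
    refine (card_union_le _ _).trans ?_
    rw [two_mul]
    exact add_le_add le_rfl card_image_le
  have h3 := card_qColl_le he hK
  have h4 : ((Icc 1 K ×ˢ Icc 1 K).card : ℝ) ^ 2 = (K : ℝ) ^ 4 := by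
    simp only [card_product, Nat.card_Icc, Nat.add_sub_cancel]; push_cast; ring
  rw [h4] at h1
  refine h1.trans ?_
  have h5 : ((((Icc 1 K ×ˢ Icc 1 K) ×ˢ (Icc 1 K ×ˢ Icc 1 K)).filter fun p =>
      qf (2 * p.1.1 + e) (2 * p.1.2 + e) = qf (2 * p.2.1 + e) (2 * p.2.2 + e)).card : ℝ)
      ≤ (K : ℝ) ^ 2 + 2 * (qColl e K).card := by exact_mod_cast h2
  unfold qVals
  gcongr
  linarith

end Biquad

namespace Biquad
open Finset

lemma qVals_bound {e K k : ℕ} (he : e ≤ 1) (hk : k ∈ qVals e K) :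
    1 ≤ k ∧ k ≤ 3 * (2 * K + 1) ^ 2 ∧ k % 2 = e := by
  unfold qVals at hk
  obtain ⟨⟨x, y⟩, hxy, rfl⟩ := mem_image.mp hk
  simp only [mem_product, mem_Icc] at hxy
  obtain ⟨⟨hx, hx'⟩, hy, hy'⟩ := hxy
  unfold qf
  refine ⟨?_, ?_, ?_⟩
  · have : 1 ≤ 2 * x + e := by omega
    nlinarith [Nat.zero_le ((2 * x + e) * (2 * y + e)), Nat.zero_le ((2 * y + e) ^ 2)]
  · have h1 : 2 * x + e ≤ 2 * K + 1 := by omega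
    have h2 : 2 * y + e ≤ 2 * K + 1 := by omega
    calc _ ≤ (2 * K + 1) ^ 2 + (2 * K + 1) * (2 * K + 1) + (2 * K + 1) ^ 2 := by gcongr
      _ = _ := by ring
  · interval_cases e <;> ring_nf <;> omega

/-- Pairs with equal sums of squares and decreasing first entry. -/
def sqColl (L : Finset ℕ) : Finset ((ℕ × ℕ) × (ℕ × ℕ)) :=
  ((L ×ˢ L) ×ˢ (L ×ˢ L)).filter fun p =>
    2 * (p.1.1 ^ 2 + p.1.2 ^ 2) = 2 * (p.2.1 ^ 2 + p.2.2 ^ 2) ∧ p.2.1 < p.1.1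

lemma card_sqColl_le {L : Finset ℕ} {e N : ℕ} (hL : ∀ k ∈ L, 1 ≤ k ∧ k ≤ 2 * N + 1 ∧ k % 2 = e) :
    (sqColl L).card ≤ (mulQuads N (2 * N)).card := by
  have hlt : ∀ {k l m n : ℕ}, 2 * (k ^ 2 + l ^ 2) = 2 * (m ^ 2 + n ^ 2) → m < k → l < n := by
    intro k l m n h1 h2
    have := Nat.pow_lt_pow_left h2 (n := 2) (by norm_num)
    exact lt_of_pow_lt_pow_left₀ 2 (by positivity) (by omega)
  refine card_le_card_of_injOn (fun p => (((p.1.1 - p.2.1) / 2, (p.1.1 + p.2.1) / 2),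
    ((p.2.2 - p.1.2) / 2, (p.2.2 + p.1.2) / 2))) ?_ ?_
  · intro p hp
    obtain ⟨⟨k, l⟩, ⟨m, n⟩⟩ := p
    rw [mem_coe, sqColl, mem_filter] at hp
    simp only [mem_product] at hp
    obtain ⟨⟨⟨hk, hl⟩, hm, hn⟩, heq, hlt1⟩ := hp
    have hlt2 := hlt heq hlt1
    have := hL _ hk
    have := hL _ hl
    have := hL _ hm
    have := hL _ hn
    obtain ⟨u, rfl⟩ : ∃ u, k = m + 2 * u := ⟨(k - m) / 2, by omega⟩
    obtain ⟨v, rfl⟩ : ∃ v, n = l + 2 * v := ⟨(n - l) / 2, by omega⟩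
    have e1 : (m + 2 * u - m) / 2 = u := by omega
    have e2 : (m + 2 * u + m) / 2 = m + u := by omega
    have e3 : (l + 2 * v - l) / 2 = v := by omega
    have e4 : (l + 2 * v + l) / 2 = l + v := by omega
    rw [mem_coe, mulQuads, mem_filter]
    simp only [mem_product, mem_Icc, e1, e2, e3, e4]
    refine ⟨⟨⟨⟨by omega, by omega⟩, by omega, by omega⟩, ⟨by omega, by omega⟩, by omega, by omega⟩, ?_⟩
    nlinarith
  · intro p hp p' hp' heq'
    obtain ⟨⟨k, l⟩, ⟨m, n⟩⟩ := p
    obtain ⟨⟨k', l'⟩, ⟨m', n'⟩⟩ := p'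
    rw [mem_coe, sqColl, mem_filter] at hp hp'
    simp only [mem_product] at hp hp'
    obtain ⟨⟨⟨hk, hl⟩, hm, hn⟩, heq, hlt1⟩ := hp
    obtain ⟨⟨⟨hk', hl'⟩, hm', hn'⟩, heq1, hlt1'⟩ := hp'
    have hlt2 := hlt heq hlt1
    have hlt2' := hlt heq1 hlt1'
    have := (hL _ hk).2.2
    have := (hL _ hl).2.2
    have := (hL _ hm).2.2
    have := (hL _ hn).2.2
    have := (hL _ hk').2.2
    have := (hL _ hl').2.2
    have := (hL _ hm').2.2
    have := (hL _ hn').2.2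
    simp only [Prod.mk.injEq] at heq' ⊢
    omega

/-- The numbers `2 (k² + l²)` with `k, l ∈ L`. -/
def sqSums (L : Finset ℕ) : Finset ℕ := (L ×ˢ L).image fun p => 2 * (p.1 ^ 2 + p.2 ^ 2)

lemma card_sqSums_ge {L : Finset ℕ} {e N : ℕ} (hL : ∀ k ∈ L, 1 ≤ k ∧ k ≤ 2 * N + 1 ∧ k % 2 = e) :
    (L.card : ℝ) ^ 4 ≤ ((L.card : ℝ) ^ 2 + 8 * N ^ 2 * (1 + Real.log N)) * (sqSums L).card := by
  have h1 := card_sq_le_card_image_mul (L ×ˢ L) (fun p => 2 * (p.1 ^ 2 + p.2 ^ 2))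
  have h2 : (((L ×ˢ L) ×ˢ (L ×ˢ L)).filter fun p =>
      2 * (p.1.1 ^ 2 + p.1.2 ^ 2) = 2 * (p.2.1 ^ 2 + p.2.2 ^ 2)).card
      ≤ L.card ^ 2 + 2 * (sqColl L).card := by
    have hsub : (((L ×ˢ L) ×ˢ (L ×ˢ L)).filter fun p =>
        2 * (p.1.1 ^ 2 + p.1.2 ^ 2) = 2 * (p.2.1 ^ 2 + p.2.2 ^ 2))
        ⊆ ((L ×ˢ L).image fun p => (p, p)) ∪ (sqColl L ∪ (sqColl L).image Prod.swap) := by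
      intro p hp
      obtain ⟨⟨x, y⟩, ⟨x', y'⟩⟩ := p
      rw [mem_filter] at hp
      obtain ⟨hm, hq⟩ := hp
      rw [mem_union, mem_union]
      rcases lt_trichotomy x x' with h | h | h
      · right; right
        rw [mem_image]
        refine ⟨((x', y'), (x, y)), ?_, rfl⟩
        rw [sqColl, mem_filter]
        rw [mem_product] at hm
        exact ⟨mem_product.mpr ⟨hm.2, hm.1⟩, hq.symm, h⟩
      · left
        subst h
        have : y = y' := by
          have : y ^ 2 = y' ^ 2 := by simp only at hq; omega
          exact Nat.pow_left_injective (n := 2) (by norm_num) this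
        subst this
        simp only [mem_product] at hm
        simp [hm]
      · right; left
        rw [sqColl, mem_filter]
        exact ⟨hm, hq, h⟩
    refine (card_le_card hsub).trans ?_
    refine (card_union_le _ _).trans ?_
    refine add_le_add (card_image_le.trans (by simp [sq])) ?_
    refine (card_union_le _ _).trans ?_
    rw [two_mul]
    exact add_le_add le_rfl card_image_le
  have h3 : ((sqColl L).card : ℝ) ≤ 2 * N * (2 * N) * (1 + Real.log N) := by
    have := card_mulQuads_le N (2 * N)
    push_cast at this
    exact le_trans (by exact_mod_cast card_sqColl_le hL) this
  rw [card_product] at h1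
  have h4 : (((L.card * L.card : ℕ) : ℝ)) ^ 2 = (L.card : ℝ) ^ 4 := by push_cast; ring
  rw [h4] at h1
  refine h1.trans ?_
  have h5 : ((((L ×ˢ L) ×ˢ (L ×ˢ L)).filter fun p =>
      2 * (p.1.1 ^ 2 + p.1.2 ^ 2) = 2 * (p.2.1 ^ 2 + p.2.2 ^ 2)).card : ℝ)
      ≤ (L.card : ℝ) ^ 2 + 2 * (sqColl L).card := by exact_mod_cast h2
  unfold sqSums
  gcongr
  linarith

lemma mem_sqSums_qVals {e K a : ℕ} (he : e ≤ 1) (ha : a ∈ sqSums (qVals e K)) :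
    a % 16 = 4 * e ∧ a ≤ 36 * (2 * K + 1) ^ 4 ∧
      ∃ z : Fin 6 → ℕ, (∀ i, 0 < z i) ∧ ∑ i, z i ^ 4 = a := by
  unfold sqSums at ha
  obtain ⟨⟨k, l⟩, hkl, rfl⟩ := mem_image.mp ha
  rw [mem_product] at hkl
  obtain ⟨hk, hl⟩ := hkl
  simp only at hk hl
  refine ⟨?_, ?_, ?_⟩
  · have key : ∀ {e k K : ℕ}, e ≤ 1 → k ∈ qVals e K → k ^ 2 % 8 = e ∨ (e = 0 ∧ k ^ 2 % 16 = 0) := by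
      intro e k K he hk
      unfold qVals at hk
      obtain ⟨⟨x, y⟩, -, rfl⟩ := mem_image.mp hk
      interval_cases e
      · right
        refine ⟨rfl, ?_⟩
        simp only
        have : (qf (2 * x + 0) (2 * y + 0)) ^ 2 = 16 * (qf x y) ^ 2 := by unfold qf; ring
        omega
      · left
        have h1 : (qf (2 * x + 1) (2 * y + 1)) % 2 = 1 := by unfold qf; ring_nf; omega
        have h2 : ∀ n : ℕ, n % 2 = 1 → n ^ 2 % 8 = 1 := by
          intro n hn
          have : n % 8 = 1 ∨ n % 8 = 3 ∨ n % 8 = 5 ∨ n % 8 = 7 := by omega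
          rcases this with h | h | h | h <;> simp [Nat.pow_mod, h]
        exact h2 _ h1
    have h1 := key he hk
    have h2 := key he hl
    simp only
    omega
  · have h1 := (qVals_bound he hk).2.1
    have h2 := (qVals_bound he hl).2.1
    calc _ ≤ 2 * ((3 * (2 * K + 1) ^ 2) ^ 2 + (3 * (2 * K + 1) ^ 2) ^ 2) := by gcongr
      _ = _ := by ring
  · unfold qVals at hk hl
    obtain ⟨⟨x, y⟩, hxy, rfl⟩ := mem_image.mp hk
    obtain ⟨⟨x', y'⟩, hxy', rfl⟩ := mem_image.mp hl
    simp only [mem_product, mem_Icc] at hxy hxy'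
    refine ⟨![2 * x + e, 2 * y + e, (2 * x + e) + (2 * y + e), 2 * x' + e, 2 * y' + e,
      (2 * x' + e) + (2 * y' + e)], ?_, ?_⟩
    · intro i
      fin_cases i <;> simp <;> omega
    · simp only [Fin.sum_univ_six]
      simp only [Matrix.cons_val]
      have h1 := qf_spec (2 * x + e) (2 * y + e)
      have h2 := qf_spec (2 * x' + e) (2 * y' + e)
      linarith

lemma card_sqSums_qVals_ge {X : ℕ} {l : ℝ} (h : Scale X l) {e : ℕ} (he : e ≤ 1) :
    3.6 / 10 ^ 18 * (X : ℝ) ^ 4 / l ^ 5 ≤ (sqSums (qVals e (6 * X))).card := by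
  set K := 6 * X with hKdef
  have hK : (K : ℝ) = 6 * X := by rw [hKdef]; push_cast; ring
  have hX := h.cast_pos
  have hX80 := h.le_cast
  have h1X := h.one_le_X
  have hl := h.pos
  have h1l := h.one_le
  have hlog := h.log_le
  have hlog0 : 0 ≤ Real.log X := Real.log_nonneg (by exact_mod_cast h1X)
  have hlX : 1 + Real.log X ≤ 185.25 * l := by
    rw [h.eq, Real.log_mul (by positivity) (by positivity), Real.log_pow, Real.log_pow]
    have h1 := log_ten_lt
    have h2 := Real.log_le_sub_one_of_pos hl
    push_cast
    linarith
  have hlogc : ∀ c : ℝ, 0 < c → c ≤ 1000 → Real.log c ≤ 6.91 := by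
    intro c hc hc'
    have h1 := log_ten_lt
    calc Real.log c ≤ Real.log (10 ^ 3) := Real.log_le_log hc (by linarith)
      _ = 3 * Real.log 10 := by rw [Real.log_pow]; norm_num
      _ ≤ _ := by linarith
  have hlog12 : Real.log 12 ≤ 2.503 := by
    have : Real.log 12 ≤ Real.log (10 * 1.2) := Real.log_le_log (by norm_num) (by norm_num)
    rw [Real.log_mul (by norm_num) (by norm_num)] at this
    have := Real.log_le_sub_one_of_pos (show (0 : ℝ) < 1.2 by norm_num)
    linarith [log_ten_lt]
  have hL1 : 1 + Real.log (2 * K) ≤ 187.8 * l := by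
    rw [hK, show 2 * (6 * (X : ℝ)) = 12 * X by ring, Real.log_mul (by norm_num) hX.ne']
    linarith
  have hl2K : 0 ≤ Real.log (2 * K) := Real.log_nonneg (by rw [hK]; linarith)
  set Q := ((qVals e K).card : ℝ) with hQ
  have hK0 : (0 : ℝ) < K := by rw [hK]; linarith
  have hQlow : (K : ℝ) ^ 2 ≤ 7520 * l * Q := by
    have h1 := card_qVals_ge he (show 1 ≤ K by omega)
    have h2 : (K : ℝ) ^ 2 + (40 * (K : ℝ) ^ 2 + 20 * K) * (1 + Real.log (2 * K)) ≤ (K : ℝ) ^ 2 * (7520 * l) := by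
      calc _ ≤ (K : ℝ) ^ 2 * l + (40 * (K : ℝ) ^ 2 + 20 * K) * (187.8 * l) := by
            gcongr
            apply le_mul_of_one_le_right (by positivity) h1l
        _ ≤ (K : ℝ) ^ 2 * l + (40.001 * (K : ℝ) ^ 2) * (187.8 * l) := by
          gcongr ?_ + ?_ * _
          rw [hK]; nlinarith
        _ ≤ _ := by nlinarith [mul_pos (pow_pos hK0 2) hl]
    have h3 : (K : ℝ) ^ 2 * K ^ 2 ≤ (K : ℝ) ^ 2 * (7520 * l * Q) := by
      calc _ = (K : ℝ) ^ 4 := by ring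
        _ ≤ _ := h1
        _ ≤ ((K : ℝ) ^ 2 * (7520 * l)) * Q := by gcongr
        _ = _ := by ring
    exact le_of_mul_le_mul_left h3 (by positivity)
  obtain ⟨N, hN⟩ : ∃ N, N = (3 * (2 * K + 1) ^ 2) / 2 := ⟨_, rfl⟩
  have hNub : (N : ℝ) ≤ 6.0001 * K ^ 2 := by
    have h1 : (N : ℝ) ≤ ((3 * (2 * K + 1) ^ 2 : ℕ) : ℝ) / 2 := by
      rw [hN]; exact Nat.cast_div_le
    push_cast at h1
    refine h1.trans ?_
    rw [hK]; nlinarith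
  have hN0 : 1 ≤ N := by
    rw [hN]
    have : 1 ≤ (2 * K + 1) ^ 2 := Nat.one_le_pow _ _ (by omega)
    omega
  have hLQ : ∀ k ∈ qVals e K, 1 ≤ k ∧ k ≤ 2 * N + 1 ∧ k % 2 = e := by
    intro k hk
    obtain ⟨h1, h2, h3⟩ := qVals_bound he hk
    exact ⟨h1, by omega, h3⟩
  have hQub : Q ≤ 12.1 * K ^ 2 := by
    have h1 : (qVals e K) ⊆ range (2 * N + 2) := by
      intro k hk
      rw [mem_range]
      have := (hLQ k hk).2.1
      omega
    have h2 : Q ≤ 2 * N + 2 := by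
      have := card_le_card h1
      rw [card_range] at this
      rw [hQ]; exact_mod_cast this
    have : (2 : ℝ) ≤ 0.0001 * K ^ 2 := by rw [hK]; nlinarith
    linarith
  have hlN : 1 + Real.log N ≤ 377 * l := by
    have h1 : Real.log N ≤ Real.log (217 * X ^ 2) := by
      apply Real.log_le_log (by exact_mod_cast hN0)
      refine hNub.trans ?_
      rw [hK]; nlinarith
    rw [Real.log_mul (by norm_num) (by positivity), Real.log_pow] at h1
    have := hlogc 217 (by norm_num) (by norm_num)
    push_cast at h1
    linarith
  have hA := card_sqSums_ge hLQ
  rw [← hQ] at hA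
  set A := ((sqSums (qVals e K)).card : ℝ) with hAdef
  have hE : Q ^ 2 + 8 * N ^ 2 * (1 + Real.log N) ≤ 1.09 * 10 ^ 5 * K ^ 4 * l := by
    calc _ ≤ (12.1 * (K : ℝ) ^ 2) ^ 2 * l + 8 * (6.0001 * (K : ℝ) ^ 2) ^ 2 * (377 * l) := by
          gcongr ?_ + 8 * ?_ ^ 2 * ?_
          · calc Q ^ 2 ≤ (12.1 * (K : ℝ) ^ 2) ^ 2 := by gcongr
              _ ≤ _ := le_mul_of_one_le_right (by positivity) h1l
      _ = K ^ 4 * l * (12.1 ^ 2 + 8 * 6.0001 ^ 2 * 377) := by ring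
      _ ≤ K ^ 4 * l * (1.09 * 10 ^ 5) := by gcongr; norm_num
      _ = _ := by ring
  have hfin : ((K : ℝ) ^ 2) ^ 4 ≤ (7520 * l) ^ 4 * (1.09 * 10 ^ 5 * K ^ 4 * l * A) := by
    calc _ ≤ (7520 * l * Q) ^ 4 := by gcongr
      _ = (7520 * l) ^ 4 * Q ^ 4 := by ring
      _ ≤ (7520 * l) ^ 4 * ((Q ^ 2 + 8 * N ^ 2 * (1 + Real.log N)) * A) := by gcongr
      _ ≤ _ := by gcongr
  have h2 : (K : ℝ) ^ 4 ≤ 7520 ^ 4 * (1.09 * 10 ^ 5) * l ^ 5 * A := by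
    have : (K : ℝ) ^ 4 * K ^ 4 ≤ (K : ℝ) ^ 4 * (7520 ^ 4 * (1.09 * 10 ^ 5) * l ^ 5 * A) := by
      calc _ = ((K : ℝ) ^ 2) ^ 4 := by ring
        _ ≤ _ := hfin
        _ = _ := by ring
    exact le_of_mul_le_mul_left this (by positivity)
  rw [hK] at h2
  rw [div_le_iff₀ (by positivity)]
  nlinarith [mul_pos (pow_pos hl 5) hX]

/-- Many sums of six positive biquadrates in one residue class modulo `80`. -/
theorem exists_sixth_sums {X : ℕ} {l : ℝ} (h : Scale X l) {e : ℕ} (he : e ≤ 1) :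
    ∃ r, r < 80 ∧ r % 16 = 4 * e ∧ ∃ A : Finset ℕ, 7 / 10 ^ 19 * (X : ℝ) ^ 4 / l ^ 5 ≤ A.card ∧
      ∀ a ∈ A, a ≤ 9400 * X ^ 4 ∧
        ∃ z : Fin 6 → ℕ, (∀ i, 0 < z i) ∧ ∑ i, z i ^ 4 = 80 * a + r := by
  set B := sqSums (qVals e (6 * X)) with hB
  have hBcard := card_sqSums_qVals_ge h he
  rw [← hB] at hBcard
  set T := (range 80).filter fun r => r % 16 = 4 * e with hT
  have hTcard : T.card = 5 := by
    rw [hT]; interval_cases e <;> decide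
  obtain ⟨r, hr, hcard⟩ := exists_le_card_fiber_of_nsmul_le_card_of_maps_to
    (s := B) (t := T) (f := fun a => a % 80) (b := (B.card : ℝ) / 5) (by
      intro a ha
      have := (mem_sqSums_qVals he ha).1
      rw [hT, mem_filter, mem_range]
      omega) (by rw [← card_pos]; omega) (by rw [hTcard]; norm_num; linarith)
  rw [hT, mem_filter, mem_range] at hr
  refine ⟨r, hr.1, hr.2, (B.filter fun a => a % 80 = r).image (fun a => a / 80), ?_, ?_⟩
  · rw [card_image_of_injOn]
    · refine le_trans ?_ hcard
      have h1 : 7 / 10 ^ 19 * (X : ℝ) ^ 4 / l ^ 5 ≤ (3.6 / 10 ^ 18 * (X : ℝ) ^ 4 / l ^ 5) / 5 := by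
        have : 0 ≤ (X : ℝ) ^ 4 / l ^ 5 := by have := h.pos; positivity
        rw [mul_div_assoc, mul_div_assoc]
        linarith
      linarith
    · intro a ha b hb hab
      simp only [coe_filter, Set.mem_ofPred_eq] at ha hb hab
      omega
  · intro a ha
    obtain ⟨b, hb, rfl⟩ := mem_image.mp ha
    rw [mem_filter] at hb
    obtain ⟨-, h2, z, hz, hzs⟩ := mem_sqSums_qVals he hb.1
    refine ⟨?_, z, hz, ?_⟩
    · have h1X := h.one_le_X
      have h3 : 36 * (2 * (6 * X) + 1) ^ 4 ≤ 80 * (9400 * X ^ 4) := by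
        have hX := h.le_cast
        have : ((36 * (2 * (6 * X) + 1) ^ 4 : ℕ) : ℝ) ≤ ((80 * (9400 * X ^ 4) : ℕ) : ℝ) := by
          push_cast
          calc (36 * (2 * (6 * X) + 1) ^ 4 : ℝ) ≤ 36 * (2 * (6 * X) + 0.001 * X) ^ 4 := by
                gcongr; linarith
            _ = 36 * 12.001 ^ 4 * X ^ 4 := by ring
            _ ≤ 752000 * X ^ 4 := by gcongr; norm_num
            _ = _ := by ring
        exact_mod_cast this
      omega
    · rw [hzs]; omega

end Biquad

namespace Biquad
open Finset Polynomial

/-- Normalised complete exponential sum of a polynomial. -/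
noncomputable def cs (P : ℤ[X]) (q : ℕ) [NeZero q] (a : ZMod q) : ℂ :=
  (q : ℂ)⁻¹ * ∑ t : ZMod q, ZMod.stdAddChar (a * aeval t P)

lemma stdAddChar_intCast (q : ℕ) [NeZero q] (j : ℤ) :
    ZMod.stdAddChar (j : ZMod q) = ex (j / q) := by
  rw [ZMod.stdAddChar_coe, ex]
  congr 1
  push_cast
  ring

lemma norm_stdAddChar (q : ℕ) [NeZero q] (x : ZMod q) :
    ‖(ZMod.stdAddChar x : ℂ)‖ = 1 := by
  obtain ⟨j, rfl⟩ := ZMod.intCast_surjective x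
  rw [stdAddChar_intCast, norm_ex]

lemma norm_cs_le_one (P : ℤ[X]) (q : ℕ) [NeZero q] (a : ZMod q) : ‖cs P q a‖ ≤ 1 := by
  have hq : (0 : ℝ) < q := by exact_mod_cast NeZero.pos q
  unfold cs
  rw [norm_mul, norm_inv, Complex.norm_natCast, inv_mul_le_iff₀ hq, mul_one]
  refine (norm_sum_le _ _).trans ?_
  simp [ZMod.card]

/-- Reduction of residues. -/
noncomputable abbrev redL (m n : ℕ) : ZMod (m * n) →+* ZMod m := ZMod.castHom (dvd_mul_right m n) (ZMod m)
/-- Reduction of residues. -/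
noncomputable abbrev redR (m n : ℕ) : ZMod (m * n) →+* ZMod n := ZMod.castHom (dvd_mul_left n m) (ZMod n)

lemma exists_units_stdAddChar {m n : ℕ} [NeZero m] [NeZero n] (h : m.Coprime n) :
    ∃ (u : (ZMod m)ˣ) (v : (ZMod n)ˣ), ∀ x : ZMod (m * n),
      (ZMod.stdAddChar x : ℂ)
        = ZMod.stdAddChar ((u : ZMod m) * redL m n x) * ZMod.stdAddChar ((v : ZMod n) * redR m n x) := by
  have hb : (n : ℤ) * m.gcdB n + m * m.gcdA n = 1 := by
    have := Nat.gcd_eq_gcd_ab m n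
    rw [h.gcd_eq_one] at this
    push_cast at this
    linarith
  have hu : IsUnit ((m.gcdB n : ℤ) : ZMod m) := by
    have := congrArg (Int.cast : ℤ → ZMod m) hb
    push_cast at this
    rw [ZMod.natCast_self, zero_mul, add_zero, mul_comm] at this
    exact IsUnit.of_mul_eq_one _ this
  have hv : IsUnit ((m.gcdA n : ℤ) : ZMod n) := by
    have := congrArg (Int.cast : ℤ → ZMod n) hb
    push_cast at this
    rw [ZMod.natCast_self, zero_mul, zero_add, mul_comm] at this
    exact IsUnit.of_mul_eq_one _ this
  refine ⟨hu.unit, hv.unit, fun x => ?_⟩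
  obtain ⟨j, rfl⟩ := ZMod.intCast_surjective x
  have e1 : ((hu.unit : (ZMod m)ˣ) : ZMod m) * redL m n (j : ZMod (m * n))
      = ((m.gcdB n * j : ℤ) : ZMod m) := by
    rw [map_intCast]; push_cast; rfl
  have e2 : ((hv.unit : (ZMod n)ˣ) : ZMod n) * redR m n (j : ZMod (m * n))
      = ((m.gcdA n * j : ℤ) : ZMod n) := by
    rw [map_intCast]; push_cast; rfl
  rw [e1, e2, stdAddChar_intCast, stdAddChar_intCast, stdAddChar_intCast, ← ex_add]
  congr 1
  have hm : (m : ℝ) ≠ 0 := by exact_mod_cast NeZero.ne m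
  have hn : (n : ℝ) ≠ 0 := by exact_mod_cast NeZero.ne n
  have hb' : (n : ℝ) * (m.gcdB n : ℤ) + m * (m.gcdA n : ℤ) = 1 := by exact_mod_cast hb
  push_cast
  field_simp
  linear_combination (-(j : ℝ)) * hb'

lemma chineseRemainder_fst {m n : ℕ} (h : m.Coprime n) (x : ZMod (m * n)) :
    (ZMod.chineseRemainder h x).1 = redL m n x := by
  have : (RingHom.fst (ZMod m) (ZMod n)).comp (ZMod.chineseRemainder h : ZMod (m * n) →+* _)
      = redL m n := RingHom.ext_zmod _ _
  exact DFunLike.congr_fun this x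

lemma chineseRemainder_snd {m n : ℕ} (h : m.Coprime n) (x : ZMod (m * n)) :
    (ZMod.chineseRemainder h x).2 = redR m n x := by
  have : (RingHom.snd (ZMod m) (ZMod n)).comp (ZMod.chineseRemainder h : ZMod (m * n) →+* _)
      = redR m n := RingHom.ext_zmod _ _
  exact DFunLike.congr_fun this x

lemma cs_mul {m n : ℕ} [NeZero m] [NeZero n] (h : m.Coprime n) :
    ∃ (u : (ZMod m)ˣ) (v : (ZMod n)ˣ), ∀ (P : ℤ[X]) (a : ZMod (m * n)),
      cs P (m * n) a = cs P m (u * redL m n a) * cs P n (v * redR m n a) := by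
  obtain ⟨u, v, huv⟩ := exists_units_stdAddChar h
  refine ⟨u, v, fun P a => ?_⟩
  have key : ∑ t : ZMod (m * n), (ZMod.stdAddChar (a * aeval t P) : ℂ)
      = (∑ t : ZMod m, ZMod.stdAddChar ((u : ZMod m) * redL m n a * aeval t P))
        * ∑ t : ZMod n, ZMod.stdAddChar ((v : ZMod n) * redR m n a * aeval t P) := by
    rw [Fintype.sum_mul_sum, ← Fintype.sum_prod_type']
    refine Fintype.sum_equiv (ZMod.chineseRemainder h).toEquiv _ _ fun t => ?_
    have e1 : ((ZMod.chineseRemainder h).toEquiv t).1 = redL m n t := chineseRemainder_fst h t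
    have e2 : ((ZMod.chineseRemainder h).toEquiv t).2 = redR m n t := chineseRemainder_snd h t
    have e3 : ∀ {R : Type} [CommRing R] (f : ZMod (m * n) →+* R), f (aeval t P) = aeval (f t) P := by
      intro R _ f
      rw [aeval_def, aeval_def, hom_eval₂]
      congr 1
      exact RingHom.ext_int _ _
    rw [huv, map_mul (redL m n), map_mul (redR m n), e3, e3, e1, e2, mul_assoc, mul_assoc]
  unfold cs
  rw [key]
  push_cast
  rw [mul_inv]
  ring

lemma isUnit_red {m n : ℕ} {a : ZMod (m * n)} (ha : IsUnit a) :
    IsUnit (redL m n a) ∧ IsUnit (redR m n a) := ⟨ha.map _, ha.map _⟩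

/-- The polynomial with values `phi c`. -/
noncomputable def phiP (c : ℕ) : ℤ[X] :=
  C 2000 * X ^ 4 + C (400 * (c : ℤ)) * X ^ 3 + C (30 * (c : ℤ) ^ 2) * X ^ 2 + C ((c : ℤ) ^ 3) * X

lemma aeval_phiP {R : Type*} [CommRing R] (c : ℕ) (t : R) :
    aeval t (phiP c) = 2000 * t ^ 4 + 400 * c * t ^ 3 + 30 * c ^ 2 * t ^ 2 + c ^ 3 * t := by
  have h2 : aeval t (2000 : ℤ[X]) = 2000 := map_ofNat (aeval t) 2000
  have h4 : aeval t (400 : ℤ[X]) = 400 := map_ofNat (aeval t) 400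
  have h3 : aeval t (30 : ℤ[X]) = 30 := map_ofNat (aeval t) 30
  simp [phiP, h2, h3, h4]

/-- Affine substitution in a complete sum. -/
lemma norm_cs_phiP (c : ℕ) {q : ℕ} [NeZero q] {n n' d c' : ℕ}
    (h : ∀ t : ZMod q, (n : ZMod q) * aeval t (phiP c) + d * (c' : ZMod q) ^ 4 = d * (n' * t + c') ^ 4)
    (u : (ZMod q)ˣ) (hu : (n : ZMod q) = u) (hn' : IsUnit (n' : ZMod q)) (a : ZMod q) :
    ‖cs (phiP c) q a‖ = ‖cs (C (d : ℤ) * X ^ 4) q (a * ↑u⁻¹)‖ := by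
  unfold cs
  rw [norm_mul, norm_mul]
  congr 1
  have h1 : ∀ t : ZMod q, (ZMod.stdAddChar (a * aeval t (phiP c)) : ℂ)
      = ZMod.stdAddChar (-(a * (↑u⁻¹ : ZMod q) * ((d : ZMod q) * (c' : ZMod q) ^ 4)))
        * ZMod.stdAddChar (a * (↑u⁻¹ : ZMod q) * ((d : ZMod q) * ((n' : ZMod q) * t + (c' : ZMod q)) ^ 4)) := by
    intro t
    rw [← AddChar.map_add_eq_mul, ← h t, hu]
    congr 1
    have : (↑u⁻¹ : ZMod q) * u = 1 := Units.inv_mul u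
    linear_combination (-(a * aeval t (phiP c))) * this
  rw [sum_congr rfl (fun t _ => h1 t), ← mul_sum, norm_mul, norm_stdAddChar, one_mul]
  congr 1
  obtain ⟨v, hv⟩ := hn'
  refine Fintype.sum_equiv ((Units.mulLeft v).trans (Equiv.addRight (c' : ZMod q))) _ _ fun t => ?_
  simp [← hv]

end Biquad

namespace Biquad
open Finset Polynomial

lemma sum_range_cast_zmod_complex {q : ℕ} [NeZero q] (F : ZMod q → ℂ) :
    ∑ k ∈ range q, F (k : ZMod q) = ∑ z : ZMod q, F z := by
  refine sum_nbij' (fun k => (k : ZMod q)) (fun z => z.val) ?_ ?_ ?_ ?_ ?_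
  · simp
  · intro z _; simpa using ZMod.val_lt z
  · intro k hk; exact ZMod.val_cast_of_lt (mem_range.mp hk)
  · intro z _; simp
  · simp

lemma sum_range_mul_cast_zmod {q : ℕ} [NeZero q] (r : ℕ) (F : ZMod q → ℂ) :
    ∑ k ∈ range (q * r), F (k : ZMod q) = r * ∑ z : ZMod q, F z := by
  induction r with
  | zero => simp
  | succ r ih =>
    rw [Nat.mul_succ, sum_range_add, ih, ← sum_range_cast_zmod_complex F]
    push_cast
    simp only [ZMod.natCast_self, zero_mul, zero_add]
    ring

lemma stdAddChar_natCast_mul {m n : ℕ} [NeZero m] [NeZero n] (x : ZMod (m * n)) :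
    (ZMod.stdAddChar ((n : ZMod (m * n)) * x) : ℂ) = ZMod.stdAddChar (redL m n x) := by
  obtain ⟨j, rfl⟩ := ZMod.intCast_surjective x
  have h1 : (n : ZMod (m * n)) * (j : ZMod (m * n)) = ((n * j : ℤ) : ZMod (m * n)) := by
    push_cast; rfl
  rw [h1, map_intCast (redL m n), stdAddChar_intCast, stdAddChar_intCast]
  congr 1
  have hm : (m : ℝ) ≠ 0 := by exact_mod_cast NeZero.ne m
  have hn : (n : ℝ) ≠ 0 := by exact_mod_cast NeZero.ne n
  push_cast
  field_simp

lemma map_aeval_int {R S : Type*} [CommRing R] [CommRing S] (f : R →+* S) (P : ℤ[X]) (t : R) :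
    f (aeval t P) = aeval (f t) P := by
  rw [aeval_def, aeval_def, hom_eval₂]
  congr 1
  exact RingHom.ext_int _ _

lemma cs_natCast_mul (P : ℤ[X]) {m n : ℕ} [NeZero m] [NeZero n] (a : ZMod (m * n)) :
    cs P (m * n) ((n : ZMod (m * n)) * a) = cs P m (redL m n a) := by
  unfold cs
  rw [← sum_range_cast_zmod_complex]
  have h : ∀ k ∈ range (m * n), (ZMod.stdAddChar ((n : ZMod (m * n)) * a
        * aeval ((k : ℕ) : ZMod (m * n)) P) : ℂ)
      = (fun z : ZMod m => (ZMod.stdAddChar (redL m n a * aeval z P) : ℂ)) k := by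
    intro k _
    rw [mul_assoc, stdAddChar_natCast_mul, map_mul (redL m n), map_aeval_int, map_natCast]
  rw [sum_congr rfl h, sum_range_mul_cast_zmod n
    (fun z : ZMod m => (ZMod.stdAddChar (redL m n a * aeval z P) : ℂ))]
  have hn : (n : ℂ) ≠ 0 := by exact_mod_cast NeZero.ne n
  push_cast
  field_simp

/-- A sum over all residues of a prime power of a function vanishing on average over the units. -/
lemma sum_zmod_eq_of_units {p M N : ℕ} (hp : p.Prime) [NeZero N] (hN : N = p * M) {k : ℕ}
    (hk : N ∣ p ^ k) (F : ZMod N → ℂ)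
    (hF : ∑ z : ZMod N, (if IsUnit z then F z else 0) = 0) :
    ∑ z : ZMod N, F z = ∑ y ∈ range M, F ((p * y : ℕ) : ZMod N) := by
  have hunit : ∀ z : ℕ, IsUnit (z : ZMod N) ↔ ¬ p ∣ z := by
    intro z
    rw [ZMod.isUnit_iff_coprime]
    constructor
    · intro h hz
      have : p ∣ Nat.gcd z N := Nat.dvd_gcd hz (hN ▸ dvd_mul_right p M)
      rw [h] at this
      exact hp.one_lt.ne' (Nat.dvd_one.mp this)
    · intro h
      exact (((Nat.Prime.coprime_iff_not_dvd hp).mpr h).symm.pow_right k).coprime_dvd_right hk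
  have h1 : ∑ z : ZMod N, F z
      = ∑ z : ZMod N, (if IsUnit z then F z else 0) + ∑ z : ZMod N, (if IsUnit z then 0 else F z) := by
    rw [← sum_add_distrib]
    exact sum_congr rfl fun z _ => by split_ifs <;> simp
  rw [h1, hF, zero_add, ← sum_range_cast_zmod_complex]
  simp only [hunit, ite_not]
  rw [← sum_filter]
  refine (sum_nbij' (fun y => p * y) (fun z => z / p) ?_ ?_ ?_ ?_ ?_).symm
  · intro y hy
    simp only [mem_filter, mem_range] at hy ⊢
    exact ⟨hN ▸ Nat.mul_lt_mul_of_pos_left hy hp.pos, dvd_mul_right p y⟩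
  · intro z hz
    simp only [mem_filter, mem_range] at hz ⊢
    rw [Nat.div_lt_iff_lt_mul hp.pos, mul_comm, ← hN]
    exact hz.1
  · intro y _
    exact Nat.mul_div_cancel_left y hp.pos
  · intro z hz
    exact Nat.mul_div_cancel' (mem_filter.mp hz).2
  · intro y _
    rfl

lemma sum_units_eq_zero {p M N : ℕ} (hp : p.Prime) [NeZero N] (hN : N = p * M)
    {b δ s : ZMod N} (hb : IsUnit b) (hs : IsUnit s) (hδ : IsNilpotent δ)
    (h : ∀ (z : ZMod N) (j : ℕ), (z + j * δ) ^ 4 = z ^ 4 + j * (s * M * z ^ 3)) :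
    ∑ z : ZMod N, (if IsUnit z then (ZMod.stdAddChar (b * z ^ 4) : ℂ) else 0) = 0 := by
  classical
  have hM : (M : ZMod N) ≠ 0 := by
    intro h0
    rw [ZMod.natCast_eq_zero_iff] at h0
    have hMpos : 0 < M := Nat.pos_of_ne_zero (by rintro rfl; exact NeZero.ne N (by simpa using hN))
    have := Nat.le_of_dvd hMpos h0
    nlinarith [hp.two_le]
  set T := ∑ z : ZMod N, (if IsUnit z then (ZMod.stdAddChar (b * z ^ 4) : ℂ) else 0) with hT
  have hshift : ∀ j : ℕ, T = ∑ z : ZMod N, (if IsUnit z then (ZMod.stdAddChar (b * z ^ 4) : ℂ)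
      * (ZMod.stdAddChar (b * (s * (M : ZMod N) * z ^ 3)) : ℂ) ^ j else 0) := by
    intro j
    rw [hT, ← Equiv.sum_comp (Equiv.addRight ((j : ZMod N) * δ))]
    refine sum_congr rfl fun z _ => ?_
    have hnil : IsNilpotent ((j : ZMod N) * δ) := (Commute.all _ _).isNilpotent_mul_left hδ
    have hiff : IsUnit (z + j * δ) ↔ IsUnit z := by
      constructor
      · intro hz
        simpa using hnil.neg.isUnit_add_left_of_commute hz (Commute.all _ _)
      · intro hz
        exact hnil.isUnit_add_left_of_commute hz (Commute.all _ _)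
    simp only [Equiv.coe_addRight, hiff]
    split_ifs
    · rw [h, mul_add, AddChar.map_add_eq_mul, ← AddChar.map_nsmul_eq_pow, nsmul_eq_mul]
      congr 2
      ring
    · rfl
  have hsum : (p : ℂ) * T = 0 := by
    calc (p : ℂ) * T = ∑ j ∈ range p, T := by simp
      _ = ∑ j ∈ range p, ∑ z : ZMod N, (if IsUnit z then (ZMod.stdAddChar (b * z ^ 4) : ℂ)
          * (ZMod.stdAddChar (b * (s * (M : ZMod N) * z ^ 3)) : ℂ) ^ j else 0) :=
        sum_congr rfl fun j _ => hshift j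
      _ = 0 := by
        rw [sum_comm]
        refine sum_eq_zero fun z _ => ?_
        split_ifs with hz
        · rw [← mul_sum]
          set x := b * (s * M * z ^ 3) with hx
          have hx0 : x ≠ 0 := by
            obtain ⟨b, rfl⟩ := hb
            obtain ⟨s, rfl⟩ := hs
            obtain ⟨z, rfl⟩ := hz
            intro h0
            apply hM
            have : x = (b * s * z ^ 3 : (ZMod N)ˣ) * (M : ZMod N) := by
              rw [hx]; push_cast; ring
            rw [this, Units.mul_right_eq_zero] at h0
            exact h0
          have h1 : (ZMod.stdAddChar x : ℂ) ≠ 1 := by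
            rw [← AddChar.map_zero_eq_one (ZMod.stdAddChar (N := N))]
            exact fun h => hx0 (ZMod.injective_stdAddChar h)
          have h2 : (ZMod.stdAddChar x : ℂ) ^ p = 1 := by
            rw [← AddChar.map_nsmul_eq_pow, nsmul_eq_mul]
            have : (p : ZMod N) * x = 0 := by
              have h3 : (p : ZMod N) * M = 0 := by
                rw [← Nat.cast_mul, ← hN, ZMod.natCast_self]
              rw [hx]
              linear_combination (b * s * z ^ 3) * h3
            rw [this, AddChar.map_zero_eq_one]
          rw [geom_sum_eq h1, h2]
          simp
        · simp
  simpa [hp.ne_zero] using hsum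

lemma cs_pow_four (q : ℕ) [NeZero q] (b : ZMod q) :
    cs (X ^ 4) q b = (q : ℂ)⁻¹ * ∑ t : ZMod q, (ZMod.stdAddChar (b * t ^ 4) : ℂ) := by
  simp [cs]

/-- The fourth power sum modulo an odd prime power is carried by the multiples of the prime. -/
lemma cs_pow_four_eq_of_odd {p n : ℕ} (hp : p.Prime) (h2 : p ≠ 2) {N : ℕ} [NeZero N]
    (hN : N = p * p ^ (n + 1)) {b : ZMod N} (hb : IsUnit b) :
    cs (X ^ 4) N b = (N : ℂ)⁻¹ * ∑ y ∈ range (p ^ (n + 1)),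
      (ZMod.stdAddChar (b * ((p * y : ℕ) : ZMod N) ^ 4) : ℂ) := by
  rw [cs_pow_four]
  congr 1
  have hk : N ∣ p ^ (n + 2) := ⟨1, by rw [hN]; ring⟩
  refine sum_zmod_eq_of_units hp hN hk _ ?_
  have hz : ((p : ZMod N) ^ (n + 1)) ^ 2 = 0 := by
    rw [← pow_mul, ← Nat.cast_pow, ZMod.natCast_eq_zero_iff, hN]
    exact ⟨p ^ n, by ring⟩
  refine sum_units_eq_zero hp hN (δ := (p : ZMod N) ^ (n + 1)) (s := 4) hb ?_ ⟨2, hz⟩ ?_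
  · have : IsUnit ((4 : ℕ) : ZMod N) := by
      rw [ZMod.isUnit_iff_coprime]
      refine Nat.Coprime.coprime_dvd_right hk (Nat.Coprime.pow_right _ ?_)
      exact Nat.Coprime.pow_left 2 ((Nat.coprime_primes Nat.prime_two hp).mpr h2.symm)
    exact_mod_cast this
  · intro z j
    push_cast
    linear_combination (6 * z ^ 2 * j ^ 2 + 4 * z * j ^ 3 * (p : ZMod N) ^ (n + 1)
      + j ^ 4 * ((p : ZMod N) ^ (n + 1)) ^ 2) * hz

lemma cs_pow_four_eq_of_two {n : ℕ} {N : ℕ} [NeZero N]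
    (hN : N = 2 * 2 ^ (n + 4)) {b : ZMod N} (hb : IsUnit b) :
    cs (X ^ 4) N b = (N : ℂ)⁻¹ * ∑ y ∈ range (2 ^ (n + 4)),
      (ZMod.stdAddChar (b * ((2 * y : ℕ) : ZMod N) ^ 4) : ℂ) := by
  rw [cs_pow_four]
  congr 1
  have hk : N ∣ 2 ^ (n + 5) := ⟨1, by rw [hN]; ring⟩
  refine sum_zmod_eq_of_units Nat.prime_two hN hk _ ?_
  have hz : 2 * ((2 : ZMod N) ^ (n + 2)) ^ 2 = 0 := by
    have : ((2 * (2 ^ (n + 2)) ^ 2 : ℕ) : ZMod N) = 0 := by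
      rw [ZMod.natCast_eq_zero_iff, hN]
      exact ⟨2 ^ n, by ring⟩
    exact_mod_cast this
  have hz4 : ((2 : ZMod N) ^ (n + 2)) ^ 4 = 0 := by
    have : (((2 ^ (n + 2)) ^ 4 : ℕ) : ZMod N) = 0 := by
      rw [ZMod.natCast_eq_zero_iff, hN]
      exact ⟨2 ^ (3 * n + 3), by ring⟩
    exact_mod_cast this
  refine sum_units_eq_zero Nat.prime_two hN (δ := (2 : ZMod N) ^ (n + 2)) (s := 1) hb isUnit_one
    ⟨4, hz4⟩ ?_
  intro z j
  push_cast
  linear_combination (3 * z ^ 2 * j ^ 2 + 2 * z * j ^ 3 * (2 : ZMod N) ^ (n + 2)) * hz + j ^ 4 * hz4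

/-- Evaluation for exponents at most four. -/
lemma sum_pow_four_small {p M N : ℕ} [NeZero N] (hN : N = p * M) (h : N ∣ p ^ 4) (b : ZMod N) :
    ‖(N : ℂ)⁻¹ * ∑ y ∈ range M, (ZMod.stdAddChar (b * ((p * y : ℕ) : ZMod N) ^ 4) : ℂ)‖
      = 1 / p := by
  have h1 : ∀ y ∈ range M, (ZMod.stdAddChar (b * ((p * y : ℕ) : ZMod N) ^ 4) : ℂ) = 1 := by
    intro y _
    have : ((p * y : ℕ) : ZMod N) ^ 4 = 0 := by
      rw [← Nat.cast_pow, ZMod.natCast_eq_zero_iff, mul_pow]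
      exact h.mul_right _
    rw [this, mul_zero, AddChar.map_zero_eq_one]
  rw [sum_congr rfl h1]
  have hM : (M : ℝ) ≠ 0 := by
    intro h0
    have : M = 0 := by exact_mod_cast h0
    exact NeZero.ne N (by simp [hN, this])
  have hp : (p : ℝ) ≠ 0 := by
    intro h0
    have : p = 0 := by exact_mod_cast h0
    exact NeZero.ne N (by simp [hN, this])
  rw [sum_const, card_range, nsmul_eq_mul, mul_one, norm_mul, norm_inv, Complex.norm_natCast,
    Complex.norm_natCast, hN]
  push_cast
  field_simp

/-- The recursion for exponents at least five. -/
lemma sum_pow_four_large {p n : ℕ} [NeZero p] [NeZero n] (b : ZMod (n * p ^ 4)) :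
    ‖((n * p ^ 4 : ℕ) : ℂ)⁻¹ * ∑ y ∈ range (n * p ^ 3),
        (ZMod.stdAddChar (b * ((p * y : ℕ) : ZMod (n * p ^ 4)) ^ 4) : ℂ)‖
      = 1 / p * ‖cs (X ^ 4) n (redL n (p ^ 4) b)‖ := by
  have h1 : ∀ y ∈ range (n * p ^ 3),
      (ZMod.stdAddChar (b * ((p * y : ℕ) : ZMod (n * p ^ 4)) ^ 4) : ℂ)
      = (fun z : ZMod n => (ZMod.stdAddChar (redL n (p ^ 4) b * z ^ 4) : ℂ)) (y : ℕ) := by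
    intro y _
    have : b * ((p * y : ℕ) : ZMod (n * p ^ 4)) ^ 4
        = ((p ^ 4 : ℕ) : ZMod (n * p ^ 4)) * (b * (y : ZMod (n * p ^ 4)) ^ 4) := by
      push_cast; ring
    rw [this, stdAddChar_natCast_mul, map_mul (redL n (p ^ 4)), map_pow (redL n (p ^ 4)),
      map_natCast (redL n (p ^ 4))]
  have hp : (p : ℂ) ≠ 0 := by exact_mod_cast NeZero.ne p
  have hn : (n : ℂ) ≠ 0 := by exact_mod_cast NeZero.ne n
  rw [sum_congr rfl h1, sum_range_mul_cast_zmod (p ^ 3)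
    (fun z : ZMod n => (ZMod.stdAddChar (redL n (p ^ 4) b * z ^ 4) : ℂ)), cs_pow_four]
  have : (1 : ℝ) / p = ‖(p : ℂ)⁻¹‖ := by simp
  rw [this, ← norm_mul]
  congr 1
  push_cast
  field_simp

end Biquad

namespace Biquad
open Finset Polynomial

/-- Quartic Gauss sum. -/
noncomputable def gs (p : ℕ) [NeZero p] (b : ZMod p) : ℂ :=
  ∑ z : ZMod p, (ZMod.stdAddChar (b * z ^ 4) : ℂ)

section
variable {p : ℕ} [Fact p.Prime]

lemma sum_stdAddChar_mul (c : ZMod p) :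
    ∑ b : ZMod p, (ZMod.stdAddChar (b * c) : ℂ) = if c = 0 then (p : ℂ) else 0 := by
  rw [AddChar.sum_mulShift c (ZMod.isPrimitive_stdAddChar p), ZMod.card]
  push_cast
  rfl

lemma gs_zero : gs p 0 = p := by simp [gs, ZMod.card]

lemma sum_gs : ∑ b ∈ univ.erase (0 : ZMod p), gs p b = 0 := by
  have h : ∑ b : ZMod p, gs p b = p := by
    unfold gs
    rw [sum_comm]
    simp only [sum_stdAddChar_mul]
    simp
  rw [← add_sum_erase _ _ (mem_univ (0 : ZMod p)), gs_zero] at h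
  simpa using h

lemma sum_norm_gs_sq {d : ℕ}
    (hd : ∀ x : ZMod p, (univ.filter fun y : ZMod p => y ^ 4 = x ^ 4).card ≤ d) :
    ∑ b ∈ univ.erase (0 : ZMod p), ‖gs p b‖ ^ 2 ≤ p * (p - 1) * (d - 1 : ℝ) := by
  have h1 : ∀ b : ZMod p, ((‖gs p b‖ ^ 2 : ℝ) : ℂ)
      = ∑ x : ZMod p, ∑ y : ZMod p, (ZMod.stdAddChar (b * (x ^ 4 - y ^ 4)) : ℂ) := by
    intro b
    rw [← Complex.normSq_eq_norm_sq, ← Complex.mul_conj]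
    unfold gs
    rw [map_sum, sum_mul_sum]
    refine sum_congr rfl fun x _ => sum_congr rfl fun y _ => ?_
    rw [← AddChar.map_neg_eq_conj, ← AddChar.map_add_eq_mul]
    congr 1
    ring
  have h2 : ((∑ b : ZMod p, ‖gs p b‖ ^ 2 : ℝ) : ℂ)
      = ((p * ∑ x : ZMod p, ((univ.filter fun y : ZMod p => y ^ 4 = x ^ 4).card : ℝ) : ℝ) : ℂ) := by
    push_cast
    have : ∀ b : ZMod p, (‖gs p b‖ : ℂ) ^ 2
      = ∑ x : ZMod p, ∑ y : ZMod p, (ZMod.stdAddChar (b * (x ^ 4 - y ^ 4)) : ℂ) := by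
      intro b; rw [← h1]; push_cast; rfl
    simp only [this]
    rw [sum_comm, mul_sum]
    refine sum_congr rfl fun x _ => ?_
    rw [sum_comm]
    simp only [sum_stdAddChar_mul]
    rw [← sum_filter, sum_const, nsmul_eq_mul, mul_comm]
    congr 3
    ext y
    simp only [mem_filter, mem_univ, true_and]
    constructor
    · intro h; linear_combination -h
    · intro h; linear_combination -h
  have h3 : (∑ b : ZMod p, ‖gs p b‖ ^ 2 : ℝ)
      = p * ∑ x : ZMod p, ((univ.filter fun y : ZMod p => y ^ 4 = x ^ 4).card : ℝ) := by
    exact_mod_cast h2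
  have hp : (2 : ℝ) ≤ p := by exact_mod_cast (Fact.out : p.Prime).two_le
  have h4 : ∑ x : ZMod p, ((univ.filter fun y : ZMod p => y ^ 4 = x ^ 4).card : ℝ)
      ≤ 1 + (p - 1) * d := by
    rw [← add_sum_erase _ _ (mem_univ (0 : ZMod p))]
    refine add_le_add ?_ ?_
    · have : (univ.filter fun y : ZMod p => y ^ 4 = 0 ^ 4) = {0} := by
        ext y; simp
      rw [this]; simp
    · refine (sum_le_card_nsmul _ _ (d : ℝ) (fun x _ => by exact_mod_cast hd x)).trans ?_
      rw [card_erase_of_mem (mem_univ _), card_univ, ZMod.card, nsmul_eq_mul,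
        Nat.cast_pred (Fact.out : p.Prime).pos]
  rw [← add_sum_erase _ _ (mem_univ (0 : ZMod p)), gs_zero, Complex.norm_natCast] at h3
  nlinarith

lemma gs_mul_pow (b : ZMod p) {w : ZMod p} (hw : w ≠ 0) : gs p (b * w ^ 4) = gs p b := by
  unfold gs
  refine Fintype.sum_equiv (Equiv.mulLeft₀ w hw) _ _ fun z => ?_
  change _ = (ZMod.stdAddChar (b * (w * z) ^ 4) : ℂ)
  congr 1
  ring

lemma gs_neg (b : ZMod p) : ‖gs p (-b)‖ = ‖gs p b‖ := by
  have : gs p (-b) = (starRingEnd ℂ) (gs p b) := by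
    unfold gs
    rw [map_sum]
    refine sum_congr rfl fun z _ => ?_
    rw [← AddChar.map_neg_eq_conj]
    congr 1
    ring
  rw [this, Complex.norm_conj]

/-- The coset of `b` modulo fourth powers. -/
def coset4 (b : ZMod p) : Finset (ZMod p) := (univ.erase 0).image fun w => b * w ^ 4

lemma coset4_subset {b : ZMod p} (hb : b ≠ 0) : coset4 b ⊆ univ.erase 0 := by
  intro x hx
  obtain ⟨w, hw, rfl⟩ := mem_image.mp hx
  exact mem_erase.mpr ⟨mul_ne_zero hb (pow_ne_zero 4 (ne_of_mem_erase hw)), mem_univ _⟩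

lemma card_coset4 {b : ZMod p} (hb : b ≠ 0) {d : ℕ}
    (hd : ∀ x : ZMod p, (univ.filter fun y : ZMod p => y ^ 4 = x ^ 4).card ≤ d) :
    (p : ℝ) - 1 ≤ d * (coset4 b).card := by
  have h := card_le_mul_card_image (s := univ.erase (0 : ZMod p)) (f := fun w => b * w ^ 4) d ?_
  · rw [card_erase_of_mem (mem_univ _), card_univ, ZMod.card] at h
    have h' : ((p - 1 : ℕ) : ℝ) ≤ ((d * (coset4 b).card : ℕ) : ℝ) := by exact_mod_cast h
    rw [Nat.cast_pred (Fact.out : p.Prime).pos] at h'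
    exact_mod_cast h'
  · intro a ha
    obtain ⟨x, hx, rfl⟩ := mem_image.mp ha
    refine (card_le_card ?_).trans (hd x)
    intro y hy
    rw [mem_filter] at hy ⊢
    exact ⟨mem_univ _, mul_left_cancel₀ hb hy.2⟩

lemma gs_of_mem_coset4 {b c : ZMod p} (hc : c ∈ coset4 b) : gs p c = gs p b := by
  obtain ⟨w, hw, rfl⟩ := mem_image.mp hc
  exact gs_mul_pow b (ne_of_mem_erase hw)

lemma norm_gs_sq_le {d : ℕ} (hd1 : 1 ≤ d)
    (hd : ∀ x : ZMod p, (univ.filter fun y : ZMod p => y ^ 4 = x ^ 4).card ≤ d)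
    {b : ZMod p} (hb : b ≠ 0) : ‖gs p b‖ ^ 2 ≤ (d - 1 : ℝ) ^ 2 * p := by
  set A := univ.erase (0 : ZMod p)
  set C := coset4 b
  have hCA : C ⊆ A := coset4_subset hb
  have hW := sum_norm_gs_sq hd
  have hm := card_coset4 hb hd
  have hp : (2 : ℝ) ≤ p := by exact_mod_cast (Fact.out : p.Prime).two_le
  have hd1' : (1 : ℝ) ≤ d := by exact_mod_cast hd1
  set m : ℝ := (C.card : ℝ) with hmdef
  set g := ‖gs p b‖ with hg
  have hAc : (A.card : ℝ) = p - 1 := by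
    rw [card_erase_of_mem (mem_univ _), card_univ, ZMod.card, Nat.cast_pred (Fact.out : p.Prime).pos]
  have hsd : ((A \ C).card : ℝ) = p - 1 - m := by
    rw [cast_card_sdiff hCA, hAc]
  have h0 : ‖∑ c ∈ A \ C, gs p c‖ = m * g := by
    have h := sum_sdiff (f := gs p) hCA
    rw [sum_gs, sum_congr rfl (fun c hc => gs_of_mem_coset4 hc), sum_const, nsmul_eq_mul] at h
    rw [eq_neg_of_add_eq_zero_left h, norm_neg, norm_mul, Complex.norm_natCast]
  have h1 : (∑ c ∈ A \ C, ‖gs p c‖ ^ 2) + m * g ^ 2 ≤ p * (p - 1) * (d - 1 : ℝ) := by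
    have h := sum_sdiff (f := fun c => ‖gs p c‖ ^ 2) hCA
    rw [sum_congr rfl (fun c hc => by rw [gs_of_mem_coset4 hc] :
      ∀ c ∈ C, ‖gs p c‖ ^ 2 = ‖gs p b‖ ^ 2), sum_const, nsmul_eq_mul] at h
    rw [h]; exact hW
  have h2 : (m * g) ^ 2 ≤ (p - 1 - m) * ∑ c ∈ A \ C, ‖gs p c‖ ^ 2 := by
    rw [← h0, ← hsd]
    refine (pow_le_pow_left₀ (norm_nonneg _) (norm_sum_le _ _) 2).trans ?_
    exact sq_sum_le_card_mul_sum_sq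
  have hmpos : 0 < m := by
    by_contra hcon
    have : d * m ≤ 0 := mul_nonpos_of_nonneg_of_nonpos (by linarith) (not_lt.mp hcon)
    linarith
  have hnn : 0 ≤ p - 1 - m := by rw [← hsd]; positivity
  set W' := ∑ c ∈ A \ C, ‖gs p c‖ ^ 2
  have h3 : (p - 1 - m) * W' ≤ (p - 1 - m) * (p * (p - 1) * (d - 1 : ℝ) - m * g ^ 2) :=
    mul_le_mul_of_nonneg_left (by linarith) hnn
  have h4 : m * g ^ 2 ≤ (p - 1 - m) * (p * (d - 1 : ℝ)) := by
    have h5 : (p - 1) * (m * g ^ 2) ≤ (p - 1) * ((p - 1 - m) * (p * (d - 1 : ℝ))) := by nlinarith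
    exact le_of_mul_le_mul_left h5 (by linarith)
  have h6 : (p - 1 - m) ≤ (d - 1) * m := by linarith
  have h7 : m * g ^ 2 ≤ m * ((d - 1 : ℝ) ^ 2 * p) := by
    calc m * g ^ 2 ≤ (p - 1 - m) * (p * (d - 1 : ℝ)) := h4
      _ ≤ ((d - 1) * m) * (p * (d - 1 : ℝ)) := by
        refine mul_le_mul_of_nonneg_right h6 ?_
        exact mul_nonneg (by linarith) (by linarith)
      _ = _ := by ring
  exact le_of_mul_le_mul_left h7 hmpos

lemma norm_gs_sq_le_of_neg {d : ℕ} (hd1 : 1 ≤ d)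
    (hd : ∀ x : ZMod p, (univ.filter fun y : ZMod p => y ^ 4 = x ^ 4).card ≤ d)
    (hneg : ∀ x y : ZMod p, y ≠ 0 → x ^ 4 ≠ - y ^ 4)
    {b : ZMod p} (hb : b ≠ 0) : 2 * ‖gs p b‖ ^ 2 ≤ d * (d - 1 : ℝ) * p := by
  have hW := sum_norm_gs_sq hd
  have hm := card_coset4 hb hd
  have hm' := card_coset4 (neg_ne_zero.mpr hb) hd
  have hp : (2 : ℝ) ≤ p := by exact_mod_cast (Fact.out : p.Prime).two_le
  have hdisj : Disjoint (coset4 b) (coset4 (-b)) := by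
    rw [disjoint_left]
    intro x hx hx'
    obtain ⟨w, hw, rfl⟩ := mem_image.mp hx
    obtain ⟨y, hy, hxy⟩ := mem_image.mp hx'
    refine hneg w y (ne_of_mem_erase hy) (mul_left_cancel₀ hb ?_)
    linear_combination -hxy
  have hsub : coset4 b ∪ coset4 (-b) ⊆ univ.erase 0 :=
    union_subset (coset4_subset hb) (coset4_subset (neg_ne_zero.mpr hb))
  have h1 : ∑ c ∈ coset4 b ∪ coset4 (-b), ‖gs p c‖ ^ 2 ≤ p * (p - 1) * (d - 1 : ℝ) :=
    (sum_le_sum_of_subset_of_nonneg hsub (fun _ _ _ => sq_nonneg _)).trans hW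
  rw [sum_union hdisj, sum_congr rfl (fun c hc => by rw [gs_of_mem_coset4 hc] :
      ∀ c ∈ coset4 b, ‖gs p c‖ ^ 2 = ‖gs p b‖ ^ 2),
      sum_congr rfl (fun c hc => by rw [gs_of_mem_coset4 hc, gs_neg] :
      ∀ c ∈ coset4 (-b), ‖gs p c‖ ^ 2 = ‖gs p b‖ ^ 2), sum_const, sum_const,
      nsmul_eq_mul, nsmul_eq_mul] at h1
  have hg : 0 ≤ ‖gs p b‖ ^ 2 := sq_nonneg _
  have hd1' : (1 : ℝ) ≤ d := by exact_mod_cast hd1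
  have h2 : (p - 1) * (2 * ‖gs p b‖ ^ 2) ≤ (p - 1) * (d * (d - 1 : ℝ) * p) := by
    have e1 := mul_le_mul_of_nonneg_right hm hg
    have e2 := mul_le_mul_of_nonneg_right hm' hg
    nlinarith [mul_le_mul_of_nonneg_left h1 (by linarith : (0 : ℝ) ≤ d)]
  exact le_of_mul_le_mul_left h2 (by linarith)

lemma card_fiber_four (x : ZMod p) : (univ.filter fun y : ZMod p => y ^ 4 = x ^ 4).card ≤ 4 := by
  have h : (univ.filter fun y : ZMod p => y ^ 4 = x ^ 4) ⊆ (nthRoots 4 (x ^ 4)).toFinset := by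
    intro y hy
    rw [Multiset.mem_toFinset, mem_nthRoots (by norm_num)]
    exact (mem_filter.mp hy).2
  exact (card_le_card h).trans ((Multiset.toFinset_card_le _).trans (card_nthRoots 4 _))

lemma card_fiber_two (hp : p % 4 = 3) (x : ZMod p) :
    (univ.filter fun y : ZMod p => y ^ 4 = x ^ 4).card ≤ 2 := by
  have h : (univ.filter fun y : ZMod p => y ^ 4 = x ^ 4) ⊆ {x, -x} := by
    intro y hy
    have h4 : y ^ 4 = x ^ 4 := (mem_filter.mp hy).2
    have h1 : (y - x) * (y + x) * (y ^ 2 + x ^ 2) = 0 := by linear_combination h4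
    rw [mem_insert, mem_singleton]
    rcases mul_eq_zero.mp h1 with h1 | h1
    · rcases mul_eq_zero.mp h1 with h1 | h1
      · left; linear_combination h1
      · right; linear_combination h1
    · left
      by_cases hx : x = 0
      · rw [hx] at h4
        rw [hx]
        exact pow_eq_zero_iff (by norm_num : 4 ≠ 0) |>.mp (by simpa using h4)
      · exfalso
        have hsq : IsSquare (-1 : ZMod p) := ⟨y * x⁻¹, by
          field_simp
          linear_combination -h1⟩
        exact ZMod.exists_sq_eq_neg_one_iff.mp hsq hp
  exact (card_le_card h).trans (card_le_two)

lemma norm_gs_sq_le_nine {b : ZMod p} (hb : b ≠ 0) : ‖gs p b‖ ^ 2 ≤ 9 * p := by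
  have := norm_gs_sq_le (by norm_num) card_fiber_four hb
  norm_num at this
  exact this

lemma norm_gs_sq_le_one (hp : p % 4 = 3) {b : ZMod p} (hb : b ≠ 0) : ‖gs p b‖ ^ 2 ≤ p := by
  have := norm_gs_sq_le (by norm_num) (card_fiber_two hp) hb
  norm_num at this
  exact this

end

end Biquad

namespace Biquad
open Finset Polynomial

lemma cs_pow_four_small {p k N : ℕ} [NeZero N] (hp : p.Prime) (h2 : p ≠ 2) (hN : N = p ^ (k + 2))
    (hk : k ≤ 2) {b : ZMod N} (hb : IsUnit b) : ‖cs (X ^ 4) N b‖ = 1 / p := by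
  rw [cs_pow_four_eq_of_odd hp h2 (n := k) (by rw [hN]; ring) hb]
  exact sum_pow_four_small (by rw [hN]; ring) (hN ▸ pow_dvd_pow p (by omega)) b

lemma cs_pow_four_rec {p n : ℕ} [NeZero p] (hp : p.Prime) (hn : 1 ≤ n) {b : ZMod (p ^ n * p ^ 4)}
    (hb : IsUnit b) :
    ‖cs (X ^ 4) (p ^ n * p ^ 4) b‖ = 1 / p * ‖cs (X ^ 4) (p ^ n) (redL (p ^ n) (p ^ 4) b)‖ := by
  rw [← sum_pow_four_large b]
  congr 1
  by_cases h2 : p = 2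
  · subst h2
    obtain ⟨m, rfl⟩ := Nat.exists_eq_add_of_le' hn
    rw [cs_pow_four_eq_of_two (n := m) (by ring) hb]
    congr 3
    ring
  · rw [cs_pow_four_eq_of_odd hp h2 (n := n + 2) (by ring) hb]
    congr 3
    ring

/-- Local factors in the bound for quartic sums. -/
def locS (p : ℕ) : ℝ := if p = 2 then 16 else if p < 19 then p else 1

lemma one_le_locS {p : ℕ} (hp : p.Prime) : 1 ≤ locS p := by
  unfold locS
  split_ifs
  · norm_num
  · exact_mod_cast hp.one_le
  · exact le_rfl

lemma pow_eight_mul_le_of_norm_le_one {x N C : ℝ} (hx : 0 ≤ x) (hx1 : x ≤ 1) (hN : 0 ≤ N) (h : N ≤ C) :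
    x ^ 8 * N ≤ C :=
  (mul_le_of_le_one_left hN (pow_le_one₀ hx hx1)).trans h

lemma norm_cs_pow_four_le {p : ℕ} [Fact p.Prime] (k : ℕ) :
    ∀ (b : ZMod (p ^ k)), IsUnit b → ‖cs (X ^ 4) (p ^ k) b‖ ^ 8 * (p ^ k : ℕ) ≤ locS p := by
  have hp : p.Prime := Fact.out
  have hp0 : (0 : ℝ) < p := by exact_mod_cast hp.pos
  have hp1 : (1 : ℝ) ≤ p := by exact_mod_cast hp.one_le
  induction k using Nat.strong_induction_on with
  | _ k ih =>
    intro b hb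
    by_cases hk5 : 5 ≤ k
    · obtain ⟨n, rfl⟩ := Nat.exists_eq_add_of_le' (show 4 ≤ k by omega)
      have h := ih n (by omega)
      suffices H : ∀ (N : ℕ) [NeZero N], N = p ^ n * p ^ 4 → ∀ b : ZMod N, IsUnit b →
          ‖cs (X ^ 4) N b‖ ^ 8 * (N : ℕ) ≤ locS p from H _ (pow_add p n 4) b hb
      rintro _ _ rfl b hb
      rw [cs_pow_four_rec hp (by omega) hb, mul_pow]
      have h1 := h _ (isUnit_red hb).1
      have : (1 / (p : ℝ)) ^ 8 * ‖cs (X ^ 4) (p ^ n) (redL (p ^ n) (p ^ 4) b)‖ ^ 8 * ((p ^ n * p ^ 4 : ℕ) : ℝ)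
          = (‖cs (X ^ 4) (p ^ n) (redL (p ^ n) (p ^ 4) b)‖ ^ 8 * (p ^ n : ℕ)) / p ^ 4 := by
        push_cast
        field_simp
      rw [this, div_le_iff₀ (by positivity)]
      refine h1.trans (le_mul_of_one_le_right ?_ (one_le_pow₀ hp1))
      linarith [one_le_locS hp]
    · have hone := norm_cs_le_one (X ^ 4) (p ^ k) b
      have hN : (0 : ℝ) ≤ (p ^ k : ℕ) := Nat.cast_nonneg _
      by_cases h2 : p = 2
      · refine pow_eight_mul_le_of_norm_le_one (norm_nonneg _) hone hN ?_
        have : p ^ k ≤ 16 := by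
          subst h2
          calc 2 ^ k ≤ 2 ^ 4 := Nat.pow_le_pow_right (by norm_num) (by omega)
            _ = 16 := by norm_num
        rw [locS, if_pos h2]
        exact_mod_cast this
      · by_cases hk2 : 2 ≤ k
        · obtain ⟨m, rfl⟩ := Nat.exists_eq_add_of_le' hk2
          rw [cs_pow_four_small hp h2 rfl (by omega) hb]
          refine le_trans ?_ (one_le_locS hp)
          rw [div_pow, one_pow, div_mul_eq_mul_div, one_mul, div_le_one (by positivity)]
          push_cast
          exact pow_le_pow_right₀ hp1 (by omega)
        · by_cases h19 : p < 19
          · refine pow_eight_mul_le_of_norm_le_one (norm_nonneg _) hone hN ?_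
            rw [locS, if_neg h2, if_pos h19]
            push_cast
            calc (p : ℝ) ^ k ≤ p ^ 1 := pow_le_pow_right₀ hp1 (by omega)
              _ = p := pow_one _
          · rw [locS, if_neg h2, if_neg h19]
            obtain rfl | rfl : k = 0 ∨ k = 1 := by omega
            · refine pow_eight_mul_le_of_norm_le_one (norm_nonneg _) hone hN ?_
              simp
            · suffices H : ∀ (N : ℕ) [NeZero N], N = p → ∀ b : ZMod N, IsUnit b →
                  ‖cs (X ^ 4) N b‖ ^ 8 * (N : ℕ) ≤ 1 from H _ (pow_one p) b hb
              intro N _ hNp b hb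
              have hNp' := hNp.symm
              subst hNp'
              have hb0 : b ≠ 0 := hb.ne_zero
              have hg := norm_gs_sq_le_nine hb0
              have he : cs (X ^ 4) p b = (p : ℂ)⁻¹ * gs p b := cs_pow_four p b
              rw [he, norm_mul, norm_inv, Complex.norm_natCast, mul_pow]
              have h8 : ‖gs p b‖ ^ 8 ≤ (9 * p) ^ 4 := by
                calc ‖gs p b‖ ^ 8 = (‖gs p b‖ ^ 2) ^ 4 := by ring
                  _ ≤ _ := pow_le_pow_left₀ (sq_nonneg _) hg 4
              have h19' : (19 : ℝ) ≤ p := by exact_mod_cast not_lt.mp h19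
              calc (p : ℝ)⁻¹ ^ 8 * ‖gs p b‖ ^ 8 * (p : ℝ) ≤ (p : ℝ)⁻¹ ^ 8 * (9 * p) ^ 4 * (p : ℝ) := by
                      gcongr
                _ = 6561 / (p : ℝ) ^ 3 := by field_simp; norm_num
                _ ≤ 1 := by
                  rw [div_le_one (by positivity)]
                  calc (6561 : ℝ) ≤ 19 ^ 3 := by norm_num
                    _ ≤ p ^ 3 := by gcongr

/-- The sum of a permutation polynomial vanishes. -/
lemma cs_phiP_eq_zero {q : ℕ} [NeZero q] {c k : ℕ} (hq : 1 < q) (h10 : q ∣ 10 ^ k)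
    (hc : IsUnit (c : ZMod q)) {a : ZMod q} (ha : IsUnit a) : cs (phiP c) q a = 0 := by
  have hnil : IsNilpotent (10 : ZMod q) := by
    refine ⟨k, ?_⟩
    have := (ZMod.natCast_eq_zero_iff (10 ^ k) q).mpr h10
    exact_mod_cast this
  have hinj : Function.Injective (fun t : ZMod q => aeval t (phiP c)) := by
    intro t s hts
    simp only [aeval_phiP] at hts
    have h1 : (t - s) * (10 * (200 * (t ^ 3 + t ^ 2 * s + t * s ^ 2 + s ^ 3)
        + 40 * c * (t ^ 2 + t * s + s ^ 2) + 3 * c ^ 2 * (t + s)) + (c : ZMod q) ^ 3) = 0 := by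
      linear_combination hts
    have hu : IsUnit (10 * (200 * (t ^ 3 + t ^ 2 * s + t * s ^ 2 + s ^ 3)
        + 40 * c * (t ^ 2 + t * s + s ^ 2) + 3 * c ^ 2 * (t + s)) + (c : ZMod q) ^ 3) :=
      IsNilpotent.isUnit_add_right_of_commute ((Commute.all _ _).isNilpotent_mul_right hnil)
        (hc.pow 3) (Commute.all _ _)
    exact sub_eq_zero.mp (hu.mul_left_eq_zero.mp h1)
  have hbij := Finite.injective_iff_bijective.mp hinj
  have : Fact (1 < q) := ⟨hq⟩
  have h0 : ∑ t : ZMod q, (ZMod.stdAddChar (a * aeval t (phiP c)) : ℂ) = 0 := by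
    rw [Function.Bijective.sum_comp hbij (fun z => (ZMod.stdAddChar (a * z) : ℂ))]
    have := AddChar.sum_mulShift a (ZMod.isPrimitive_stdAddChar q)
    rw [if_neg ha.ne_zero] at this
    simpa [mul_comm] using this
  rw [cs, h0, mul_zero]

lemma cs_C_mul (d : ℕ) (q : ℕ) [NeZero q] (a : ZMod q) :
    cs (C (d : ℤ) * X ^ 4) q a = cs (X ^ 4) q (d * a) := by
  unfold cs
  congr 1
  refine sum_congr rfl fun t _ => ?_
  congr 1
  simp
  ring

/-- Local factors in the bound for the sums of `phiP`. -/
def locT (p : ℕ) : ℝ := if p = 2 then 256 else if p = 5 then 625 else locS p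

lemma one_le_locT {p : ℕ} (hp : p.Prime) : 1 ≤ locT p := by
  unfold locT
  split_ifs
  · norm_num
  · norm_num
  · exact one_le_locS hp

lemma norm_cs_scaled_le {p : ℕ} [Fact p.Prime] (j k : ℕ) {a : ZMod (p ^ k)} (ha : IsUnit a) :
    ‖cs (X ^ 4) (p ^ k) ((p ^ j : ℕ) * a)‖ ^ 8 * (p ^ k : ℕ) ≤ p ^ j * locS p := by
  have hp : p.Prime := Fact.out
  have hp1 : (1 : ℝ) ≤ p := by exact_mod_cast hp.one_le
  by_cases hk : k ≤ j
  · refine pow_eight_mul_le_of_norm_le_one (norm_nonneg _) (norm_cs_le_one _ _ _)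
      (Nat.cast_nonneg _) ?_
    push_cast
    calc (p : ℝ) ^ k ≤ p ^ j := pow_le_pow_right₀ hp1 hk
      _ ≤ _ := le_mul_of_one_le_right (by positivity) (one_le_locS hp)
  · obtain ⟨n, rfl⟩ := Nat.exists_eq_add_of_le' (show j ≤ k by omega)
    suffices H : ∀ (N : ℕ) [NeZero N], N = p ^ n * p ^ j → ∀ a : ZMod N, IsUnit a →
        ‖cs (X ^ 4) N ((p ^ j : ℕ) * a)‖ ^ 8 * (N : ℕ) ≤ p ^ j * locS p from
      H _ (pow_add p n j) a ha
    rintro _ _ rfl a ha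
    rw [cs_natCast_mul]
    have h := norm_cs_pow_four_le n _ (isUnit_red ha).1
    have hj : (0 : ℝ) ≤ p ^ j := by positivity
    have := mul_le_mul_of_nonneg_left h hj
    push_cast at this ⊢
    linarith

lemma norm_cs_phiP_le {p : ℕ} [Fact p.Prime] {c : ℕ} (hc : c ∈ ({0, 1, 4, 5} : Finset ℕ))
    (k : ℕ) (hk : 0 < k) {a : ZMod (p ^ k)} (ha : IsUnit a) :
    ‖cs (phiP c) (p ^ k) a‖ ^ 8 * (p ^ k : ℕ) ≤ locT p := by
  have hp : p.Prime := Fact.out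
  have hq1 : 1 < p ^ k := Nat.one_lt_pow hk.ne' hp.one_lt
  have hcop : ∀ m : ℕ, m.Coprime p → IsUnit (m : ZMod (p ^ k)) := fun m hm => by
    rw [ZMod.isUnit_iff_coprime]; exact hm.pow_right k
  have hzero : ∀ {m : ℕ}, p ∣ 10 → IsUnit ((c : ℕ) : ZMod (p ^ k)) →
      ‖cs (phiP c) (p ^ k) a‖ ^ 8 * (p ^ k : ℕ) ≤ locT p := by
    intro _ h10 hcu
    rw [cs_phiP_eq_zero hq1 (pow_dvd_pow_of_dvd h10 k) hcu ha]
    simp only [norm_zero]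
    linarith [one_le_locT hp]
  by_cases h2 : p = 2
  · subst h2
    have hmain : ∀ c', c = 4 * c' → ‖cs (phiP c) (2 ^ k) a‖ ^ 8 * (2 ^ k : ℕ) ≤ locT 2 := by
      intro c' hcc
      have h5 := hcop 5 (by norm_num)
      have key := norm_cs_phiP c (q := 2 ^ k) (n := 5) (n' := 5) (d := 16) (c' := c')
        (fun t => by rw [aeval_phiP, hcc]; push_cast; ring) h5.unit rfl h5 a
      rw [key, cs_C_mul]
      have := norm_cs_scaled_le (p := 2) 4 k (a := a * ↑h5.unit⁻¹) (ha.mul (Units.isUnit _))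
      norm_num [locS] at this
      norm_num [locT]
      linarith
    simp only [mem_insert, mem_singleton] at hc
    rcases hc with rfl | rfl | rfl | rfl
    · exact hmain 0 rfl
    · exact hzero (m := 0) (by norm_num) (hcop 1 (by norm_num))
    · exact hmain 1 rfl
    · exact hzero (m := 0) (by norm_num) (hcop 5 (by norm_num))
  · by_cases h5 : p = 5
    · subst h5
      have hmain : ∀ c', c = 5 * c' → ‖cs (phiP c) (5 ^ k) a‖ ^ 8 * (5 ^ k : ℕ) ≤ locT 5 := by
        intro c' hcc
        have h16 := hcop 16 (by norm_num)
        have h4 := hcop 4 (by norm_num)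
        have key := norm_cs_phiP c (q := 5 ^ k) (n := 16) (n' := 4) (d := 125) (c' := c')
          (fun t => by rw [aeval_phiP, hcc]; push_cast; ring) h16.unit rfl h4 a
        rw [key, cs_C_mul]
        have := norm_cs_scaled_le (p := 5) 3 k (a := a * ↑h16.unit⁻¹) (ha.mul (Units.isUnit _))
        norm_num [locS] at this
        norm_num [locT]
        linarith
      simp only [mem_insert, mem_singleton] at hc
      rcases hc with rfl | rfl | rfl | rfl
      · exact hmain 0 rfl
      · exact hzero (m := 0) (by norm_num) (hcop 1 (by norm_num))
      · exact hzero (m := 0) (by norm_num) (hcop 4 (by norm_num))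
      · exact hmain 1 rfl
    · have hp2 : Nat.Coprime 2 p := (Nat.coprime_primes Nat.prime_two hp).mpr (Ne.symm h2)
      have hp5 : Nat.Coprime 5 p := (Nat.coprime_primes Nat.prime_five hp).mpr (Ne.symm h5)
      have h80 := hcop 80 ((hp2.pow_left 4).mul_left hp5)
      have h20 := hcop 20 ((hp2.pow_left 2).mul_left hp5)
      have key := norm_cs_phiP c (q := p ^ k) (n := 80) (n' := 20) (d := 1) (c' := c)
          (fun t => by rw [aeval_phiP]; push_cast; ring) h80.unit rfl h20 a
      rw [key, cs_C_mul]
      have := norm_cs_scaled_le (p := p) 0 k (a := a * ↑h80.unit⁻¹) (ha.mul (Units.isUnit _))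
      rw [pow_zero, pow_zero, one_mul] at this
      rw [locT, if_neg h2, if_neg h5]
      exact this

lemma norm_cs_pow_eight_le_prod (P : ℤ[X]) (h : ℕ → ℝ)
    (hP : ∀ (p : ℕ) [Fact p.Prime] (k : ℕ), 0 < k → ∀ a : ZMod (p ^ k), IsUnit a →
      ‖cs P (p ^ k) a‖ ^ 8 * (p ^ k : ℕ) ≤ h p) (q : ℕ) :
    ∀ [NeZero q] (a : ZMod q), IsUnit a → ‖cs P q a‖ ^ 8 * q ≤ ∏ p ∈ q.primeFactors, h p := by
  induction q using Nat.recOnPosPrimePosCoprime with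
  | prime_pow p k hp hk =>
    intro _ a ha
    have : Fact p.Prime := ⟨hp⟩
    rw [Nat.primeFactors_prime_pow hk.ne' hp, prod_singleton]
    exact hP p k hk a ha
  | zero => intro h0; exact absurd rfl (NeZero.ne 0)
  | one =>
    intro _ a ha
    simpa using pow_eight_mul_le_of_norm_le_one (norm_nonneg _) (norm_cs_le_one P 1 a) zero_le_one le_rfl
  | coprime m n hm hn hmn ihm ihn =>
    intro _ a ha
    have : NeZero m := ⟨by omega⟩
    have : NeZero n := ⟨by omega⟩
    obtain ⟨u, v, huv⟩ := cs_mul hmn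
    rw [huv P a, hmn.primeFactors_mul, prod_union hmn.disjoint_primeFactors]
    have h1 := ihm (u * redL m n a) (u.isUnit.mul (isUnit_red ha).1)
    have h2 := ihn (v * redR m n a) (v.isUnit.mul (isUnit_red ha).2)
    have := mul_le_mul h1 h2 (by positivity) (le_trans (by positivity) h1)
    refine le_trans (le_of_eq ?_) this
    rw [norm_mul]
    push_cast
    ring

lemma norm_cs_phiP_pow_eight_le {c : ℕ} (hc : c ∈ ({0, 1, 4, 5} : Finset ℕ)) (q : ℕ) [NeZero q]
    {a : ZMod q} (ha : IsUnit a) : ‖cs (phiP c) q a‖ ^ 8 * q ≤ 9 * 10 ^ 9 := by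
  refine (norm_cs_pow_eight_le_prod (phiP c) locT (fun p _ k hk a ha => norm_cs_phiP_le hc k hk ha)
    q a ha).trans ?_
  have hsplit : ∏ p ∈ q.primeFactors, locT p = ∏ p ∈ q.primeFactors with p < 19, locT p := by
    rw [prod_filter]
    refine prod_congr rfl fun p _ => ?_
    split_ifs with h
    · rfl
    · rw [locT, if_neg (by omega), if_neg (by omega), locS, if_neg (by omega), if_neg h]
  rw [hsplit]
  have hsub : (q.primeFactors.filter fun p => p < 19) ⊆ (range 19).filter Nat.Prime := by
    intro p hp
    rw [mem_filter] at hp ⊢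
    exact ⟨mem_range.mpr hp.2, Nat.prime_of_mem_primeFactors hp.1⟩
  have hone : ∀ p ∈ (range 19).filter Nat.Prime, 1 ≤ locT p :=
    fun p hp => one_le_locT (mem_filter.mp hp).2
  calc ∏ p ∈ q.primeFactors with p < 19, locT p ≤ ∏ p ∈ (range 19).filter Nat.Prime, locT p :=
        by
        refine prod_le_prod_of_subset_of_one_le hsub (fun p hp => ?_) (fun p hp _ => hone p hp)
        linarith [hone p (hsub hp)]
    _ ≤ 9 * 10 ^ 9 := by
      have : (range 19).filter Nat.Prime = {2, 3, 5, 7, 11, 13, 17} := by decide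
      rw [this]
      simp only [locT, locS]
      norm_num

end Biquad

namespace Biquad
open Finset Polynomial

open Classical in
/-- The ninth moment of the quartic sums to modulus `q`. -/
noncomputable def moment (q : ℕ) [NeZero q] : ℝ :=
  ∑ a : ZMod q, if IsUnit a then ‖cs (X ^ 4) q a‖ ^ 9 else 0

lemma moment_nonneg (q : ℕ) [NeZero q] : 0 ≤ moment q :=
  sum_nonneg fun a _ => by split_ifs <;> positivity

lemma moment_mul {m n : ℕ} [NeZero m] [NeZero n] (h : m.Coprime n) :
    moment (m * n) = moment m * moment n := by
  classical
  obtain ⟨u, v, huv⟩ := cs_mul h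
  have hm : moment m = ∑ a : ZMod m, if IsUnit a then ‖cs (X ^ 4) m (u * a)‖ ^ 9 else 0 := by
    refine (Fintype.sum_equiv (Units.mulLeft u) _ _ fun a => ?_).symm
    simp
  have hn : moment n = ∑ a : ZMod n, if IsUnit a then ‖cs (X ^ 4) n (v * a)‖ ^ 9 else 0 := by
    refine (Fintype.sum_equiv (Units.mulLeft v) _ _ fun a => ?_).symm
    simp
  rw [hm, hn, Fintype.sum_mul_sum, ← Fintype.sum_prod_type']
  refine Fintype.sum_equiv (ZMod.chineseRemainder h).toEquiv _ _ fun t => ?_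
  have e1 : ((ZMod.chineseRemainder h).toEquiv t).1 = redL m n t := chineseRemainder_fst h t
  have e2 : ((ZMod.chineseRemainder h).toEquiv t).2 = redR m n t := chineseRemainder_snd h t
  have hu : IsUnit t ↔ IsUnit (redL m n t) ∧ IsUnit (redR m n t) := by
    rw [← e1, ← e2, ← Prod.isUnit_iff]
    exact (MulEquiv.isUnit_map (ZMod.chineseRemainder h)).symm
  rw [e1, e2, huv, norm_mul, mul_pow]
  by_cases h1 : IsUnit (redL m n t) <;> by_cases h2 : IsUnit (redR m n t) <;>
    simp [hu, h1, h2, -ZMod.castHom_apply]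

lemma moment_congr {m n : ℕ} [NeZero m] [NeZero n] (h : m = n) : moment m = moment n := by
  subst h; rfl

lemma isUnit_red_pow_iff {p k j : ℕ} (hk : 1 ≤ k) (a : ZMod (p ^ k * p ^ j)) :
    IsUnit a ↔ IsUnit (redL (p ^ k) (p ^ j) a) := by
  refine ⟨fun h => (isUnit_red h).1, fun h => ?_⟩
  obtain ⟨i, rfl⟩ := ZMod.intCast_surjective a
  rw [map_intCast, ZMod.coe_int_isUnit_iff_isCoprime] at h
  rw [ZMod.coe_int_isUnit_iff_isCoprime]
  push_cast at h ⊢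
  have hp : IsCoprime (p : ℤ) i := (IsCoprime.pow_left_iff hk).mp h
  exact hp.pow_left.mul_left hp.pow_left

lemma moment_rec {p : ℕ} [Fact p.Prime] {k : ℕ} (hk : 1 ≤ k) :
    moment (p ^ (k + 4)) = (1 / (p : ℝ) ^ 5) * moment (p ^ k) := by
  classical
  have hp : p.Prime := Fact.out
  have hp0 : (p : ℝ) ≠ 0 := by exact_mod_cast hp.ne_zero
  rw [moment_congr (pow_add p k 4)]
  set F : ZMod (p ^ k) → ℂ := fun b =>
    (((1 / (p : ℝ)) ^ 9 * if IsUnit b then ‖cs (X ^ 4) (p ^ k) b‖ ^ 9 else 0 : ℝ) : ℂ) with hF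
  have h1 : (moment (p ^ k * p ^ 4) : ℂ) = ∑ a : ZMod (p ^ k * p ^ 4), F (redL (p ^ k) (p ^ 4) a) := by
    unfold moment
    push_cast
    refine sum_congr rfl fun a _ => ?_
    rw [hF]
    simp only [← isUnit_red_pow_iff hk]
    split_ifs with ha
    · rw [cs_pow_four_rec hp hk ha]
      push_cast
      ring
    · simp
  have h2 : ∑ a : ZMod (p ^ k * p ^ 4), F (redL (p ^ k) (p ^ 4) a)
      = ((p ^ 4 : ℕ) : ℂ) * ∑ b : ZMod (p ^ k), F b := by
    rw [← sum_range_mul_cast_zmod, ← sum_range_cast_zmod_complex]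
    refine sum_congr rfl fun i _ => ?_
    rw [map_natCast]
  have h3 : (moment (p ^ k * p ^ 4) : ℂ) = ((1 / (p : ℝ) ^ 5 * moment (p ^ k) : ℝ) : ℂ) := by
    rw [h1, h2, hF, ← Complex.ofReal_sum, ← mul_sum]
    rw [← Complex.ofReal_natCast, ← Complex.ofReal_mul]
    congr 1
    unfold moment
    push_cast
    field_simp
  exact_mod_cast h3

lemma card_units_le (N : ℕ) [NeZero N] (C : ℝ) (f : ZMod N → ℝ) (hC : 0 ≤ C) [DecidablePred fun a : ZMod N => IsUnit a]
    (h : ∀ a, IsUnit a → f a ≤ C) : ∑ a : ZMod N, (if IsUnit a then f a else 0) ≤ N * C := by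
  refine (sum_le_card_nsmul univ _ C fun a _ => ?_).trans ?_
  · split_ifs with ha
    · exact h a ha
    · exact hC
  · rw [card_univ, ZMod.card, nsmul_eq_mul]

lemma moment_small {p : ℕ} [Fact p.Prime] (h2 : p ≠ 2) {k : ℕ} (hk : k ≤ 2) :
    moment (p ^ (k + 2)) ≤ (p : ℝ) ^ (k + 2) / p ^ 9 := by
  classical
  refine (card_units_le _ ((1 / (p : ℝ)) ^ 9) _ (by positivity) fun a ha => ?_).trans ?_
  · rw [cs_pow_four_small Fact.out h2 rfl hk ha]
  · push_cast
    rw [div_pow, one_pow, mul_one_div]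

lemma moment_prime {p : ℕ} [Fact p.Prime] {d : ℕ} {M r : ℝ} (hr : 0 ≤ r) (hM : M ≤ r ^ 2)
    (hd : ∀ x : ZMod p, (univ.filter fun y : ZMod p => y ^ 4 = x ^ 4).card ≤ d)
    (hG : ∀ b : ZMod p, b ≠ 0 → ‖gs p b‖ ^ 2 ≤ M) :
    moment p ≤ M ^ 3 * r * (p * (p - 1) * (d - 1)) / p ^ 9 := by
  classical
  have hp0 : (0 : ℝ) < p := by exact_mod_cast (Fact.out : p.Prime).pos
  have hM0 : 0 ≤ M := (sq_nonneg _).trans (hG 1 one_ne_zero)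
  have h1 : moment p = (∑ b ∈ univ.erase (0 : ZMod p), ‖gs p b‖ ^ 9) / p ^ 9 := by
    unfold moment
    rw [sum_div, ← add_sum_erase _ _ (mem_univ (0 : ZMod p))]
    rw [if_neg not_isUnit_zero, zero_add]
    refine sum_congr rfl fun b hb => ?_
    rw [if_pos (isUnit_iff_ne_zero.mpr (ne_of_mem_erase hb))]
    have he : cs (X ^ 4) p b = (p : ℂ)⁻¹ * gs p b := cs_pow_four p b
    rw [he, norm_mul, norm_inv, Complex.norm_natCast, mul_pow]
    field_simp
  rw [h1]
  refine div_le_div_of_nonneg_right ?_ (by positivity)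
  calc ∑ b ∈ univ.erase (0 : ZMod p), ‖gs p b‖ ^ 9
      ≤ ∑ b ∈ univ.erase (0 : ZMod p), M ^ 3 * r * ‖gs p b‖ ^ 2 := by
        refine sum_le_sum fun b hb => ?_
        have hb2 := hG b (ne_of_mem_erase hb)
        have hbr : ‖gs p b‖ ≤ r := abs_le_of_sq_le_sq' (hb2.trans hM) hr |>.2
        calc ‖gs p b‖ ^ 9 = (‖gs p b‖ ^ 2) ^ 3 * ‖gs p b‖ * ‖gs p b‖ ^ 2 := by ring
          _ ≤ _ := by gcongr
    _ = M ^ 3 * r * ∑ b ∈ univ.erase (0 : ZMod p), ‖gs p b‖ ^ 2 := by rw [mul_sum]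
    _ ≤ _ := mul_le_mul_of_nonneg_left (sum_norm_gs_sq hd) (by positivity)

lemma sum_moment_le {p : ℕ} [Fact p.Prime] (h2 : p ≠ 2) {t : ℝ}
    (ht : moment p + 1 / (p : ℝ) ^ 7 + 1 / (p : ℝ) ^ 6 + 1 / (p : ℝ) ^ 5 ≤ t * (1 - 1 / (p : ℝ) ^ 5))
    (K : ℕ) : ∑ k ∈ range K, moment (p ^ (k + 1)) ≤ t := by
  have hp0 : (0 : ℝ) < p := by exact_mod_cast (Fact.out : p.Prime).pos
  have hp1 : (1 : ℝ) < p := by exact_mod_cast (Fact.out : p.Prime).one_lt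
  have hlt : 1 / (p : ℝ) ^ 5 < 1 := by
    rw [div_lt_one (by positivity)]
    exact one_lt_pow₀ hp1 (by norm_num)
  have ht0 : 0 ≤ t := by
    have h : 0 ≤ t * (1 - 1 / (p : ℝ) ^ 5) := le_trans (by have := moment_nonneg p; positivity) ht
    exact nonneg_of_mul_nonneg_left h (by linarith)
  have hfour : ∑ k ∈ range 4, moment (p ^ (k + 1))
      ≤ moment p + 1 / (p : ℝ) ^ 7 + 1 / (p : ℝ) ^ 6 + 1 / (p : ℝ) ^ 5 := by
    simp only [sum_range_succ, range_zero, sum_empty, zero_add]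
    have e1 : moment (p ^ 1) = moment p := moment_congr (pow_one p)
    have e2 := moment_small h2 (show 0 ≤ 2 by norm_num)
    have e3 := moment_small h2 (show 1 ≤ 2 by norm_num)
    have e4 := moment_small h2 (show 2 ≤ 2 by norm_num)
    have f2 : (p : ℝ) ^ (0 + 2) / p ^ 9 = 1 / (p : ℝ) ^ 7 := by field_simp
    have f3 : (p : ℝ) ^ (1 + 2) / p ^ 9 = 1 / (p : ℝ) ^ 6 := by field_simp
    have f4 : (p : ℝ) ^ (2 + 2) / p ^ 9 = 1 / (p : ℝ) ^ 5 := by field_simp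
    norm_num at e1 e2 e3 e4 f2 f3 f4 ⊢
    linarith
  have hmain : ∀ K, ∑ k ∈ range (K + 4), moment (p ^ (k + 1)) ≤ t := by
    intro K
    induction K using Nat.strong_induction_on with
    | _ K ih =>
      have hle : ∑ k ∈ range K, moment (p ^ (k + 1)) ≤ t := by
        by_cases hK : K < 4
        · refine (sum_le_sum_of_subset_of_nonneg (range_subset_range.mpr hK.le)
            fun _ _ _ => moment_nonneg _).trans (hfour.trans (ht.trans ?_))
          exact mul_le_of_le_one_right ht0 (by linarith [show 0 ≤ 1 / (p : ℝ) ^ 5 by positivity])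
        · obtain ⟨m, rfl⟩ := Nat.exists_eq_add_of_le' (not_lt.mp hK)
          exact ih m (by omega)
      rw [add_comm K 4, sum_range_add]
      have : ∀ k ∈ range K, moment (p ^ (4 + k + 1)) = 1 / (p : ℝ) ^ 5 * moment (p ^ (k + 1)) := by
        intro k _
        rw [← moment_rec (by omega)]
        exact moment_congr (by ring)
      rw [sum_congr rfl this, ← mul_sum]
      have := mul_le_mul_of_nonneg_left hle (show 0 ≤ 1 / (p : ℝ) ^ 5 by positivity)
      linarith
  exact (sum_le_sum_of_subset_of_nonneg (range_subset_range.mpr (by omega))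
    fun _ _ _ => moment_nonneg _).trans (hmain K)

end Biquad

namespace Biquad
open Finset Polynomial

/-- An upper bound for the contribution of the prime `p` to the singular series. -/
noncomputable def locB (p : ℕ) : ℝ :=
  if p = 2 ∨ p = 5 then 0 else if p = 3 then 0.021 else if p = 13 then 0.185
  else if p = 17 then 0.305 else if p % 4 = 3 then 2 / (p : ℝ) ^ 3
  else 6561 / ((p : ℝ) ^ 3 * if p < 37 then 5 else if p < 101 then 6 else 10)

lemma locB_nonneg (p : ℕ) : 0 ≤ locB p := by
  unfold locB
  split_ifs <;> positivity

lemma norm_gs_sq_le_thirteen {b : ZMod 13} (hb : b ≠ 0) : ‖gs 13 b‖ ^ 2 ≤ 78 := by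
  have hneg : ∀ x y : ZMod 13, y ≠ 0 → x ^ 4 ≠ -y ^ 4 := by decide
  have : Fact (Nat.Prime 13) := ⟨by norm_num⟩
  have := norm_gs_sq_le_of_neg (p := 13) (by norm_num) card_fiber_four hneg hb
  norm_num at this
  linarith

lemma sum_moment_le_locB {p : ℕ} [hp : Fact p.Prime] (h2 : p ≠ 2) (h5 : p ≠ 5) (K : ℕ) :
    ∑ k ∈ range K, moment (p ^ (k + 1)) ≤ locB p := by
  refine sum_moment_le h2 ?_ K
  have hp0 : (0 : ℝ) < p := by exact_mod_cast hp.out.pos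
  rcases eq_or_ne p 3 with rfl | h3
  · have := moment_prime (p := 3) (d := 2) (M := 3) (r := 1.7321) (by norm_num) (by norm_num)
      (card_fiber_two rfl) fun b hb => norm_gs_sq_le_one rfl hb
    norm_num [locB] at this ⊢
    linarith
  rcases eq_or_ne p 13 with rfl | h13
  · have := moment_prime (p := 13) (d := 4) (M := 78) (r := 8.832) (by norm_num) (by norm_num)
      card_fiber_four fun b hb => norm_gs_sq_le_thirteen hb
    norm_num [locB] at this ⊢
    linarith
  rcases eq_or_ne p 17 with rfl | h17
  · have := moment_prime (p := 17) (d := 4) (M := 153) (r := 12.37) (by norm_num) (by norm_num)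
      card_fiber_four fun b hb => (norm_gs_sq_le_nine hb).trans (by norm_num)
    norm_num [locB] at this ⊢
    linarith
  by_cases h4 : p % 4 = 3
  · have h7 : 7 ≤ p := by
      have := hp.out.two_le
      by_contra!
      interval_cases p <;> omega
    have h7' : (7 : ℝ) ≤ p := by exact_mod_cast h7
    have := moment_prime (p := p) (d := 2) (M := p) (r := p) hp0.le (by nlinarith)
      (card_fiber_two h4) fun b hb => norm_gs_sq_le_one h4 hb
    have hl : locB p = 2 / (p : ℝ) ^ 3 := by simp [locB, h2, h5, h3, h13, h17, h4]
    rw [hl]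
    have e : (p : ℝ) ^ 3 * p * (p * (p - 1) * ((2 : ℕ) - 1)) / p ^ 9 ≤ 1 / (p : ℝ) ^ 3 := by
      rw [div_le_div_iff₀ (by positivity) (by positivity)]
      have : (0:ℝ) < p ^ 8 := by positivity
      push_cast
      nlinarith
    have e2 : 1 / (p : ℝ) ^ 7 + 1 / (p : ℝ) ^ 6 + 1 / (p : ℝ) ^ 5 ≤
        2 / (p : ℝ) ^ 3 * (1 - 1 / (p : ℝ) ^ 5) - 1 / (p : ℝ) ^ 3 := by
      have e3 : 2 / (p : ℝ) ^ 3 * (1 - 1 / (p : ℝ) ^ 5) - 1 / (p : ℝ) ^ 3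
        - (1 / (p : ℝ) ^ 7 + 1 / (p : ℝ) ^ 6 + 1 / (p : ℝ) ^ 5) =
        (p ^ 5 - p ^ 3 - p ^ 2 - p - 2) / (p : ℝ) ^ 8 := by
        field_simp
        ring
      have : 0 ≤ (p ^ 5 - p ^ 3 - p ^ 2 - p - 2) / (p : ℝ) ^ 8 := by
        refine div_nonneg ?_ (by positivity)
        have h2 : (49 : ℝ) ≤ p ^ 2 := by nlinarith
        have h3 : (343 : ℝ) ≤ p ^ 3 := by nlinarith
        nlinarith
      linarith
    linarith
  · have hodd : p % 2 = 1 := (hp.out.eq_two_or_odd).resolve_left h2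
    have h29 : 29 ≤ p := by
      have := hp.out.two_le
      by_contra!
      have hpp := hp.out
      interval_cases p <;> first | omega | (norm_num at hpp)
    have h29' : (29 : ℝ) ≤ p := by exact_mod_cast h29
    obtain ⟨s, hs0, hs, hl⟩ : ∃ s : ℝ, 0 < s ∧ s ≤ √p ∧ locB p = 6561 / ((p : ℝ) ^ 3 * s) := by
      refine ⟨if p < 37 then 5 else if p < 101 then 6 else 10, ?_, ?_, ?_⟩
      · split_ifs <;> norm_num
      · apply Real.le_sqrt_of_sq_le
        split_ifs with h h'
        · linarith
        · have : (37 : ℝ) ≤ p := by exact_mod_cast not_lt.mp h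
          linarith
        · have : (101 : ℝ) ≤ p := by exact_mod_cast not_lt.mp h'
          linarith
      · simp [locB, h2, h5, h3, h13, h17, h4]
    have hsq : √(p : ℝ) ^ 2 = p := Real.sq_sqrt hp0.le
    have hs5 : 5 ≤ √(p : ℝ) := Real.le_sqrt_of_sq_le (by linarith)
    set w := √(p : ℝ)
    have := moment_prime (p := p) (d := 4) (M := 9 * p) (r := 3 * w) (by positivity) (by nlinarith)
      card_fiber_four fun b hb => norm_gs_sq_le_nine hb
    have hle : 6561 * w / (p : ℝ) ^ 4 ≤ locB p := by
      rw [hl, div_le_div_iff₀ (by positivity) (by positivity)]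
      have : w * s ≤ p := by nlinarith
      have h3 : (0 : ℝ) < p ^ 3 := by positivity
      nlinarith
    have hmul := mul_le_mul_of_nonneg_right hle (show (0 : ℝ) ≤ 1 - 1 / (p : ℝ) ^ 5 by
      rw [sub_nonneg, div_le_one (by positivity)]
      exact one_le_pow₀ (by linarith))
    refine le_trans ?_ hmul
    have e : ((9 : ℝ) * p) ^ 3 * (3 * w) * (p * (p - 1) * ((4 : ℕ) - 1)) / p ^ 9
        = 6561 * w * (p - 1) / (p : ℝ) ^ 5 := by
      field_simp
      push_cast
      ring
    rw [e] at this
    have e3 : 6561 * w / (p : ℝ) ^ 4 * (1 - 1 / (p : ℝ) ^ 5) - 6561 * w * (p - 1) / (p : ℝ) ^ 5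
        - (1 / (p : ℝ) ^ 7 + 1 / (p : ℝ) ^ 6 + 1 / (p : ℝ) ^ 5) =
        (6561 * w * (p ^ 4 - 1) - p ^ 4 - p ^ 3 - p ^ 2) / (p : ℝ) ^ 9 := by
      field_simp
      ring
    have : 0 ≤ (6561 * w * (p ^ 4 - 1) - p ^ 4 - p ^ 3 - p ^ 2) / (p : ℝ) ^ 9 := by
      refine div_nonneg ?_ (by positivity)
      have a2 : (1 : ℝ) ≤ p ^ 2 := by nlinarith
      have a3 : (p : ℝ) ^ 2 ≤ p ^ 3 := by nlinarith
      have a4 : (p : ℝ) ^ 3 ≤ p ^ 4 := by nlinarith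
      have a5 : (0 : ℝ) ≤ p ^ 4 - 1 := by linarith
      have a6 : (29 : ℝ) ≤ p ^ 4 := by nlinarith
      have := mul_le_mul_of_nonneg_right hs5 a5
      nlinarith
    linarith

lemma locB_le {n : ℕ} (hn : 101 ≤ n) :
    locB n ≤ 656.1 / 4 * (1 / ((n : ℝ) - 1) ^ 2 - 1 / ((n : ℝ) + 1) ^ 2) := by
  have hn' : (101 : ℝ) ≤ n := by exact_mod_cast hn
  have h1 : locB n ≤ 656.1 / (n : ℝ) ^ 3 := by
    have h3 : (0 : ℝ) < (n : ℝ) ^ 3 := by positivity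
    unfold locB
    rw [if_neg (by omega), if_neg (by omega), if_neg (by omega), if_neg (by omega),
      if_neg (show ¬ n < 37 by omega), if_neg (show ¬ n < 101 by omega)]
    split_ifs
    · gcongr
      norm_num
    · rw [div_le_div_iff₀ (by positivity) h3]
      linarith
  refine h1.trans ?_
  have : 0 < (n : ℝ) - 1 := by linarith
  rw [div_sub_div _ _ (by positivity) (by positivity), div_mul_div_comm,
    div_le_div_iff₀ (by positivity) (by positivity)]
  have e : (1 * ((n : ℝ) + 1) ^ 2 - ((n : ℝ) - 1) ^ 2 * 1) = 4 * n := by ring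
  rw [e]
  have e2 : (((n : ℝ) - 1) ^ 2 * (n + 1) ^ 2) = ((n : ℝ) ^ 2 - 1) ^ 2 := by ring
  rw [e2]
  have : ((n : ℝ) ^ 2 - 1) ^ 2 ≤ n ^ 4 := by nlinarith
  nlinarith

lemma sum_locB_le (K : ℕ) :
    ∑ p ∈ (101 + 2 * K).primesBelow, locB p ≤
      0.63 + 656.1 / 4 * (1 / 100 ^ 2 - 1 / (100 + 2 * (K : ℝ)) ^ 2) := by
  induction K with
  | zero =>
    have : Nat.primesBelow (101 + 2 * 0) = {2, 3, 5, 7, 11, 13, 17, 19, 23, 29, 31, 37, 41, 43,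
      47, 53, 59, 61, 67, 71, 73, 79, 83, 89, 97} := by decide +kernel
    rw [this]
    norm_num [locB]
  | succ K ih =>
    have h1 : ¬ (101 + 2 * K + 1).Prime := fun h => by
      have := h.eq_two_or_odd
      omega
    have h2 : ∑ p ∈ (101 + 2 * (K + 1)).primesBelow, locB p ≤
        ∑ p ∈ (101 + 2 * K).primesBelow, locB p + locB (101 + 2 * K) := by
      rw [show 101 + 2 * (K + 1) = (101 + 2 * K + 1) + 1 by ring, Nat.primesBelow_succ, if_neg h1,
        Nat.primesBelow_succ]
      split_ifs
      · rw [sum_insert (Nat.notMem_primesBelow _), add_comm]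
      · have := locB_nonneg (101 + 2 * K)
        linarith
    have h3 := locB_le (show 101 ≤ 101 + 2 * K by omega)
    push_cast at h3 ⊢
    have e1 : (101 : ℝ) + 2 * K - 1 = 100 + 2 * K := by ring
    have e2 : (101 : ℝ) + 2 * K + 1 = 100 + 2 * (K + 1) := by ring
    rw [e1, e2] at h3
    linarith

lemma exp_le : Real.exp 0.647 ≤ 1.91 := by
  refine (Real.exp_bound' (by norm_num) (by norm_num) (show 0 < 7 by norm_num)).trans ?_
  norm_num [sum_range_succ, Nat.factorial]

lemma prod_one_add_locB_le (N : ℕ) : ∏ p ∈ N.primesBelow, (1 + locB p) ≤ 1.91 := by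
  calc ∏ p ∈ N.primesBelow, (1 + locB p) ≤ ∏ p ∈ N.primesBelow, Real.exp (locB p) := by
        refine prod_le_prod (fun p _ => add_nonneg zero_le_one (locB_nonneg p)) fun p _ => ?_
        rw [add_comm]
        exact Real.add_one_le_exp _
    _ = Real.exp (∑ p ∈ N.primesBelow, locB p) := (Real.exp_sum _ _).symm
    _ ≤ Real.exp 0.647 := by
        refine Real.exp_le_exp.mpr ?_
        have : ∑ p ∈ N.primesBelow, locB p ≤ ∑ p ∈ (101 + 2 * N).primesBelow, locB p :=
          sum_le_sum_of_subset_of_nonneg (filter_subset_filter _ (range_subset_range.mpr (by omega)))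
            fun p _ _ => locB_nonneg p
        have h2 := sum_locB_le N
        have h3 : 0 ≤ 1 / (100 + 2 * (N : ℝ)) ^ 2 := by positivity
        linarith
    _ ≤ 1.91 := exp_le

/-- The moment, restricted to moduli coprime to `10`. -/
noncomputable def moment' : ℕ → ℝ
  | 0 => 0
  | k + 1 => if (k + 1).Coprime 10 then moment (k + 1) else 0

lemma moment'_eq (q : ℕ) [NeZero q] : moment' q = if q.Coprime 10 then moment q else 0 := by
  obtain ⟨k, rfl⟩ := Nat.exists_eq_succ_of_ne_zero (NeZero.ne q)
  rfl

lemma moment'_nonneg (q : ℕ) : 0 ≤ moment' q := by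
  cases q with
  | zero => exact le_rfl
  | succ k =>
    rw [moment'_eq]
    split_ifs
    · exact moment_nonneg _
    · exact le_rfl

lemma moment'_one : moment' 1 = 1 := by
  have e : (1 : ZMod 1) = 0 := rfl
  rw [moment'_eq, if_pos (by norm_num), moment, Fintype.sum_unique, if_pos (isUnit_of_subsingleton _),
    cs]
  simp

lemma moment'_mul {m n : ℕ} (h : m.Coprime n) : moment' (m * n) = moment' m * moment' n := by
  rcases Nat.eq_zero_or_pos m with rfl | hm
  · simp [moment']
  rcases Nat.eq_zero_or_pos n with rfl | hn
  · simp [moment']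
  have : NeZero m := ⟨hm.ne'⟩
  have : NeZero n := ⟨hn.ne'⟩
  rw [moment'_eq, moment'_eq, moment'_eq, moment_mul h]
  have hmn : (m * n).Coprime 10 ↔ m.Coprime 10 ∧ n.Coprime 10 := Nat.coprime_mul_iff_left
  split_ifs <;> first | rfl | (exfalso; tauto) | simp

lemma sum_moment'_pow_le {p : ℕ} (hp : p.Prime) (K : ℕ) :
    ∑ k ∈ range K, moment' (p ^ (k + 1)) ≤ locB p := by
  have : Fact p.Prime := ⟨hp⟩
  by_cases h : p = 2 ∨ p = 5
  · refine (sum_eq_zero fun k _ => ?_).trans_le (locB_nonneg p)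
    rw [moment'_eq, if_neg]
    rw [Nat.coprime_pow_left_iff (by omega)]
    rcases h with rfl | rfl <;> norm_num
  · push Not at h
    refine (sum_le_sum fun k _ => ?_).trans (sum_moment_le_locB h.1 h.2 K)
    rw [moment'_eq]
    split_ifs
    · exact le_rfl
    · exact moment_nonneg _

lemma sum_moment'_le (K : ℕ) : ∑ k ∈ range K, moment' (k + 2) ≤ 0.91 := by
  have hb : ∀ {p : ℕ}, p.Prime → ∀ K, ∑ k ∈ range K, moment' (p ^ k) ≤ 1 + locB p := by
    intro p hp K
    refine (sum_le_sum_of_subset_of_nonneg (range_subset_range.mpr (Nat.le_succ K))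
      fun _ _ _ => moment'_nonneg _).trans ?_
    rw [sum_range_succ', pow_zero, moment'_one, add_comm]
    have := sum_moment'_pow_le hp K
    gcongr
  have hs : ∀ {p : ℕ}, p.Prime → Summable fun n => moment' (p ^ n) := fun hp =>
    summable_of_sum_range_le (fun n => moment'_nonneg _) (hb hp)
  have hs' : ∀ {p : ℕ}, p.Prime → Summable fun n => ‖moment' (p ^ n)‖ := fun hp => (hs hp).norm
  obtain ⟨h1, h2⟩ := EulerProduct.summable_and_hasSum_smoothNumbers_prod_primesBelow_tsum
    moment'_one (fun {m n} h => moment'_mul h) hs' (K + 2)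
  have h3 : ∏ p ∈ (K + 2).primesBelow, ∑' n, moment' (p ^ n) ≤ 1.91 := by
    refine (prod_le_prod (fun p _ => tsum_nonneg fun n => moment'_nonneg _) fun p hp => ?_).trans
      (prod_one_add_locB_le (K + 2))
    exact (hs (Nat.prime_of_mem_primesBelow hp)).tsum_le_of_sum_range_le
      (hb (Nat.prime_of_mem_primesBelow hp))
  have hmem : ∀ k ∈ range (K + 1), k + 1 ∈ (K + 2).smoothNumbers := fun k hk =>
    Nat.mem_smoothNumbers_of_lt (Nat.succ_pos k) (by have := mem_range.mp hk; omega)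
  have h4 : ∑ k ∈ range (K + 1), moment' (k + 1) ≤ 1.91 := by
    refine le_trans ?_ h3
    rw [← sum_attach, ← sum_image (f := fun m : (K + 2).smoothNumbers => moment' m)
      (g := fun k : {x // x ∈ range (K + 1)} => (⟨k.1 + 1, hmem k.1 k.2⟩ : (K + 2).smoothNumbers))]
    · exact sum_le_hasSum _ (fun _ _ => moment'_nonneg _) h2
    · intro a _ b _ hab
      exact Subtype.ext (by simpa using hab)
  rw [sum_range_succ', moment'_one] at h4
  norm_num at h4 ⊢
  linarith

lemma norm_cs_phiP_of_coprime {q : ℕ} [NeZero q] (hq : q.Coprime 10) (c : ℕ) :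
    ∃ u : (ZMod q)ˣ, (u : ZMod q) = 80 ∧
      ∀ a, ‖cs (phiP c) q a‖ = ‖cs (X ^ 4) q (a * ↑u⁻¹)‖ := by
  have h10 : ∀ d k : ℕ, d ∣ 10 ^ k → IsUnit (d : ZMod q) := fun d k hd =>
    (ZMod.isUnit_iff_coprime d q).mpr ((hq.pow_right k).symm.coprime_dvd_left hd)
  obtain ⟨u, hu⟩ := h10 80 4 (by norm_num)
  refine ⟨u, by rw [hu]; norm_num, fun a => ?_⟩
  rw [norm_cs_phiP c (n := 80) (n' := 20) (d := 1) (c' := c) ?_ u hu.symm (h10 20 2 (by norm_num)) a]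
  · simp
  · intro t
    rw [aeval_phiP]
    push_cast
    ring

lemma cs_phiP_one_eq_zero {q : ℕ} [NeZero q] (hq : ¬ q.Coprime 10) {a : ZMod q} (ha : IsUnit a) :
    cs (phiP 1) q a = 0 := by
  obtain ⟨p, hp, hpq, hp10⟩ := Nat.Prime.not_coprime_iff_dvd.mp hq
  obtain ⟨k, n, hn, hqn⟩ := Nat.exists_eq_pow_mul_and_not_dvd (NeZero.ne q) p hp.ne_one
  have hk : k ≠ 0 := by
    rintro rfl
    rw [pow_zero, one_mul] at hqn
    exact hn (hqn ▸ hpq)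
  subst hqn
  have : NeZero (p ^ k) := ⟨(pow_pos hp.pos k).ne'⟩
  have : NeZero n := ⟨by rintro rfl; exact hn (dvd_zero p)⟩
  obtain ⟨u, v, huv⟩ := cs_mul (Nat.Coprime.pow_left k ((hp.coprime_iff_not_dvd).mpr hn))
  rw [huv, cs_phiP_eq_zero (k := k) (Nat.one_lt_pow hk hp.one_lt) (pow_dvd_pow_of_dvd hp10 k) (by simp)
    (u.isUnit.mul (isUnit_red ha).1), zero_mul]

open Classical in
/-- Absolute convergence of the singular series, with a bound for its tail. -/
theorem sum_prod_cs_le (c : Fin 9 → ℕ) (h0 : c 0 = 1) (K : ℕ) :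
    ∑ k ∈ range K, ∑ a : ZMod (k + 2), (if IsUnit a then ∏ i, ‖cs (phiP (c i)) (k + 2) a‖ else 0)
      ≤ 0.91 := by
  refine (sum_le_sum fun k _ => ?_).trans (sum_moment'_le K)
  rw [moment'_eq]
  split_ifs with hq
  · obtain ⟨u, hu, -⟩ := norm_cs_phiP_of_coprime hq 0
    have h : ∀ i a, ‖cs (phiP (c i)) (k + 2) a‖ = ‖cs (X ^ 4) (k + 2) (a * ↑u⁻¹)‖ := by
      intro i a
      obtain ⟨v, hv, h⟩ := norm_cs_phiP_of_coprime hq (c i)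
      rw [h, show v = u from Units.ext (hv.trans hu.symm)]
    unfold moment
    refine le_of_eq (Fintype.sum_equiv (Units.mulRight u⁻¹) _ _ fun a => ?_)
    simp [h]
  · refine (sum_eq_zero fun a _ => ?_).le
    split_ifs with ha
    · refine prod_eq_zero (mem_univ 0) ?_
      rw [h0, cs_phiP_one_eq_zero hq ha, norm_zero]
    · rfl

end Biquad

namespace Biquad
open Finset

/-- The real number `t` with `2000 t ^ 4 = u`. -/
noncomputable def rt (u : ℕ) : ℝ := √(√((u : ℝ) / 2000))

/-- The density of values of `2000 t ^ 4` at `u`. -/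
noncomputable def wt (u : ℕ) : ℝ := rt (u + 1) - rt u

lemma rt_nonneg (u : ℕ) : 0 ≤ rt u := Real.sqrt_nonneg _

lemma rt_pow (u : ℕ) : 2000 * rt u ^ 4 = u := by
  have : rt u ^ 4 = (rt u ^ 2) ^ 2 := by ring
  rw [this, rt, Real.sq_sqrt (Real.sqrt_nonneg _), Real.sq_sqrt (by positivity)]
  ring

lemma rt_mono : Monotone rt := fun a b h => by
  have : (a : ℝ) ≤ b := by exact_mod_cast h
  unfold rt
  gcongr

lemma wt_nonneg (u : ℕ) : 0 ≤ wt u := sub_nonneg.mpr (rt_mono (Nat.le_succ u))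

lemma le_rt {x : ℝ} {u : ℕ} (h : 2000 * x ^ 4 ≤ u) : x ≤ rt u := by
  rw [← rt_pow u] at h
  exact le_of_pow_le_pow_left₀ (by norm_num : (4 : ℕ) ≠ 0) (rt_nonneg u) (by linarith)

lemma rt_le {x : ℝ} {u : ℕ} (hx : 0 ≤ x) (h : u ≤ 2000 * x ^ 4) : rt u ≤ x := by
  rw [← rt_pow u] at h
  exact le_of_pow_le_pow_left₀ (by norm_num : (4 : ℕ) ≠ 0) hx (by linarith)

lemma rt_eq {x : ℝ} {u : ℕ} (hx : 0 ≤ x) (h : 2000 * x ^ 4 = u) : rt u = x :=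
  le_antisymm (rt_le hx h.ge) (le_rt h.le)

lemma wt_mul (u : ℕ) :
    2000 * wt u * (rt (u + 1) ^ 3 + rt (u + 1) ^ 2 * rt u + rt (u + 1) * rt u ^ 2 + rt u ^ 3) = 1 := by
  have h1 := rt_pow u
  have h2 := rt_pow (u + 1)
  push_cast at h2
  unfold wt
  linear_combination h2 - h1

lemma wt_anti : Antitone wt := antitone_nat_of_succ_le fun u => by
  have h1 := wt_mul u
  have h2 := wt_mul (u + 1)
  have a0 := rt_nonneg u
  have a1 := rt_mono (Nat.le_succ u)
  have a2 := rt_mono (Nat.le_succ (u + 1))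
  simp only [Nat.succ_eq_add_one] at a1 a2
  have hw := wt_nonneg u
  by_contra! hlt
  have hle : rt (u + 1) ^ 3 + rt (u + 1) ^ 2 * rt u + rt (u + 1) * rt u ^ 2 + rt u ^ 3 ≤
      rt (u + 1 + 1) ^ 3 + rt (u + 1 + 1) ^ 2 * rt (u + 1) + rt (u + 1 + 1) * rt (u + 1) ^ 2
        + rt (u + 1) ^ 3 := by
    have b1 : 0 ≤ rt (u + 1) := rt_nonneg _
    have b2 : 0 ≤ rt (u + 1 + 1) := rt_nonneg _
    gcongr
  have hpos : 0 < rt (u + 1) ^ 3 + rt (u + 1) ^ 2 * rt u + rt (u + 1) * rt u ^ 2 + rt u ^ 3 := by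
    by_contra! h
    have := mul_nonpos_of_nonneg_of_nonpos (mul_nonneg (by norm_num : (0 : ℝ) ≤ 2000) hw) h
    linarith
  have := mul_lt_mul'' (mul_lt_mul_of_pos_left hlt (by norm_num : (0 : ℝ) < 2000))
    (hle.trans_lt (lt_add_one _)) (by positivity) hpos.le
  nlinarith [mul_le_mul_of_nonneg_left hle (mul_nonneg (by norm_num : (0 : ℝ) ≤ 2000) (wt_nonneg (u + 1)))]

/-- The scale `2000 X ^ 4` of the values of `phi c` on `(X, 2 X]`. -/
def vol (X : ℕ) : ℕ := 2000 * X ^ 4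

lemma cast_vol (X : ℕ) : (vol X : ℝ) = 2000 * (X : ℝ) ^ 4 := by simp [vol]

lemma rt_vol (X : ℕ) : rt (vol X) = X := rt_eq (by positivity) (cast_vol X).symm

lemma rt_vol' (X : ℕ) : rt (16 * vol X) = 2 * X :=
  rt_eq (by positivity) (by push_cast [cast_vol]; ring)

lemma wt_vol_le {X : ℕ} (hX : 0 < X) : wt (vol X) ≤ X / (4 * vol X) := by
  have h := wt_mul (vol X)
  have h1 := rt_mono (Nat.le_succ (vol X))
  rw [Nat.succ_eq_add_one, rt_vol] at h1
  rw [rt_vol] at h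
  have hx : (0 : ℝ) < X := by exact_mod_cast hX
  rw [cast_vol, le_div_iff₀ (by positivity)]
  have : 4 * (X : ℝ) ^ 3 ≤ rt (vol X + 1) ^ 3 + rt (vol X + 1) ^ 2 * X + rt (vol X + 1) * X ^ 2 + X ^ 3 := by
    have e : 4 * (X : ℝ) ^ 3 = X ^ 3 + X ^ 2 * X + X * X ^ 2 + X ^ 3 := by ring
    rw [e]
    gcongr
  have := mul_le_mul_of_nonneg_left this (mul_nonneg (by norm_num : (0 : ℝ) ≤ 2000) (wt_nonneg (vol X)))
  rw [h] at this
  nlinarith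

/-- The smooth model for `fS c X`. -/
noncomputable def mH (X : ℕ) (β : ℝ) : ℂ :=
  ∑ u ∈ Ico (vol X) (16 * vol X), (wt u : ℂ) * ex (β * u)

lemma sum_wt {a b : ℕ} (h : a ≤ b) : ∑ u ∈ Ico a b, wt u = rt b - rt a :=
  sum_Ico_sub _ h

lemma norm_mH_le (X : ℕ) (β : ℝ) : ‖mH X β‖ ≤ X := by
  refine (norm_sum_le _ _).trans ?_
  have : ∀ u ∈ Ico (vol X) (16 * vol X), ‖(wt u : ℂ) * ex (β * u)‖ = wt u := fun u _ => by
    rw [norm_mul, norm_ex, mul_one, Complex.norm_real, Real.norm_of_nonneg (wt_nonneg u)]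
  rw [sum_congr rfl this, sum_wt (by omega), rt_vol, rt_vol']
  linarith

lemma norm_mH_le_of_nd {X : ℕ} (hX : 0 < X) {β : ℝ} (hβ : nd β ≠ 0) :
    ‖mH X β‖ ≤ X / (8 * vol X * nd β) := by
  set V := vol X
  have h0 : mH X β = ∑ k ∈ range (15 * V), ex (β * k + β * V) * (wt (V + k) : ℂ) := by
    unfold mH
    rw [sum_Ico_eq_sum_range, show 16 * vol X - vol X = 15 * V by omega]
    refine sum_congr rfl fun k _ => ?_
    rw [mul_comm]
    congr 2
    push_cast
    ring
  have h1 := norm_sum_mul_le_of_partial (g := fun k => ex (β * k + β * V))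
    (h := fun k => (wt (V + k) : ℂ)) (M := 15 * V) (E := 1 / (2 * nd β))
    fun k _ => norm_geom_le β hβ (β * V) k
  have hpos : 0 < nd β := lt_of_le_of_ne (nd_nonneg β) hβ.symm
  have h2 : ‖(wt (V + 15 * V) : ℂ)‖ + ∑ u ∈ range (15 * V), ‖(wt (V + (u + 1)) : ℂ) - (wt (V + u) : ℂ)‖
      = wt V := by
    have : ∀ u ∈ range (15 * V), ‖(wt (V + (u + 1)) : ℂ) - (wt (V + u) : ℂ)‖
        = wt (V + u) - wt (V + (u + 1)) := fun u _ => by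
      rw [← Complex.ofReal_sub, Complex.norm_real, Real.norm_eq_abs, abs_sub_comm,
        abs_of_nonneg (sub_nonneg.mpr (wt_anti (by omega)))]
    rw [sum_congr rfl this, sum_range_sub' (fun u => wt (V + u)), Complex.norm_real,
      Real.norm_of_nonneg (wt_nonneg _), add_zero]
    ring
  rw [h0]
  refine h1.trans ?_
  rw [h2]
  have h3 := wt_vol_le hX
  have hV : (0 : ℝ) < vol X := by rw [cast_vol]; positivity
  calc 1 / (2 * nd β) * wt V ≤ 1 / (2 * nd β) * (X / (4 * vol X)) := by gcongr
    _ = X / (8 * vol X * nd β) := by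
      field_simp
      norm_num

lemma norm_sum_periodic_sub_le {q : ℕ} [NeZero q] (F : ZMod q → ℂ) (hF : ∀ z, ‖F z‖ ≤ 1) (m n : ℕ) :
    ‖∑ i ∈ range n, F ((m + i : ℕ) : ZMod q) - n * ((q : ℂ)⁻¹ * ∑ z, F z)‖ ≤ 2 * (q - 1) := by
  have hq0 : 0 < q := NeZero.pos q
  set T := (q : ℂ)⁻¹ * ∑ z, F z with hTdef
  have hT : ‖T‖ ≤ 1 := by
    have hq : (0 : ℝ) < q := by exact_mod_cast hq0
    rw [norm_mul, norm_inv, Complex.norm_natCast, inv_mul_le_iff₀ hq, mul_one]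
    refine (norm_sum_le _ _).trans ((sum_le_card_nsmul univ _ 1 fun z _ => hF z).trans ?_)
    simp [ZMod.card]
  have hper : ∑ i ∈ range (q * (n / q)), F ((m + i : ℕ) : ZMod q) = (q * (n / q) : ℕ) * T := by
    have h := sum_range_mul_cast_zmod (n / q) fun z : ZMod q => F (m + z)
    have h2 : ∑ z : ZMod q, F (m + z) = ∑ z, F z :=
      Fintype.sum_equiv (Equiv.addLeft (m : ZMod q)) _ _ fun z => rfl
    rw [h2] at h
    push_cast
    rw [h, hTdef]
    have : (q : ℂ) ≠ 0 := by exact_mod_cast hq0.ne'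
    field_simp
  have hn : n = q * (n / q) + n % q := (Nat.div_add_mod n q).symm
  have hs : n % q < q := Nat.mod_lt n hq0
  set r := n / q
  set s := n % q
  have e : ∑ i ∈ range n, F ((m + i : ℕ) : ZMod q) - n * T
      = ∑ i ∈ range s, (F ((m + (q * r + i) : ℕ) : ZMod q) - T) := by
    rw [hn, sum_range_add, hper, sum_sub_distrib, sum_const, card_range, nsmul_eq_mul]
    push_cast
    ring
  rw [e]
  refine (norm_sum_le _ _).trans ((sum_le_card_nsmul _ _ 2 fun i _ => ?_).trans ?_)
  · exact (norm_sub_le _ _).trans (by linarith [hF ((m + (q * r + i) : ℕ) : ZMod q)])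
  · rw [card_range, nsmul_eq_mul]
    have : (s : ℝ) + 1 ≤ q := by exact_mod_cast hs
    linarith

lemma phi_strictMono (c : ℕ) : StrictMono (phi c) := strictMono_nat_of_lt_succ fun t => by
  unfold phi
  have h4 : t ^ 4 < (t + 1) ^ 4 := Nat.pow_lt_pow_left (Nat.lt_succ_self t) (by norm_num)
  have h3 : t ^ 3 ≤ (t + 1) ^ 3 := Nat.pow_le_pow_left (Nat.le_succ t) 3
  have h2 : t ^ 2 ≤ (t + 1) ^ 2 := Nat.pow_le_pow_left (Nat.le_succ t) 2
  have := Nat.mul_le_mul_left (400 * c) h3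
  have := Nat.mul_le_mul_left (30 * c ^ 2) h2
  have := Nat.mul_le_mul_left (c ^ 3) (Nat.le_succ t)
  simp only [Nat.succ_eq_add_one] at *
  omega

lemma exists_cut {φ : ℕ → ℕ} (hφ : StrictMono φ) (k X : ℕ) : ∀ n, ∃ m, m ≤ n ∧
    (∀ t ∈ Ioc X (X + m), φ t < k) ∧ ∀ t ∈ Ioc (X + m) (X + n), k ≤ φ t := by
  intro n
  induction n with
  | zero => exact ⟨0, le_rfl, by simp, by simp⟩
  | succ n ih =>
    obtain ⟨m, hm, h1, h2⟩ := ih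
    by_cases h : φ (X + (n + 1)) < k
    · refine ⟨n + 1, le_rfl, fun t ht => ?_, by simp⟩
      exact (hφ.monotone (mem_Ioc.mp ht).2).trans_lt h
    · refine ⟨m, by omega, h1, fun t ht => ?_⟩
      rw [mem_Ioc] at ht
      rcases eq_or_ne t (X + (n + 1)) with rfl | hne
      · omega
      · exact h2 t (mem_Ioc.mpr ⟨ht.1, by omega⟩)

/-- Clamping to the interval `[V, 16 V]`. -/
def clamp (V u : ℕ) : ℕ := max V (min u (16 * V))

lemma rt_clamp_bounds {X c k m : ℕ} (hc : c ≤ 5) (hm : m ≤ X)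
    (h1 : ∀ t ∈ Ioc X (X + m), phi c t < k) (h2 : ∀ t ∈ Ioc (X + m) (X + X), k ≤ phi c t) :
    (X + m : ℝ) ≤ rt (clamp (vol X) k) ∧ rt (clamp (vol X) k) ≤ X + m + 2 := by
  have hV := rt_vol X
  have hV' := rt_vol' X
  have hm' : (m : ℝ) ≤ X := by exact_mod_cast hm
  have hlo : rt (vol X) ≤ rt (clamp (vol X) k) := rt_mono (le_max_left _ _)
  have hhi : rt (clamp (vol X) k) ≤ rt (16 * vol X) := rt_mono (by unfold clamp; omega)
  constructor
  · rcases Nat.eq_zero_or_pos m with rfl | hm0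
    · simpa [hV] using hlo
    · have h := h1 (X + m) (mem_Ioc.mpr ⟨by omega, le_rfl⟩)
      have h3 : 2000 * (X + m) ^ 4 ≤ k := le_trans (by unfold phi; omega) h.le
      have h4 : 2000 * (X + m) ^ 4 ≤ clamp (vol X) k := by
        refine le_trans (le_min h3 ?_) (le_max_right _ _)
        have : (X + m) ^ 4 ≤ (2 * X) ^ 4 := Nat.pow_le_pow_left (by omega) 4
        rw [mul_pow] at this
        unfold vol
        omega
      exact le_rt (by exact_mod_cast h4)
  · rcases eq_or_lt_of_le hm with rfl | hlt
    · rw [hV'] at hhi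
      linarith
    · have h := h2 (X + m + 1) (mem_Ioc.mpr ⟨by omega, by omega⟩)
      have h3 : k ≤ 2000 * (X + m + 2) ^ 4 := by
        have h5 : (20 * (X + m + 1) + c) ^ 4 ≤ (20 * (X + m + 2)) ^ 4 :=
          Nat.pow_le_pow_left (by omega) 4
        rw [← phi_spec, mul_pow] at h5
        omega
      have h4 : clamp (vol X) k ≤ 2000 * (X + m + 2) ^ 4 := by
        refine max_le ?_ ((min_le_left _ _).trans h3)
        unfold vol
        gcongr
        omega
      refine rt_le (by positivity) ?_
      exact_mod_cast h4

lemma ex_mul_div_eq {q : ℕ} [NeZero q] (a : ZMod q) (c t : ℕ) :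
    ex ((a.val : ℝ) / q * phi c t) = ZMod.stdAddChar (a * Polynomial.aeval (t : ZMod q) (phiP c)) := by
  have : a * Polynomial.aeval (t : ZMod q) (phiP c) = ((a.val * phi c t : ℤ) : ZMod q) := by
    rw [aeval_phiP]
    push_cast [phi]
    simp
  rw [this, stdAddChar_intCast]
  congr 1
  push_cast
  ring

lemma phi_lt {X c t : ℕ} (hX : 10 ≤ X) (hc : c ≤ 5) (ht : t ≤ X + X) : phi c t < 17 * vol X := by
  have h1 : (20 * t + c) ^ 4 ≤ (40 * X + 5) ^ 4 := Nat.pow_le_pow_left (by omega) 4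
  rw [← phi_spec] at h1
  have h2 : (40 * X + 5) ^ 4 < 80 * (17 * vol X) := by
    have : (40 * X + 5) ^ 4 = 2560000 * X ^ 4 + 1280000 * X ^ 3 + 240000 * X ^ 2 + 20000 * X + 625 := by
      ring
    have h3 : 10 * X ^ 3 ≤ X ^ 4 := by rw [pow_succ X 3, mul_comm]; gcongr
    have h4 : 10 * X ^ 2 ≤ X ^ 3 := by rw [pow_succ X 2, mul_comm]; gcongr
    have h5 : 10 * X ≤ X ^ 2 := by rw [pow_succ X 1, mul_comm, pow_one]; gcongr
    unfold vol
    omega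
  omega

/-- The major arc approximation. -/
theorem norm_fS_sub_le {X c q : ℕ} [NeZero q] (hX : 10 ≤ X) (hc : c ≤ 5) (a : ZMod q) (β : ℝ) :
    ‖fS c X ((a.val : ℝ) / q + β) - cs (phiP c) q a * mH X β‖ ≤
      2 * q * (1 + 2 * Real.pi * (17 * vol X) * |β|) := by
  classical
  set V := vol X with hVdef
  set T := cs (phiP c) q a with hT
  set g : ℕ → ℂ := fun u => (∑ t ∈ Ioc X (2 * X) with phi c t = u, ex ((a.val : ℝ) / q * phi c t))
    - T * ((rt (clamp V (u + 1)) - rt (clamp V u) : ℝ) : ℂ) with hg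
  have hV1 : ∀ u ∈ range (17 * V), u ∉ Ico V (16 * V) → rt (clamp V (u + 1)) - rt (clamp V u) = 0 := by
    intro u _ hu
    rw [mem_Ico] at hu
    rw [show clamp V (u + 1) = clamp V u by unfold clamp; omega, sub_self]
  have hH : mH X β = ∑ u ∈ range (17 * V), ((rt (clamp V (u + 1)) - rt (clamp V u) : ℝ) : ℂ) * ex (β * u) := by
    rw [← sum_subset (s₁ := Ico V (16 * V)) (fun u hu => by rw [mem_Ico] at hu; rw [mem_range]; omega)
      fun u hu hu' => by rw [hV1 u hu hu']; simp]
    refine sum_congr rfl fun u hu => ?_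
    rw [mem_Ico] at hu
    rw [show clamp V (u + 1) = u + 1 by unfold clamp; omega,
      show clamp V u = u by unfold clamp; omega, wt]
  have hf : fS c X ((a.val : ℝ) / q + β) = ∑ u ∈ range (17 * V),
      (∑ t ∈ Ioc X (2 * X) with phi c t = u, ex ((a.val : ℝ) / q * phi c t)) * ex (β * u) := by
    unfold fS
    rw [← sum_fiberwise_of_maps_to (s := Ioc X (2 * X)) (t := range (17 * V)) (g := phi c)
      fun t ht => mem_range.mpr (phi_lt hX hc (by have := (mem_Ioc.mp ht).2; omega))]
    refine sum_congr rfl fun u _ => ?_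
    rw [sum_mul]
    refine sum_congr rfl fun t ht => ?_
    rw [add_mul, ex_add, (mem_filter.mp ht).2]
  have hsum : fS c X ((a.val : ℝ) / q + β) - T * mH X β = ∑ u ∈ range (17 * V), g u * ex (β * u) := by
    rw [hf, hH, mul_sum, ← sum_sub_distrib]
    refine sum_congr rfl fun u _ => ?_
    rw [hg]
    ring
  have hpart : ∀ k ≤ 17 * V, ‖∑ u ∈ range k, g u‖ ≤ 2 * q := by
    intro k _
    obtain ⟨m, hm, h1, h2⟩ := exists_cut (phi_strictMono c) k X X
    obtain ⟨hlo, hhi⟩ := rt_clamp_bounds hc hm h1 h2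
    rw [hg]
    dsimp only
    rw [sum_sub_distrib, ← mul_sum, ← Complex.ofReal_sum, sum_range_sub fun u => rt (clamp V u)]
    have e1 : ∑ u ∈ range k, ∑ t ∈ Ioc X (2 * X) with phi c t = u, ex ((a.val : ℝ) / q * phi c t)
        = ∑ i ∈ range m, (ZMod.stdAddChar (a * Polynomial.aeval ((X + 1 + i : ℕ) : ZMod q) (phiP c)) : ℂ) := by
      have e2 : ∀ u ∈ range k, (Ioc X (2 * X)).filter (fun t => phi c t = u)
          = (Ioc X (X + m)).filter (fun t => phi c t = u) := by
        intro u hu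
        rw [mem_range] at hu
        ext t
        simp only [mem_filter, mem_Ioc]
        constructor
        · rintro ⟨⟨ht1, ht2⟩, ht3⟩
          refine ⟨⟨ht1, ?_⟩, ht3⟩
          by_contra! h
          have := h2 t (mem_Ioc.mpr ⟨h, by omega⟩)
          omega
        · rintro ⟨⟨ht1, ht2⟩, ht3⟩
          exact ⟨⟨ht1, by omega⟩, ht3⟩
      rw [sum_congr rfl fun u hu => by rw [e2 u hu],
        sum_fiberwise_of_maps_to (s := Ioc X (X + m)) (t := range k) (g := phi c)
          fun t ht => mem_range.mpr (h1 t ht)]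
      rw [← Ico_add_one_add_one_eq_Ioc, sum_Ico_eq_sum_range, show X + m + 1 - (X + 1) = m by omega]
      exact sum_congr rfl fun i _ => ex_mul_div_eq a c _
    have h3 := norm_sum_periodic_sub_le
      (fun z : ZMod q => (ZMod.stdAddChar (a * Polynomial.aeval z (phiP c)) : ℂ))
      (fun z => (norm_stdAddChar _ _).le) (X + 1) m
    rw [e1, show clamp V 0 = V by simp [clamp], hVdef, rt_vol]
    have e3 : (∑ i ∈ range m, (ZMod.stdAddChar (a * Polynomial.aeval ((X + 1 + i : ℕ) : ZMod q) (phiP c)) : ℂ))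
        - T * ((rt (clamp (vol X) k) - X : ℝ) : ℂ) =
        ((∑ i ∈ range m, (ZMod.stdAddChar (a * Polynomial.aeval ((X + 1 + i : ℕ) : ZMod q) (phiP c)) : ℂ))
          - m * T) - T * ((rt (clamp (vol X) k) - X - m : ℝ) : ℂ) := by
      push_cast
      ring
    rw [e3]
    have h4 : ‖T * ((rt (clamp (vol X) k) - X - m : ℝ) : ℂ)‖ ≤ 1 * 2 := by
      rw [norm_mul, Complex.norm_real, Real.norm_eq_abs]
      gcongr
      · exact norm_cs_le_one _ _ _
      · rw [abs_le]
        constructor <;> linarith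
    refine (norm_sub_le _ _).trans ((add_le_add h3 h4).trans (le_of_eq ?_))
    ring
  rw [hsum]
  refine (norm_sum_mul_le_of_partial hpart).trans ?_
  gcongr
  · rw [norm_ex]
  · refine (sum_le_card_nsmul _ _ (2 * Real.pi * |β|) fun u _ => ?_).trans (le_of_eq ?_)
    · have : ex (β * (u + 1 : ℕ)) - ex (β * u) = ex (β * u) * (ex β - 1) := by
        rw [mul_sub, ← ex_add]
        push_cast
        ring_nf
      rw [this, norm_mul, norm_ex, one_mul]
      exact norm_ex_sub_one_le β
    · rw [card_range, nsmul_eq_mul]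
      push_cast
      ring

end Biquad

namespace Biquad
open Finset Polynomial

lemma sum_ex_div_mul {N : ℕ} (hN : 0 < N) {d : ℤ} (hd : |d| < N) :
    ∑ k ∈ range N, ex ((k : ℝ) / N * d) = if d = 0 then (N : ℂ) else 0 := by
  have hN' : (N : ℝ) ≠ 0 := by exact_mod_cast hN.ne'
  split_ifs with h
  · subst h
    simp
  · have hz : ∀ k : ℕ, ex ((k : ℝ) / N * d) = ex ((d : ℝ) / N) ^ k := fun k => by
      rw [← ex_nat_mul]
      congr 1
      ring
    simp_rw [hz]
    have h1 : ex ((d : ℝ) / N) ≠ 1 := by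
      intro he
      rw [ex, Complex.exp_eq_one_iff] at he
      obtain ⟨m, hm⟩ := he
      have h2 : ((2 * Real.pi * (d / N) : ℝ) : ℂ) = ((m * (2 * Real.pi) : ℝ) : ℂ) := by
        apply mul_right_cancel₀ Complex.I_ne_zero
        rw [hm]
        push_cast
        ring
      have h3 : (2 * Real.pi) * ((d : ℝ) / N) = (2 * Real.pi) * m := by
        have := Complex.ofReal_injective h2
        linarith
      have h4 := mul_left_cancel₀ (by positivity : (2 * Real.pi) ≠ 0) h3
      rw [div_eq_iff hN'] at h4
      have h5 : d = m * N := by exact_mod_cast h4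
      rw [h5, abs_mul, Nat.abs_cast] at hd
      have hm0 : m ≠ 0 := by rintro rfl; simp at h5; exact h h5
      have := Int.one_le_abs hm0
      nlinarith
    have h2 := mul_geom_sum (ex ((d : ℝ) / N)) N
    rw [← ex_nat_mul, mul_div_cancel₀ _ hN', ex_int, sub_self] at h2
    exact (mul_eq_zero.mp h2).resolve_left (sub_ne_zero.mpr h1)

lemma sum_eval_mul_ex (P : ℂ[X]) {N n : ℕ} (hP : P.natDegree < N) (hn : n < N) :
    ∑ k ∈ range N, P.eval (ex ((k : ℝ) / N)) * ex (-((k : ℝ) / N * n)) = N * P.coeff n := by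
  have h : ∀ k ∈ range N, P.eval (ex ((k : ℝ) / N)) * ex (-((k : ℝ) / N * n))
      = ∑ j ∈ range N, P.coeff j * ex ((k : ℝ) / N * ((j - n : ℤ) : ℝ)) := by
    intro k _
    rw [eval_eq_sum_range' hP, sum_mul]
    refine sum_congr rfl fun j _ => ?_
    rw [mul_assoc, ← ex_nat_mul, ← ex_add]
    congr 2
    push_cast
    ring
  rw [sum_congr rfl h, sum_comm]
  simp_rw [← mul_sum]
  rw [sum_eq_single_of_mem n (mem_range.mpr hn)]
  · rw [sum_ex_div_mul (by omega) (by simp; omega), if_pos (sub_self _), mul_comm]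
  · intro j hj hjn
    rw [mem_range] at hj
    rw [sum_ex_div_mul (by omega) (by rw [abs_lt]; omega), if_neg (by omega), mul_zero]

/-- The generating polynomial of a finite set. -/
noncomputable def genP (A : Finset ℕ) : ℂ[X] := ∑ a ∈ A, X ^ a

lemma eval_genP (A : Finset ℕ) (x : ℝ) : (genP A).eval (ex x) = ∑ a ∈ A, ex (x * a) := by
  unfold genP
  rw [eval_finsetSum]
  refine sum_congr rfl fun a _ => ?_
  rw [eval_pow, eval_X, ← ex_nat_mul, mul_comm]

lemma sum_norm_genP_sq {A : Finset ℕ} {N : ℕ} (hN : 0 < N) (hA : ∀ a ∈ A, a < N) :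
    ∑ k ∈ range N, ‖(genP A).eval (ex ((k : ℝ) / N))‖ ^ 2 = N * A.card := by
  have h : ∀ k ∈ range N, ((‖(genP A).eval (ex ((k : ℝ) / N))‖ ^ 2 : ℝ) : ℂ)
      = ∑ a ∈ A, ∑ b ∈ A, ex ((k : ℝ) / N * ((a - b : ℤ) : ℝ)) := by
    intro k _
    rw [Complex.ofReal_pow, ← Complex.mul_conj', eval_genP, map_sum, sum_mul_sum]
    refine sum_congr rfl fun a _ => sum_congr rfl fun b _ => ?_
    rw [conj_ex, ← ex_add]
    congr 1
    push_cast
    ring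
  have h2 : ((∑ k ∈ range N, ‖(genP A).eval (ex ((k : ℝ) / N))‖ ^ 2 : ℝ) : ℂ)
      = ((N * A.card : ℝ) : ℂ) := by
    rw [Complex.ofReal_sum, sum_congr rfl h, sum_comm]
    have h3 : ∀ a ∈ A, ∑ k ∈ range N, ∑ b ∈ A, ex ((k : ℝ) / N * ((a - b : ℤ) : ℝ)) = N := by
      intro a ha
      rw [sum_comm, sum_eq_single_of_mem a ha]
      · rw [sum_ex_div_mul hN (by simpa using hN), if_pos (sub_self _)]
      · intro b hb hba
        have := hA a ha
        have := hA b hb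
        rw [sum_ex_div_mul hN (by rw [abs_lt]; omega), if_neg (by omega)]
    rw [sum_congr rfl h3, sum_const, nsmul_eq_mul]
    push_cast
    rw [mul_comm]
  exact_mod_cast h2

/-- The generating polynomial of the smooth weights. -/
noncomputable def wP (Y : ℕ) : ℝ[X] := ∑ u ∈ Ico (vol Y) (16 * vol Y), C (wt u) * X ^ u

lemma coeff_wP_mul (Y n : ℕ) (P : ℝ[X]) :
    (wP Y * P).coeff n = ∑ u ∈ Ico (vol Y) (16 * vol Y), wt u * if u ≤ n then P.coeff (n - u) else 0 := by
  unfold wP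
  rw [sum_mul, finsetSum_coeff]
  refine sum_congr rfl fun u _ => ?_
  rw [mul_assoc, coeff_C_mul, coeff_X_pow_mul']

lemma coeff_wP_pow_nonneg (Y k : ℕ) : ∀ n, 0 ≤ (wP Y ^ k).coeff n := by
  induction k with
  | zero => intro n; rw [pow_zero, coeff_one]; split_ifs <;> norm_num
  | succ k ih =>
    intro n
    rw [pow_succ', coeff_wP_mul]
    refine sum_nonneg fun u _ => mul_nonneg (wt_nonneg u) ?_
    split_ifs
    · exact ih _
    · exact le_rfl

lemma le_coeff_wP_mul {Y n a b : ℕ} {P : ℝ[X]} {B : ℝ} (hP : ∀ n, 0 ≤ P.coeff n)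
    (ha : vol Y ≤ a) (hab : a ≤ b) (hb : b ≤ 16 * vol Y)
    (h : ∀ u ∈ Ico a b, u ≤ n ∧ B ≤ P.coeff (n - u)) : (rt b - rt a) * B ≤ (wP Y * P).coeff n := by
  rw [coeff_wP_mul, ← sum_wt hab, sum_mul]
  calc ∑ u ∈ Ico a b, wt u * B ≤ ∑ u ∈ Ico a b, wt u * if u ≤ n then P.coeff (n - u) else 0 := by
        refine sum_le_sum fun u hu => mul_le_mul_of_nonneg_left ?_ (wt_nonneg u)
        rw [if_pos (h u hu).1]
        exact (h u hu).2
    _ ≤ _ := by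
        refine sum_le_sum_of_subset_of_nonneg (Ico_subset_Ico ha hb) fun u _ _ =>
          mul_nonneg (wt_nonneg u) ?_
        split_ifs
        · exact hP _
        · exact le_rfl

lemma le_wt {Y u : ℕ} (hY : 0 < Y) (hu : u < 16 * vol Y) : (Y : ℝ) / (32 * vol Y) ≤ wt u := by
  have h := wt_mul u
  have h0 := rt_nonneg u
  have h1 := rt_mono (Nat.le_succ u)
  have h2 : rt (u + 1) ≤ 2 * Y := by
    rw [← rt_vol']
    exact rt_mono hu
  rw [Nat.succ_eq_add_one] at h1
  have h3 : rt u ≤ 2 * Y := h1.trans h2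
  have h4 : 0 ≤ rt (u + 1) := rt_nonneg _
  have hy : (0 : ℝ) < Y := by exact_mod_cast hY
  have h5 : rt (u + 1) ^ 3 + rt (u + 1) ^ 2 * rt u + rt (u + 1) * rt u ^ 2 + rt u ^ 3 ≤ 32 * (Y : ℝ) ^ 3 := by
    have e : 32 * (Y : ℝ) ^ 3 = (2 * Y) ^ 3 + (2 * Y) ^ 2 * (2 * Y) + (2 * Y) * (2 * Y) ^ 2 + (2 * Y) ^ 3 := by
      ring
    rw [e]
    gcongr
  have h6 := mul_le_mul_of_nonneg_left h5 (mul_nonneg (by norm_num : (0 : ℝ) ≤ 2000) (wt_nonneg u))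
  rw [h] at h6
  rw [cast_vol, div_le_iff₀ (by positivity)]
  have := mul_le_mul_of_nonneg_right h6 hy.le
  nlinarith

/-- Lower bound for the singular integral. -/
lemma le_coeff_wP_pow {Y : ℕ} (hY : 0 < Y) (k : ℕ) : ∀ n : ℕ,
    (k + 1) * (81 * (125 * Y ^ 4)) ≤ n + 65 * (125 * Y ^ 4) →
    n < (k + 1) * (81 * (125 * Y ^ 4)) + 175 * (125 * Y ^ 4) →
    ((Y : ℝ) / 2) ^ k * (Y / (32 * vol Y)) ≤ (wP Y ^ (k + 1)).coeff n := by
  set W := 125 * Y ^ 4 with hW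
  have hV : vol Y = 16 * W := by rw [hW, vol]; ring
  have hc : rt (81 * W) = 3 / 2 * Y := rt_eq (by positivity) (by rw [hW]; push_cast; ring)
  have hV1 := rt_vol Y
  have hV2 := rt_vol' Y
  induction k with
  | zero =>
    intro n h1 h2
    rw [pow_zero, one_mul, zero_add, pow_one, ← mul_one (wP Y), coeff_wP_mul]
    have hn : n ∈ Ico (vol Y) (16 * vol Y) := by rw [mem_Ico]; omega
    rw [sum_eq_single_of_mem n hn]
    · simpa using le_wt hY (mem_Ico.mp hn).2
    · intro u _ hun
      split_ifs with h
      · rw [coeff_one, if_neg (by omega), mul_zero]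
      · rw [mul_zero]
  | succ k ih =>
    intro n h1 h2
    rw [pow_succ' _ (k + 1), pow_succ', mul_assoc]
    have e : (k + 1 + 1) * (81 * W) = (k + 1) * (81 * W) + 81 * W := by ring
    rw [e] at h1 h2
    set D := (k + 1) * (81 * W) with hD
    have hD81 : 81 * W ≤ D := by rw [hD, add_mul, one_mul]; exact Nat.le_add_left _ _
    by_cases h : n < D + 81 * W + 110 * W
    · have := le_coeff_wP_mul (n := n) (coeff_wP_pow_nonneg Y (k + 1)) (a := vol Y) (b := 81 * W) le_rfl
        (by omega) (by omega) fun u hu => ⟨by rw [mem_Ico] at hu; omega,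
          ih (n - u) (by rw [mem_Ico] at hu; omega) (by rw [mem_Ico] at hu; omega)⟩
      rw [hc, hV1] at this
      convert this using 2
      ring
    · have := le_coeff_wP_mul (n := n) (coeff_wP_pow_nonneg Y (k + 1)) (a := 81 * W) (b := 16 * vol Y)
        (by omega) (by omega) le_rfl fun u hu => ⟨by rw [mem_Ico] at hu; omega,
          ih (n - u) (by rw [mem_Ico] at hu; omega) (by rw [mem_Ico] at hu; omega)⟩
      rw [hc, hV2] at this
      convert this using 2
      ring

/-- The model for the product of nine exponential sums. -/
noncomputable def model (c : Fin 9 → ℕ) (Y K : ℕ) (α : ℝ) : ℂ :=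
  open Classical in
  ∑ k ∈ range K, ∑ a : ZMod (k + 1), if IsUnit a then
    (∏ i, cs (phiP (c i)) (k + 1) a) * mH Y (α - (a.val : ℝ) / (k + 1 : ℕ)) ^ 9 else 0

/-- The polynomial with values `model`. -/
noncomputable def modelP (c : Fin 9 → ℕ) (Y K : ℕ) : ℂ[X] :=
  open Classical in
  ∑ k ∈ range K, ∑ a : ZMod (k + 1), if IsUnit a then C (∏ i, cs (phiP (c i)) (k + 1) a) *
    (((wP Y) ^ 9).map Complex.ofRealHom).comp (C (ex (-((a.val : ℝ) / (k + 1 : ℕ)))) * X) else 0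

/-- The truncated singular series. -/
noncomputable def sing (c : Fin 9 → ℕ) (K v : ℕ) : ℂ :=
  open Classical in
  ∑ k ∈ range K, ∑ a : ZMod (k + 1), if IsUnit a then
    (∏ i, cs (phiP (c i)) (k + 1) a) * ex (-((a.val : ℝ) / (k + 1 : ℕ))) ^ v else 0

lemma eval_wP (Y : ℕ) (β : ℝ) : ((wP Y).map Complex.ofRealHom).eval (ex β) = mH Y β := by
  unfold wP mH
  rw [Polynomial.map_sum, eval_finsetSum]
  refine sum_congr rfl fun u _ => ?_
  rw [Polynomial.map_mul, map_C, Polynomial.map_pow, map_X, eval_mul, eval_C, eval_pow, eval_X,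
    ← ex_nat_mul, mul_comm (u : ℝ)]
  rfl

lemma eval_modelP (c : Fin 9 → ℕ) (Y K : ℕ) (α : ℝ) : (modelP c Y K).eval (ex α) = model c Y K α := by
  unfold modelP model
  rw [eval_finsetSum]
  refine sum_congr rfl fun k _ => ?_
  rw [eval_finsetSum]
  refine sum_congr rfl fun a _ => ?_
  split_ifs
  · rw [eval_mul, eval_C, eval_comp, eval_mul, eval_C, eval_X, ← ex_add, Polynomial.map_pow, eval_pow, eval_wP]
    congr 3
    ring
  · simp

lemma coeff_modelP (c : Fin 9 → ℕ) (Y K v : ℕ) :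
    (modelP c Y K).coeff v = sing c K v * ((wP Y ^ 9).coeff v : ℝ) := by
  unfold modelP sing
  rw [finsetSum_coeff, sum_mul]
  refine sum_congr rfl fun k _ => ?_
  rw [finsetSum_coeff, sum_mul]
  refine sum_congr rfl fun a _ => ?_
  split_ifs
  · rw [coeff_C_mul, comp_C_mul_X_coeff, coeff_map]
    simp only [Complex.ofRealHom_eq_coe]
    ring
  · simp

lemma le_re_sing {c : Fin 9 → ℕ} (h0 : c 0 = 1) {K : ℕ} (hK : 0 < K) (v : ℕ) :
    0.09 ≤ (sing c K v).re := by
  classical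
  obtain ⟨K, rfl⟩ := Nat.exists_eq_succ_of_ne_zero hK.ne'
  have h1 := sum_prod_cs_le c h0 K
  unfold sing
  rw [sum_range_succ']
  set R := ∑ k ∈ range K, ∑ a : ZMod (k + 1 + 1), (if IsUnit a then
    (∏ i, cs (phiP (c i)) (k + 1 + 1) a) * ex (-((a.val : ℝ) / (k + 1 + 1 : ℕ))) ^ v else 0) with hR
  have h2 : ‖R‖ ≤ 0.91 := by
    refine le_trans ?_ h1
    refine (norm_sum_le _ _).trans (sum_le_sum fun k _ => (norm_sum_le _ _).trans (sum_le_sum fun a _ => ?_))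
    split_ifs
    · rw [norm_mul, norm_pow, norm_ex, one_pow, mul_one, norm_prod]
    · rw [norm_zero]
  have h3 : (∑ a : ZMod (0 + 1), (if IsUnit a then
      (∏ i, cs (phiP (c i)) (0 + 1) a) * ex (-((a.val : ℝ) / (0 + 1 : ℕ))) ^ v else 0)) = 1 := by
    have hs : ∀ (P : ℤ[X]) (a : ZMod 1), cs P 1 a = 1 := fun P a => by
      have h0 : ∀ z : ZMod 1, z = 0 := fun z => Subsingleton.elim _ _
      rw [cs, Fintype.sum_unique, h0 (_ * _)]
      simp
    rw [Fintype.sum_eq_single (0 : ZMod (0 + 1))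
      fun x hx => absurd (Subsingleton.elim (α := ZMod 1) x 0) hx,
      if_pos (isUnit_of_subsingleton (M := ZMod 1) _)]
    rw [prod_congr rfl fun i _ => hs (phiP (c i)) 0, ZMod.val_zero]
    simp
  rw [h3, Complex.add_re, Complex.one_re]
  have := (Complex.abs_re_le_norm R).trans h2
  rw [abs_le] at this
  linarith [this.1]

lemma coeff_genP_mul (A : Finset ℕ) (P : ℂ[X]) (n : ℕ) :
    (genP A * P).coeff n = ∑ a ∈ A, if a ≤ n then P.coeff (n - a) else 0 := by
  unfold genP
  rw [sum_mul, finsetSum_coeff]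
  exact sum_congr rfl fun a _ => coeff_X_pow_mul' _ _ _

/-- The generating polynomial of the values of `phi c`. -/
noncomputable def phiG (c Y : ℕ) : ℂ[X] := ∑ t ∈ Ioc Y (2 * Y), X ^ phi c t

lemma eval_phiG (c Y : ℕ) (α : ℝ) : (phiG c Y).eval (ex α) = fS c Y α := by
  unfold phiG fS
  rw [eval_finsetSum]
  refine sum_congr rfl fun t _ => ?_
  rw [eval_pow, eval_X, ← ex_nat_mul, mul_comm]

/-- The circle method: a good model yields a representation. -/
theorem exists_rep_of_model {c : Fin 9 → ℕ} (h0 : c 0 = 1) {Y K : ℕ} (hY : 0 < Y) (hK : 0 < K)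
    {A : Finset ℕ} {n : ℕ} (hn : ∀ a ∈ A, ∀ b ∈ A, a + b + 664 * (125 * Y ^ 4) ≤ n ∧
      n < a + b + 904 * (125 * Y ^ 4)) {S : ℝ}
    (hS : ∀ α, ‖(∏ i, fS (c i) Y α) - model c Y K α‖ ≤ S)
    (hlt : S < A.card * (0.09 * ((Y : ℝ) ^ 9 / (8192 * vol Y)))) :
    ∃ a ∈ A, ∃ b ∈ A, ∃ t : Fin 9 → ℕ, (∀ i, Y < t i) ∧ a + b + ∑ i, phi (c i) (t i) = n := by
  by_contra! hno
  have hS0 : 0 ≤ S := (norm_nonneg _).trans (hS 0)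
  set L := 0.09 * ((Y : ℝ) ^ 9 / (8192 * vol Y)) with hL
  have hcard : (0 : ℝ) < A.card := by
    by_contra! h
    have : (A.card : ℝ) = 0 := le_antisymm h (by positivity)
    rw [this, zero_mul] at hlt
    linarith
  set F : ℂ[X] := ∏ i, phiG (c i) Y with hF
  set G := genP A with hG
  have hzero : (G * (G * F)).coeff n = 0 := by
    rw [hG, hF, coeff_genP_mul]
    refine sum_eq_zero fun a ha => ?_
    split_ifs with h1
    · rw [coeff_genP_mul]
      refine sum_eq_zero fun b hb => ?_
      split_ifs with h2
      · unfold phiG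
        rw [prod_univ_sum, finsetSum_coeff]
        refine sum_eq_zero fun t ht => ?_
        rw [prod_pow_eq_pow_sum, coeff_X_pow, if_neg]
        have := hno a ha b hb t fun i => (mem_Ioc.mp (Fintype.mem_piFinset.mp ht i)).1
        omega
      · rfl
    · rfl
  have hmain : (A.card : ℝ) * (A.card * L) ≤ ((G * (G * modelP c Y K)).coeff n).re := by
    rw [hG, coeff_genP_mul, Complex.re_sum, ← nsmul_eq_mul]
    refine card_nsmul_le_sum _ _ _ fun a ha => ?_
    obtain ⟨b₀, hb₀⟩ : A.Nonempty := card_pos.mp (by exact_mod_cast hcard)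
    have ha0 := hn a ha b₀ hb₀
    rw [if_pos (by omega), coeff_genP_mul, Complex.re_sum, ← nsmul_eq_mul]
    refine card_nsmul_le_sum _ _ _ fun b hb => ?_
    have hab := hn a ha b hb
    rw [if_pos (by omega), coeff_modelP, Complex.re_mul_ofReal]
    have hJ := le_coeff_wP_pow hY 8 (n - a - b) (by omega) (by omega)
    have e : ((Y : ℝ) / 2) ^ 8 * (Y / (32 * vol Y)) = (Y : ℝ) ^ 9 / (8192 * vol Y) := by
      have : (vol Y : ℝ) ≠ 0 := by rw [cast_vol]; positivity
      field_simp
      norm_num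
    rw [e] at hJ
    rw [hL]
    exact mul_le_mul (le_re_sing h0 hK _) hJ (by positivity) (le_trans (by norm_num) (le_re_sing h0 hK (n - a - b)))
  set D : ℂ[X] := G * (G * (F - modelP c Y K)) with hD
  have hDc : D.coeff n = -(G * (G * modelP c Y K)).coeff n := by
    rw [hD, mul_sub, mul_sub, coeff_sub, hzero, zero_sub]
  obtain ⟨N, hN1, hN2, hN3⟩ : ∃ N, D.natDegree < N ∧ n < N ∧ ∀ a ∈ A, a < N :=
    ⟨max (D.natDegree + 1) (max (n + 1) (A.sup id + 1)), by omega, by omega, fun a ha => by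
      have : a ≤ A.sup id := le_sup (f := id) ha
      omega⟩
  have hN0 : 0 < N := by omega
  have hNr : (0 : ℝ) < N := by exact_mod_cast hN0
  have hup : N * ‖D.coeff n‖ ≤ N * A.card * S := by
    have hco : N * ‖D.coeff n‖ = ‖(N : ℂ) * D.coeff n‖ := by rw [norm_mul, Complex.norm_natCast]
    rw [hco, ← sum_norm_genP_sq hN0 hN3, sum_mul,
      ← sum_eval_mul_ex D hN1 hN2]
    refine (norm_sum_le _ _).trans (sum_le_sum fun k _ => ?_)
    rw [norm_mul, norm_ex, mul_one, hD, eval_mul, eval_mul, eval_sub, eval_modelP, hF, eval_prod]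
    simp_rw [eval_phiG]
    rw [norm_mul, norm_mul, ← mul_assoc, ← sq]
    exact mul_le_mul_of_nonneg_left (hS _) (by positivity)
  have h1 : ((G * (G * modelP c Y K)).coeff n).re ≤ ‖D.coeff n‖ := by
    rw [hDc, norm_neg]
    exact Complex.re_le_norm _
  have h2 : ‖D.coeff n‖ ≤ A.card * S := by
    rw [mul_assoc] at hup
    exact le_of_mul_le_mul_left hup hNr
  have h3 : (A.card : ℝ) * (A.card * L) ≤ A.card * S := hmain.trans (h1.trans h2)
  have := le_of_mul_le_mul_left h3 hcard
  linarith

end Biquad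

namespace Biquad
open Finset

lemma norm_prod_le_pow_card {ι : Type*} (s : Finset ι) {g : ι → ℂ} {M : ℝ} (hg : ∀ i ∈ s, ‖g i‖ ≤ M) :
    ‖∏ i ∈ s, g i‖ ≤ M ^ s.card := by
  rw [norm_prod, ← prod_const]
  exact prod_le_prod (fun _ _ => norm_nonneg _) hg

lemma norm_prod_sub_prod_le {ι : Type*} (s : Finset ι) {f g : ι → ℂ} {M E : ℝ} (hM : 0 ≤ M)
    (hf : ∀ i ∈ s, ‖f i‖ ≤ M) (hg : ∀ i ∈ s, ‖g i‖ ≤ M) (hfg : ∀ i ∈ s, ‖f i - g i‖ ≤ E) :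
    M * ‖∏ i ∈ s, f i - ∏ i ∈ s, g i‖ ≤ s.card * (M ^ s.card * E) := by
  classical
  induction s using Finset.induction_on with
  | empty => simp
  | insert a s ha ih =>
    simp only [mem_insert, forall_eq_or_imp] at hf hg hfg
    have h := ih hf.2 hg.2 hfg.2
    rw [prod_insert ha, prod_insert ha, card_insert_of_notMem ha]
    have e : f a * ∏ i ∈ s, f i - g a * ∏ i ∈ s, g i
        = f a * (∏ i ∈ s, f i - ∏ i ∈ s, g i) + (f a - g a) * ∏ i ∈ s, g i := by ring
    have hp := norm_prod_le_pow_card s hg.2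
    have h1 : ‖f a * (∏ i ∈ s, f i - ∏ i ∈ s, g i) + (f a - g a) * ∏ i ∈ s, g i‖
        ≤ M * ‖∏ i ∈ s, f i - ∏ i ∈ s, g i‖ + E * M ^ s.card := by
      refine (norm_add_le _ _).trans ?_
      rw [norm_mul, norm_mul]
      have := (norm_nonneg _).trans hfg.1
      gcongr
      · exact hf.1
      · exact hfg.1
    rw [e]
    refine (mul_le_mul_of_nonneg_left (h1.trans (add_le_add h le_rfl)) hM).trans (le_of_eq ?_)
    push_cast
    ring

lemma fS_add_int (c X : ℕ) (α : ℝ) (m : ℤ) : fS c X (α + m) = fS c X α := by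
  unfold fS
  refine sum_congr rfl fun t _ => ?_
  rw [add_mul, show (m : ℝ) * (phi c t : ℕ) = ((m * phi c t : ℤ) : ℝ) by push_cast; ring, ex_add_int]

lemma mH_add_int (X : ℕ) (β : ℝ) (m : ℤ) : mH X (β + m) = mH X β := by
  unfold mH
  refine sum_congr rfl fun u _ => ?_
  rw [add_mul, show (m : ℝ) * (u : ℕ) = ((m * u : ℤ) : ℝ) by push_cast; ring, ex_add_int]

/-- The fraction `a / q` attached to a residue class. -/
noncomputable def frac (s : Σ k : ℕ, ZMod (k + 1)) : ℝ := (s.2.val : ℝ) / (s.1 + 1 : ℕ)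

lemma coprime_val {q : ℕ} [NeZero q] {a : ZMod q} (ha : IsUnit a) : a.val.Coprime q := by
  rwa [← ZMod.isUnit_iff_coprime, ZMod.natCast_zmod_val]

/-- Distinct reduced fractions repel each other modulo one. -/
lemma eq_of_nd_frac_lt {s t : Σ k : ℕ, ZMod (k + 1)} (hs : IsUnit s.2) (ht : IsUnit t.2)
    (h : nd (frac s - frac t) * ((s.1 + 1 : ℕ) * (t.1 + 1 : ℕ)) < 1) : s = t := by
  obtain ⟨k, a⟩ := s
  obtain ⟨j, b⟩ := t
  simp only [frac, nd] at *
  set m := round ((a.val : ℝ) / (k + 1 : ℕ) - (b.val : ℝ) / (j + 1 : ℕ))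
  have hk : (0 : ℝ) < (k + 1 : ℕ) := by positivity
  have hj : (0 : ℝ) < (j + 1 : ℕ) := by positivity
  have h1 : ((a.val : ℤ) * (j + 1 : ℕ) - (b.val : ℤ) * (k + 1 : ℕ) - m * ((k + 1 : ℕ) * (j + 1 : ℕ)) : ℤ) = 0 := by
    rw [← abs_of_pos (mul_pos hk hj), ← abs_mul] at h
    have e : ((a.val : ℝ) / (k + 1 : ℕ) - (b.val : ℝ) / (j + 1 : ℕ) - m) * ((k + 1 : ℕ) * (j + 1 : ℕ))
        = (((a.val : ℤ) * (j + 1 : ℕ) - (b.val : ℤ) * (k + 1 : ℕ) - m * ((k + 1 : ℕ) * (j + 1 : ℕ)) : ℤ) : ℝ) := by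
      rw [Int.cast_sub, Int.cast_sub, Int.cast_mul, Int.cast_mul, Int.cast_mul, Int.cast_mul]
      simp only [Int.cast_natCast]
      field_simp
    rw [e] at h
    rw [← Int.abs_lt_one_iff]
    exact_mod_cast h
  have d1 : k + 1 ∣ j + 1 := by
    have : ((k + 1 : ℕ) : ℤ) ∣ (a.val : ℤ) * (j + 1 : ℕ) :=
      ⟨(b.val : ℤ) + m * (j + 1 : ℕ), by linear_combination h1⟩
    exact (coprime_val hs).symm.dvd_of_dvd_mul_left (by exact_mod_cast this)
  have d2 : j + 1 ∣ k + 1 := by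
    have : ((j + 1 : ℕ) : ℤ) ∣ (b.val : ℤ) * (k + 1 : ℕ) :=
      ⟨(a.val : ℤ) - m * (k + 1 : ℕ), by linear_combination -h1⟩
    exact (coprime_val ht).symm.dvd_of_dvd_mul_left (by exact_mod_cast this)
  obtain rfl : k = j := by have := Nat.dvd_antisymm d1 d2; omega
  have h2 : (a.val : ℤ) = b.val + m * (k + 1 : ℕ) := by
    have hne : ((k + 1 : ℕ) : ℤ) ≠ 0 := by positivity
    exact mul_right_cancel₀ hne (by linear_combination h1)
  have h3 : a = b := by
    have := congrArg (fun x : ℤ => (x : ZMod (k + 1))) h2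
    simpa only [Int.cast_add, Int.cast_mul, Int.cast_natCast, ZMod.natCast_zmod_val, ZMod.natCast_self,
      mul_zero, add_zero] using this
  rw [h3]

open Classical in
/-- One term of `model`. -/
noncomputable def modelTerm (c : Fin 9 → ℕ) (Y : ℕ) (α : ℝ) (s : Σ k : ℕ, ZMod (k + 1)) : ℂ :=
  if IsUnit s.2 then (∏ i, cs (phiP (c i)) (s.1 + 1) s.2) * mH Y (α - frac s) ^ 9 else 0

/-- The reduced fractions of denominator at most `K`. -/
def fracs (K : ℕ) : Finset (Σ k : ℕ, ZMod (k + 1)) := (range K).sigma fun _ => univ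

lemma card_fracs_le (K : ℕ) : ((fracs K).card : ℝ) ≤ (K : ℝ) ^ 2 := by
  have : (fracs K).card ≤ K * K := by
    rw [fracs, card_sigma]
    refine (sum_le_card_nsmul _ _ K fun k hk => ?_).trans (by simp)
    rw [card_univ, ZMod.card]
    exact mem_range.mp hk
  rw [sq]
  exact_mod_cast this

lemma model_eq_sum (c : Fin 9 → ℕ) (Y K : ℕ) (α : ℝ) :
    model c Y K α = ∑ s ∈ fracs K, modelTerm c Y α s := by
  rw [model, fracs, sum_sigma]
  rfl

lemma norm_prod_cs_le_one (c : Fin 9 → ℕ) (q : ℕ) [NeZero q] (a : ZMod q) :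
    ‖∏ i, cs (phiP (c i)) q a‖ ≤ 1 := by
  rw [norm_prod]
  exact prod_le_one (fun _ _ => norm_nonneg _) fun _ _ => norm_cs_le_one _ _ _

lemma norm_mH_le_of_le_nd {X : ℕ} (hX : 0 < X) {β B : ℝ} (hB : 0 < B) (hβ : B ≤ vol X * nd β) :
    ‖mH X β‖ ≤ X / (8 * B) := by
  have hn : nd β ≠ 0 := fun h => by rw [h, mul_zero] at hβ; linarith
  refine (norm_mH_le_of_nd hX hn).trans ?_
  rw [mul_assoc]
  gcongr

lemma norm_modelTerm_le {c : Fin 9 → ℕ} {Y : ℕ} (hY : 0 < Y) {α B : ℝ} (hB : 0 < B)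
    {s : Σ k : ℕ, ZMod (k + 1)} (hs : IsUnit s.2 → B ≤ vol Y * nd (α - frac s)) :
    ‖modelTerm c Y α s‖ ≤ (Y / (8 * B)) ^ 9 := by
  unfold modelTerm
  split_ifs with h
  · rw [norm_mul, norm_pow]
    refine (mul_le_of_le_one_left (by positivity) (norm_prod_cs_le_one _ _ _)).trans ?_
    have := norm_mH_le_of_le_nd hY hB (hs h)
    gcongr
  · rw [norm_zero]
    positivity

lemma norm_sum_modelTerm_le {c : Fin 9 → ℕ} {Y K : ℕ} (hY : 0 < Y) {α B : ℝ} (hB : 0 < B)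
    {S : Finset (Σ k : ℕ, ZMod (k + 1))} (hS : S ⊆ fracs K)
    (h : ∀ s ∈ S, IsUnit s.2 → B ≤ vol Y * nd (α - frac s)) :
    ‖∑ s ∈ S, modelTerm c Y α s‖ ≤ (K : ℝ) ^ 2 * (Y / (8 * B)) ^ 9 := by
  refine (norm_sum_le_of_le _ fun s hs => norm_modelTerm_le hY hB (h s hs)).trans ?_
  rw [sum_const, nsmul_eq_mul]
  have := (Nat.cast_le (α := ℝ).mpr (card_le_card hS)).trans (card_fracs_le K)
  gcongr

/-- Near a fraction, the product of exponential sums is close to the matching term. -/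
lemma norm_prod_fS_sub_modelTerm_le {c : Fin 9 → ℕ} {Y : ℕ} (hY : 10 ≤ Y) (hc : ∀ i, c i ≤ 5) {α : ℝ}
    {s : Σ k : ℕ, ZMod (k + 1)} (hs : IsUnit s.2) :
    Y * ‖(∏ i, fS (c i) Y α) - modelTerm c Y α s‖ ≤
      9 * ((Y : ℝ) ^ 9 * (2 * (s.1 + 1 : ℕ) * (1 + 2 * Real.pi * (17 * vol Y) * nd (α - frac s)))) := by
  set m := round (α - frac s) with hm
  set β := α - frac s - m with hβ
  have e1 : α = frac s + β + m := by rw [hβ]; ring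
  have e2 : α - frac s = β + m := by rw [hβ]; ring
  have e3 : modelTerm c Y α s = ∏ i, cs (phiP (c i)) (s.1 + 1) s.2 * mH Y β := by
    rw [modelTerm, if_pos hs, e2, mH_add_int, prod_mul_distrib, prod_const, card_univ, Fintype.card_fin]
  have e4 : nd (α - frac s) = |β| := rfl
  rw [e3, e4]
  have := norm_prod_sub_prod_le (univ : Finset (Fin 9)) (f := fun i => fS (c i) Y α)
    (g := fun i => cs (phiP (c i)) (s.1 + 1) s.2 * mH Y β) (M := Y)
    (E := 2 * (s.1 + 1 : ℕ) * (1 + 2 * Real.pi * (17 * vol Y) * |β|)) (by positivity)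
    (fun i _ => norm_fS_le _ _ _)
    (fun i _ => by
      rw [norm_mul]
      exact (mul_le_of_le_one_left (norm_nonneg _) (norm_cs_le_one _ _ _)).trans (norm_mH_le _ _))
    (fun i _ => by
      rw [e1, fS_add_int]
      exact norm_fS_sub_le hY (hc i) s.2 β)
  simpa using this

lemma two_pi_mul_le {x : ℝ} (hx : 0 ≤ x) : 2 * Real.pi * (17 * x) ≤ 107 * x := by
  nlinarith [Real.pi_lt_d4]

lemma exists_dirichlet (α : ℝ) {Q : ℕ} (hQ : 0 < Q) : ∃ (a : ℤ) (k : ℕ), IsUnit (a : ZMod (k + 1)) ∧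
    |α - a / (k + 1 : ℕ)| ≤ 1 / ((Q + 1) * (k + 1 : ℕ)) ∧ k + 1 ≤ Q := by
  obtain ⟨r, hr1, hr2⟩ := Real.exists_rat_abs_sub_le_and_den_le α hQ
  obtain ⟨k, hk⟩ := Nat.exists_eq_succ_of_ne_zero r.den_nz
  rw [Nat.succ_eq_add_one] at hk
  have hcop : IsCoprime ((r.den : ℕ) : ℤ) r.num :=
    (Int.isCoprime_iff_gcd_eq_one.mpr (by simpa [Int.gcd] using r.reduced)).symm
  rw [Rat.cast_def, hk] at hr1
  rw [hk] at hr2 hcop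
  exact ⟨r.num, k, (ZMod.coe_int_isUnit_iff_isCoprime _ _).mpr hcop, hr1, hr2⟩

variable {X : ℕ} {l : ℝ}

/-- Away from the fractions of small denominator, each exponential sum is small. -/
lemma norm_fS_le_of_far (h : Scale X l) {c : ℕ} (hc : c ∈ ({0, 1, 4, 5} : Finset ℕ)) {K : ℕ}
    (hK : 10 ^ 38 * l ^ 8 < (K : ℝ) + 1) {α : ℝ}
    (hfar : ∀ s ∈ fracs K, IsUnit s.2 → 10 ^ 11 * l ^ 3 ≤ vol X * nd (α - frac s)) :
    ‖fS c X α‖ ≤ X / (900 * l) := by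
  have hl := h.one_le
  have hl0 := h.pos
  have hX := h.cast_pos
  have hX80 := h.le_cast
  have hXn : 10 ≤ X := by
    have : (10 : ℝ) ≤ X := le_trans (by norm_num) hX80
    exact_mod_cast this
  set Q := ⌊2 * 10 ^ 9 * (X : ℝ) ^ 3 * l⌋₊ with hQ
  have hQ0 : 0 < Q := Nat.floor_pos.mpr (by
    have : (1 : ℝ) ≤ X := le_trans (by norm_num) hX80
    have : (1 : ℝ) ≤ (X : ℝ) ^ 3 := one_le_pow₀ this
    nlinarith)
  have hQle : (Q : ℝ) ≤ 2 * 10 ^ 9 * (X : ℝ) ^ 3 * l := Nat.floor_le (by positivity)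
  have hQlt := Nat.lt_floor_add_one (2 * 10 ^ 9 * (X : ℝ) ^ 3 * l)
  rw [← hQ] at hQlt
  obtain ⟨a, k, hunit, ha, hkQ⟩ := exists_dirichlet α hQ0
  have hkQ' : ((k + 1 : ℕ) : ℝ) ≤ Q := by exact_mod_cast hkQ
  have hk0 : (0 : ℝ) < (k + 1 : ℕ) := by positivity
  rcases le_or_gt ((X : ℝ) / (10 ^ 4 * l)) ((k + 1 : ℕ) : ℝ) with hbig | hsmall
  · refine norm_fS_le_of_minor h c hunit (ha.trans ?_) hbig (hkQ'.trans hQle)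
    rw [sq]
    gcongr
    linarith
  set β := α - a / (k + 1 : ℕ) with hβ
  set s : Σ k : ℕ, ZMod (k + 1) := ⟨k, (a : ZMod (k + 1))⟩ with hs
  have hα : α = frac s + β + (a / (k + 1 : ℕ) : ℤ) := by
    have h1 : (a : ℝ) = (a : ZMod (k + 1)).val + (k + 1 : ℕ) * ((a / (k + 1 : ℕ) : ℤ) : ℝ) := by
      have := Int.emod_add_mul_ediv a (k + 1 : ℕ)
      rw [← ZMod.val_intCast] at this
      exact_mod_cast this.symm
    rw [frac, hs, hβ]
    field_simp
    linear_combination h1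
  have hsub := norm_fS_sub_le hXn (c := c) (by fin_cases hc <;> norm_num) s.2 β
  have hf : fS c X α = fS c X (frac s + β) := by rw [hα, fS_add_int]
  change ‖fS c X (frac s + β) - _‖ ≤ _ at hsub
  rw [← hf] at hsub
  have herr : 2 * ((k + 1 : ℕ) : ℝ) * (1 + 2 * Real.pi * (17 * vol X) * |β|) ≤ X / (2000 * l) := by
    have h1 := two_pi_mul_le (x := vol X) (by positivity)
    have h2 : ((k + 1 : ℕ) : ℝ) * |β| ≤ 1 / (2 * 10 ^ 9 * (X : ℝ) ^ 3 * l) := by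
      calc ((k + 1 : ℕ) : ℝ) * |β| ≤ (k + 1 : ℕ) * (1 / ((Q + 1) * (k + 1 : ℕ))) := by gcongr
        _ = 1 / (Q + 1) := by field_simp
        _ ≤ _ := by gcongr
    calc 2 * ((k + 1 : ℕ) : ℝ) * (1 + 2 * Real.pi * (17 * vol X) * |β|)
        ≤ 2 * ((k + 1 : ℕ) : ℝ) * (1 + 107 * vol X * |β|) := by gcongr
      _ = 2 * ((k + 1 : ℕ) : ℝ) + 214 * vol X * ((k + 1 : ℕ) * |β|) := by ring
      _ ≤ 2 * (X / (10 ^ 4 * l)) + 214 * vol X * (1 / (2 * 10 ^ 9 * (X : ℝ) ^ 3 * l)) := by gcongr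
      _ = (2 / 10 ^ 4 + 214 * 2000 / (2 * 10 ^ 9)) * (X / l) := by
        rw [cast_vol]
        field_simp
      _ ≤ 1 / 2000 * (X / l) := by
        gcongr
        norm_num
      _ = X / (2000 * l) := by field_simp
  have hmain : ‖cs (phiP c) (k + 1) s.2 * mH X β‖ ≤ X / (1800 * l) := by
    rw [norm_mul]
    rcases le_or_gt K k with hKk | hkK
    · have h8 := norm_cs_phiP_pow_eight_le hc (k + 1) hunit
      have hT : ‖cs (phiP c) (k + 1) s.2‖ ≤ 1 / (1800 * l) := by
        refine le_of_pow_le_pow_left₀ (by norm_num : (8 : ℕ) ≠ 0) (by positivity) ?_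
        have hkk : 10 ^ 38 * l ^ 8 ≤ ((k + 1 : ℕ) : ℝ) := by
          have : (K : ℝ) ≤ k := by exact_mod_cast hKk
          push_cast
          linarith
        have h9 : ‖cs (phiP c) (k + 1) s.2‖ ^ 8 * (10 ^ 38 * l ^ 8) ≤ 9 * 10 ^ 9 :=
          le_trans (by gcongr) h8
        rw [div_pow, mul_pow, one_pow, le_div_iff₀ (by positivity)]
        nlinarith
      calc ‖cs (phiP c) (k + 1) s.2‖ * ‖mH X β‖ ≤ 1 / (1800 * l) * X := by
            gcongr
            exact norm_mH_le _ _
        _ = _ := by ring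
    · have hmem : s ∈ fracs K := by simp [fracs, hs, hkK]
      have hfar' := hfar s hmem hunit
      have e : α - frac s = β + (a / (k + 1 : ℕ) : ℤ) := by rw [hα]; ring
      rw [e, nd_add_int] at hfar'
      have hH := norm_mH_le_of_le_nd h.one_le_X (by positivity) hfar'
      calc ‖cs (phiP c) (k + 1) s.2‖ * ‖mH X β‖ ≤ 1 * (X / (8 * (10 ^ 11 * l ^ 3))) := by
            gcongr
            exact norm_cs_le_one _ _ _
        _ ≤ X / (1800 * l) := by
            rw [one_mul]
            have : l ≤ l ^ 3 := le_self_pow₀ hl (by norm_num)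
            refine div_le_div_of_nonneg_left hX.le (by positivity) ?_
            linarith
  have htri := norm_add_le (fS c X α - cs (phiP c) (k + 1) s.2 * mH X β)
    (cs (phiP c) (k + 1) s.2 * mH X β)
  rw [sub_add_cancel] at htri
  have e : (X : ℝ) / (2000 * l) + X / (1800 * l) ≤ X / (900 * l) := by
    have e2 : (X : ℝ) / (2000 * l) ≤ X / (1800 * l) := by
      gcongr
      norm_num
    have e3 : (X : ℝ) / (900 * l) = X / (1800 * l) + X / (1800 * l) := by
      field_simp
      norm_num
    linarith
  linarith [hsub.trans herr]

/-- The model approximates the product of the exponential sums uniformly. -/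
lemma norm_prod_fS_sub_model_le (h : Scale X l) {c : Fin 9 → ℕ} (hc : ∀ i, c i ∈ ({0, 1, 4, 5} : Finset ℕ))
    (α : ℝ) : ‖(∏ i, fS (c i) X α) - model c X ⌊10 ^ 38 * l ^ 8⌋₊ α‖ ≤ 3 / 10 ^ 27 * ((X : ℝ) ^ 9 / l ^ 9) := by
  have hl := h.one_le
  have hl0 := h.pos
  have hX := h.cast_pos
  have hX80 := h.le_cast
  have hXn : 10 ≤ X := by
    have : (10 : ℝ) ≤ X := le_trans (by norm_num) hX80
    exact_mod_cast this
  set K := ⌊10 ^ 38 * l ^ 8⌋₊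
  have hK1 : (K : ℝ) ≤ 10 ^ 38 * l ^ 8 := Nat.floor_le (by positivity)
  have hK2 : 10 ^ 38 * l ^ 8 < (K : ℝ) + 1 := Nat.lt_floor_add_one _
  set B := 10 ^ 11 * l ^ 3 with hB
  have hB0 : 0 < B := by positivity
  have hV : (0 : ℝ) < vol X := by rw [cast_vol]; positivity
  have htail : (K : ℝ) ^ 2 * (X / (8 * B)) ^ 9 ≤ 1 / 10 ^ 29 * ((X : ℝ) ^ 9 / l ^ 9) := by
    calc (K : ℝ) ^ 2 * (X / (8 * B)) ^ 9 ≤ (10 ^ 38 * l ^ 8) ^ 2 * (X / (8 * B)) ^ 9 := by gcongr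
      _ = (10 ^ 76 / (8 * 10 ^ 11) ^ 9 / l ^ 2) * ((X : ℝ) ^ 9 / l ^ 9) := by
        rw [hB]
        field_simp
      _ ≤ 1 / 10 ^ 29 * ((X : ℝ) ^ 9 / l ^ 9) := by
        refine mul_le_mul_of_nonneg_right ?_ (by positivity)
        rw [div_le_iff₀ (by positivity)]
        have := one_le_pow₀ (n := 2) hl
        norm_num
        linarith
  by_cases hnear : ∃ s ∈ fracs K, IsUnit s.2 ∧ vol X * nd (α - frac s) < B
  · obtain ⟨s, hsK, hsu, hsB⟩ := hnear
    have hle : ∀ t ∈ fracs K, ((t.1 + 1 : ℕ) : ℝ) ≤ K := fun t ht => by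
      exact_mod_cast mem_range.mp (mem_sigma.mp ht).1
    have hfar : ∀ t ∈ (fracs K).erase s, IsUnit t.2 → B ≤ vol X * nd (α - frac t) := by
      intro t ht htu
      rw [mem_erase] at ht
      by_contra! hlt
      refine ht.1 (eq_of_nd_frac_lt hsu htu ?_).symm
      have h1 : nd (frac s - frac t) ≤ nd (α - frac s) + nd (α - frac t) := by
        rw [← nd_neg (α - frac s), show frac s - frac t = -(α - frac s) + (α - frac t) by ring]
        exact nd_add_le _ _
      have h2 : vol X * nd (frac s - frac t) < 2 * B := by nlinarith
      have h3 : ((s.1 + 1 : ℕ) * (t.1 + 1 : ℕ) : ℝ) ≤ K ^ 2 := by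
        rw [sq]
        have := hle s hsK
        have := hle t ht.2
        gcongr
      have h4 : 2 * B * (K : ℝ) ^ 2 ≤ vol X := by
        rw [cast_vol, hB]
        calc 2 * (10 ^ 11 * l ^ 3) * (K : ℝ) ^ 2 ≤ 2 * (10 ^ 11 * l ^ 3) * (10 ^ 38 * l ^ 8) ^ 2 := by gcongr
          _ = 2 * 10 ^ 87 * l ^ 19 := by ring
          _ ≤ 10 ^ 160 * l ^ 60 := by
            gcongr
            · norm_num
            · norm_num
          _ = (X : ℝ) ^ 2 := by rw [h.eq]; ring
          _ ≤ (X : ℝ) ^ 4 := by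
            gcongr
            · linarith
            · norm_num
          _ ≤ 2000 * (X : ℝ) ^ 4 := by linarith [pow_pos hX 4]
      have h5 : vol X * (nd (frac s - frac t) * ((s.1 + 1 : ℕ) * (t.1 + 1 : ℕ))) < vol X * 1 := by
        calc vol X * (nd (frac s - frac t) * ((s.1 + 1 : ℕ) * (t.1 + 1 : ℕ)))
            = vol X * nd (frac s - frac t) * ((s.1 + 1 : ℕ) * (t.1 + 1 : ℕ) : ℝ) := by ring
          _ < 2 * B * ((s.1 + 1 : ℕ) * (t.1 + 1 : ℕ) : ℝ) := by gcongr
          _ ≤ 2 * B * (K : ℝ) ^ 2 := by gcongr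
          _ ≤ vol X * 1 := by rwa [mul_one]
      exact lt_of_mul_lt_mul_left h5 hV.le
    have hrest := norm_sum_modelTerm_le h.one_le_X hB0 (c := c) (erase_subset _ _) hfar
    have hmain : ‖(∏ i, fS (c i) X α) - modelTerm c X α s‖ ≤ 1 / 10 ^ 27 * ((X : ℝ) ^ 9 / l ^ 9) := by
      refine le_of_mul_le_mul_left ((norm_prod_fS_sub_modelTerm_le hXn (fun i => ?_) hsu).trans ?_) hX
      · have := hc i
        simp only [mem_insert, mem_singleton] at this
        omega
      have h1 := two_pi_mul_le (x := vol X) hV.le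
      have hd := nd_nonneg (α - frac s)
      have h2 := hle s hsK
      calc 9 * ((X : ℝ) ^ 9 * (2 * (s.1 + 1 : ℕ) * (1 + 2 * Real.pi * (17 * vol X) * nd (α - frac s))))
          ≤ 9 * ((X : ℝ) ^ 9 * (2 * K * (1 + 107 * vol X * nd (α - frac s)))) := by gcongr
        _ = 9 * ((X : ℝ) ^ 9 * (2 * K * (1 + 107 * (vol X * nd (α - frac s))))) := by ring
        _ ≤ 9 * ((X : ℝ) ^ 9 * (2 * (10 ^ 38 * l ^ 8) * (B + 107 * B))) := by
          gcongr
          · rw [hB]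
            have := one_le_pow₀ (n := 3) hl
            linarith
        _ = 1944 * 10 ^ 49 * l ^ 11 * (X : ℝ) ^ 9 := by rw [hB]; ring
        _ ≤ 10 ^ 53 * l ^ 21 * (X : ℝ) ^ 9 := by
          gcongr
          · norm_num
          · norm_num
        _ = 1 / 10 ^ 27 * (10 ^ 80 * l ^ 30) * ((X : ℝ) ^ 9 / l ^ 9) := by
          field_simp
        _ = X * (1 / 10 ^ 27 * ((X : ℝ) ^ 9 / l ^ 9)) := by
          rw [← h.eq]
          ring
    rw [model_eq_sum, ← add_sum_erase _ _ hsK, ← sub_sub]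
    refine (norm_sub_le _ _).trans ((add_le_add hmain (hrest.trans htail)).trans ?_)
    rw [← add_mul]
    gcongr
    norm_num
  · push Not at hnear
    have hmodel := norm_sum_modelTerm_le h.one_le_X hB0 (c := c) (Subset.refl _) hnear
    have hprod : ‖∏ i, fS (c i) X α‖ ≤ (X / (900 * l)) ^ 9 := by
      simpa using norm_prod_le_pow_card univ fun i _ => norm_fS_le_of_far h (hc i) hK2 hnear
    have hp : ((X : ℝ) / (900 * l)) ^ 9 = 1 / 900 ^ 9 * ((X : ℝ) ^ 9 / l ^ 9) := by
      rw [div_pow, mul_pow]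
      field_simp
    rw [hp] at hprod
    rw [model_eq_sum]
    refine (norm_sub_le _ _).trans ((add_le_add hprod (hmodel.trans htail)).trans ?_)
    rw [← add_mul]
    gcongr
    norm_num

/-- Sums of two elements of a dense set and nine values of `phi`. -/
theorem exists_rep_of_dense (h : Scale X l) {c : Fin 9 → ℕ} (h0 : c 0 = 1)
    (hc : ∀ i, c i ∈ ({0, 1, 4, 5} : Finset ℕ)) {A : Finset ℕ} {n : ℕ}
    (hA : 7 / 10 ^ 19 * (X : ℝ) ^ 4 / l ^ 5 ≤ A.card)
    (hn : ∀ a ∈ A, ∀ b ∈ A, a + b + 664 * (125 * X ^ 4) ≤ n ∧ n < a + b + 904 * (125 * X ^ 4)) :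
    ∃ a ∈ A, ∃ b ∈ A, ∃ t : Fin 9 → ℕ, (∀ i, X < t i) ∧ a + b + ∑ i, phi (c i) (t i) = n := by
  have hl := h.one_le
  have hl0 := h.pos
  have hX := h.cast_pos
  refine exists_rep_of_model h0 h.one_le_X (Nat.floor_pos.mpr ?_) hn (norm_prod_fS_sub_model_le h hc) ?_
  · have := one_le_pow₀ (n := 8) hl
    linarith
  · calc 3 / 10 ^ 27 * ((X : ℝ) ^ 9 / l ^ 9) ≤ 3 / 10 ^ 27 * ((X : ℝ) ^ 9 / l ^ 5) := by
          gcongr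
          norm_num
      _ < 7 * 9 / (10 ^ 21 * (8192 * 2000)) * ((X : ℝ) ^ 9 / l ^ 5) := by
          exact mul_lt_mul_of_pos_right (by norm_num) (by positivity)
      _ = 7 / 10 ^ 19 * (X : ℝ) ^ 4 / l ^ 5 * (0.09 * ((X : ℝ) ^ 9 / (8192 * vol X))) := by
          rw [cast_vol]
          field_simp
          norm_num
      _ ≤ _ := by gcongr

end Biquad

namespace Biquad
open Finset

lemma isRepr_zero (k : ℕ) : IsRepr 0 0 k := ⟨Fin.elim0, fun i => i.elim0, by simp⟩

lemma isRepr_pow {x : ℕ} (hx : 0 < x) (k : ℕ) : IsRepr (x ^ k) 1 k := ⟨fun _ => x, fun _ => hx, by simp⟩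

lemma _root_.IsRepr.add {m n i j k : ℕ} (hm : IsRepr m i k) (hn : IsRepr n j k) : IsRepr (m + n) (i + j) k := by
  obtain ⟨a, ha, rfl⟩ := hm
  obtain ⟨b, hb, rfl⟩ := hn
  refine ⟨Fin.append a b, fun t => ?_, by simp [Fin.sum_univ_add]⟩
  induction t using Fin.addCases with
  | left t => simpa using ha t
  | right t => simpa using hb t

lemma exists_residues {R : ℕ} (h1 : 1 ≤ R % 16) (h9 : R % 16 ≤ 9) : ∃ c : Fin 9 → ℕ, c 0 = 1 ∧
    (∀ i, c i ∈ ({0, 1, 4, 5} : Finset ℕ)) ∧ (∑ i, c i ^ 4) % 80 = R % 80 := by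
  set f : ℕ → Fin 9 → ℕ := fun R i => if (i : ℕ) < R % 16 then (if (i : ℕ) < (R + 4) % 5 + 1 then 1 else 5)
    else (if (i : ℕ) < (R + 4) % 5 + 1 then 4 else 0) with hf
  have key : ∀ S < 80, 1 ≤ S % 16 → S % 16 ≤ 9 → f S 0 = 1 ∧
      (∀ i, f S i ∈ ({0, 1, 4, 5} : Finset ℕ)) ∧ (∑ i, f S i ^ 4) % 80 = S := by
    rw [hf]
    decide +kernel
  have := key (R % 80) (Nat.mod_lt _ (by norm_num)) (by omega) (by omega)
  exact ⟨f (R % 80), this⟩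

lemma exists_rep_of_scale {X n : ℕ} (hX : 10 ^ 80 ≤ X) (h1 : 8200000 * X ^ 4 ≤ n)
    (h2 : n < 8200000 * (X + 1) ^ 4) : IsRepr n 21 4 := by
  obtain ⟨l, hl⟩ := exists_scale hX
  obtain ⟨e, he, hn⟩ : ∃ e ≤ 1, 1 ≤ (n + 8 * e) % 16 ∧ (n + 8 * e) % 16 ≤ 9 := by
    by_cases h : 1 ≤ n % 16 ∧ n % 16 ≤ 9
    · exact ⟨0, by omega, by omega⟩
    · exact ⟨1, by omega, by omega⟩
  obtain ⟨r, hr80, hr16, A, hA, hA'⟩ := exists_sixth_sums hl he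
  obtain ⟨c, h0, hc, hcR⟩ := exists_residues (R := n + 160 - 2 * r) (by omega) (by omega)
  have hsum : ∑ i, c i ^ 4 ≤ 5625 := by
    refine (sum_le_card_nsmul univ _ 625 fun i _ => ?_).trans (by simp)
    have := hc i
    simp only [mem_insert, mem_singleton] at this
    have : c i ≤ 5 := by omega
    calc c i ^ 4 ≤ 5 ^ 4 := Nat.pow_le_pow_left this 4
      _ = 625 := by norm_num
  set s := ∑ i, c i ^ 4
  have hX0 : 1000 ≤ X := le_trans (by norm_num) hX
  clear hX
  have hX3 : 1000 * X ^ 3 ≤ X ^ 4 := by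
    rw [pow_succ X 3, mul_comm (X ^ 3)]
    exact Nat.mul_le_mul_right _ hX0
  have hX3' : 1 ≤ X ^ 3 := Nat.one_le_pow _ _ (by omega)
  have hX2 : 6 * X ^ 2 + 4 * X + 1 ≤ 11 * X ^ 3 := by
    have e1 : X ^ 2 ≤ X ^ 3 := Nat.pow_le_pow_right (by omega) (by norm_num)
    have e2 : X ≤ X ^ 3 := Nat.le_self_pow (by norm_num) X
    omega
  have hX4 : (X + 1) ^ 4 ≤ X ^ 4 + 15 * X ^ 3 := by
    have : (X + 1) ^ 4 = X ^ 4 + 4 * X ^ 3 + (6 * X ^ 2 + 4 * X + 1) := by ring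
    omega
  obtain ⟨n', hn'⟩ : ∃ n', n = 2 * r + s + 80 * n' := by
    have hn0 : 5785 ≤ n := by omega
    have : (2 * r + s) % 80 = n % 80 := by clear * - hcR hr80 hn0; omega
    exact ⟨(n - (2 * r + s)) / 80, by clear * - this hn0 hsum hr80; omega⟩
  obtain ⟨a, ha, b, hb, t, ht, hab⟩ := exists_rep_of_dense hl h0 hc (n := n') hA fun a ha b hb => by
    have h3 := (hA' a ha).1
    have h4 := (hA' b hb).1
    clear * - h1 h2 h3 h4 hX4 hX3 hX3' hsum hr80 hn'
    constructor
    · omega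
    · omega
  obtain ⟨-, z, hz, hza⟩ := hA' a ha
  obtain ⟨-, w, hw, hwb⟩ := hA' b hb
  have h9 : IsRepr (∑ i, (80 * phi (c i) (t i) + c i ^ 4)) 9 4 := by
    refine ⟨fun i => 20 * t i + c i, fun i => ?_, ?_⟩
    · have := ht i
      change 0 < 20 * t i + c i
      omega
    · simp_rw [phi_spec]
  have e : n = 80 * a + r + (80 * b + r) + (80 * ∑ i, phi (c i) (t i) + s) := by
    clear * - hn' hab
    omega
  have h21 := (IsRepr.add ⟨z, hz, hza⟩ ⟨w, hw, hwb⟩).add h9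
  rw [sum_add_distrib, ← mul_sum] at h21
  rw [e]
  exact h21

/-- Every large number is a sum of 21 positive biquadrates. -/
theorem isRepr_of_large {n : ℕ} (hn : 8200000 * (10 ^ 80) ^ 4 ≤ n) : IsRepr n 21 4 := by
  set P : ℕ → Prop := fun X => 8200000 * X ^ 4 ≤ n
  have hb : ∀ X, P X → X ≤ n := fun X hX => by
    have : X ≤ X ^ 4 := Nat.le_self_pow (by norm_num) X
    have : 8200000 * X ^ 4 ≤ n := hX
    omega
  classical
  refine exists_rep_of_scale (X := Nat.findGreatest P n) (Nat.le_findGreatest (hb _ hn) hn)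
    (Nat.findGreatest_spec (P := P) (hb _ hn) hn) ?_
  by_contra! h
  have := Nat.le_findGreatest (P := P) (hb _ h) h
  omega

end Biquad

namespace Biquad
open Finset

/-- The union of the left shifts of the bit mask `m` by the elements of `l`. -/
def shiftUnion (m : ℕ) (l : List ℕ) : ℕ :=
  l.foldr (fun x acc => Nat.lor (Nat.shiftLeft m x) acc) 0

lemma testBit_shiftUnion {m i : ℕ} {l : List ℕ} :
    (shiftUnion m l).testBit i = true ↔ ∃ x ∈ l, x ≤ i ∧ m.testBit (i - x) = true := by
  induction l with
  | nil => simp [shiftUnion]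
  | cons x l ih =>
    change (m <<< x ||| shiftUnion m l).testBit i = true ↔ _
    simp [Nat.testBit_or, Nat.testBit_shiftLeft, ih]

/-- The bit mask of the interval `[lo, lo + L)`. -/
def intervalMask (lo L : ℕ) : ℕ := Nat.shiftLeft (Nat.shiftLeft 1 L - 1) lo

lemma testBit_intervalMask {lo L i : ℕ} :
    (intervalMask lo L).testBit i = true ↔ lo ≤ i ∧ i < lo + L := by
  change ((1 <<< L - 1) <<< lo).testBit i = true ↔ _
  rw [Nat.one_shiftLeft, Nat.testBit_shiftLeft, Nat.testBit_two_pow_sub_one]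
  simp only [ge_iff_le, Bool.and_eq_true, decide_eq_true_eq]
  omega

lemma testBit_of_land_eq {m lo L i : ℕ} (h : Nat.land m (intervalMask lo L) = intervalMask lo L)
    (hi : lo ≤ i) (hi' : i < lo + L) : m.testBit i = true := by
  have hb := testBit_intervalMask.2 ⟨hi, hi'⟩
  rw [← h] at hb
  change (m &&& intervalMask lo L).testBit i = true at hb
  rw [Nat.testBit_and, Bool.and_eq_true] at hb
  exact hb.1

lemma isRepr_succ_iff {m k : ℕ} : IsRepr (m + (k + 1)) (k + 1) 4 ↔
    ∃ a, (a + 1) ^ 4 - 1 ≤ m ∧ IsRepr (m - ((a + 1) ^ 4 - 1) + k) k 4 := by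
  constructor
  · rintro ⟨a, ha, h⟩
    rw [Fin.sum_univ_succ] at h
    have hk : k ≤ ∑ i : Fin k, a i.succ ^ 4 := by
      simpa using card_nsmul_le_sum (univ : Finset (Fin k)) (fun i => a i.succ ^ 4) 1
        fun i _ => Nat.one_le_pow _ _ (ha _)
    have h1 : 1 ≤ a 0 ^ 4 := Nat.one_le_pow _ _ (ha 0)
    have e : a 0 - 1 + 1 = a 0 := Nat.sub_add_cancel (ha 0)
    refine ⟨a 0 - 1, ?_, fun i => a i.succ, fun i => ha _, ?_⟩
    · rw [e]
      omega
    · change ∑ i : Fin k, a i.succ ^ 4 = _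
      rw [e]
      omega
  · rintro ⟨a, ha, h⟩
    have := (isRepr_pow (x := a + 1) a.succ_pos 4).add h
    have h1 : 1 ≤ (a + 1) ^ 4 := Nat.one_le_pow _ _ a.succ_pos
    convert this using 1 <;> omega

lemma _root_.IsRepr.add_ones {m k : ℕ} (h : IsRepr (m + k) k 4) (j : ℕ) : IsRepr (m + (k + j)) (k + j) 4 := by
  induction j with
  | zero => exact h
  | succ j ih => exact isRepr_succ_iff.2 ⟨0, by simp, by simpa using ih⟩

/-- The numbers `m` for which `m + k` is a sum of `k` biquadrates of numbers from `1` to `17`, as a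
bit mask. -/
def smallMask : ℕ → ℕ
  | 0 => 1
  | k + 1 => shiftUnion (smallMask k) ((List.range 17).map fun a => (a + 1) ^ 4 - 1)

lemma testBit_smallMask {k m : ℕ} (hm : m < 104975) :
    (smallMask k).testBit m = true ↔ IsRepr (m + k) k 4 := by
  induction k generalizing m with
  | zero =>
    rw [smallMask, Nat.testBit_one_eq_true_iff_self_eq_zero]
    constructor
    · rintro rfl
      exact isRepr_zero 4
    · rintro ⟨a, -, h⟩
      simpa using h.symm
  | succ k ih =>
    rw [smallMask, testBit_shiftUnion, isRepr_succ_iff]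
    constructor
    · rintro ⟨x, hx, hle, h⟩
      obtain ⟨a, -, rfl⟩ := List.mem_map.1 hx
      exact ⟨a, hle, (ih (by omega)).1 h⟩
    · rintro ⟨a, ha, h⟩
      refine ⟨_, List.mem_map.2 ⟨a, List.mem_range.2 ?_, rfl⟩, ha, (ih (by omega)).2 h⟩
      by_contra! h17
      have : (17 + 1) ^ 4 ≤ (a + 1) ^ 4 := Nat.pow_le_pow_left (by omega) 4
      omega

lemma smallMask_land : Nat.land (smallMask 22) (intervalMask 0 2642) =
    Nat.land (smallMask 21) (intervalMask 0 2642) := by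
  decide +kernel

lemma smallMask_land_21 : Nat.land (smallMask 21) (intervalMask 2642 97358) = intervalMask 2642 97358 := by
  decide +kernel

lemma smallMask_land_17 : Nat.land (smallMask 17) (intervalMask 31442 68558) = intervalMask 31442 68558 := by
  decide +kernel

lemma isRepr_succ_iff_of_le {k m : ℕ} (hk : 21 ≤ k) (hm : m ≤ 2641) :
    IsRepr (m + (k + 1)) (k + 1) 4 ↔ IsRepr (m + k) k 4 := by
  induction k, hk using Nat.le_induction generalizing m with
  | base =>
    rw [← testBit_smallMask (by omega), ← testBit_smallMask (by omega)]
    have h := congrArg (fun t => t.testBit m) smallMask_land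
    change (smallMask 22 &&& intervalMask 0 2642).testBit _ =
      (smallMask 21 &&& intervalMask 0 2642).testBit _ at h
    have hb := (testBit_intervalMask (lo := 0) (L := 2642)).2 ⟨m.zero_le, by omega⟩
    rw [Nat.testBit_and, Nat.testBit_and, hb, Bool.and_true, Bool.and_true] at h
    rw [h]
  | succ k hk ih =>
    rw [isRepr_succ_iff, isRepr_succ_iff]
    exact exists_congr fun a => and_congr_right fun ha => ih (by omega)

lemma isRepr_iff_of_le {j m : ℕ} (hj : 21 ≤ j) (hm : m ≤ 2641) :
    IsRepr (m + j) j 4 ↔ IsRepr (m + 21) 21 4 := by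
  induction j, hj using Nat.le_induction with
  | base => rfl
  | succ j hj ih => rw [isRepr_succ_iff_of_le hj hm, ih]

/-- Consecutive translates of an interval overlap when the gaps are at most its length. -/
lemma exists_translate {g : ℕ → ℕ} {N lo L n : ℕ} (hg : ∀ i < N, g (i + 1) ≤ g i + L)
    (h0 : g 0 + lo ≤ n) (hN : n < g N + lo + L) : ∃ i ≤ N, g i + lo ≤ n ∧ n < g i + lo + L := by
  induction N with
  | zero => exact ⟨0, le_rfl, h0, hN⟩
  | succ N ih =>
    by_cases h : n < g N + lo + L
    · obtain ⟨i, hi, h⟩ := ih (fun i hi => hg i (by omega)) h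
      exact ⟨i, by omega, h⟩
    · have := hg N (by omega)
      exact ⟨N + 1, le_rfl, by omega, hN⟩

lemma isRepr_succ_of_interval {k lo L : ℕ} (N : ℕ)
    (h : ∀ n, lo ≤ n → n < lo + L → IsRepr n k 4) (hN : 4 * (N + 1) ^ 3 ≤ L) {n : ℕ}
    (hn : lo + 1 ≤ n) (hn' : n < lo + 1 + N ^ 4) : IsRepr n (k + 1) 4 := by
  obtain ⟨i, -, h1, h2⟩ := exists_translate (g := fun i => (i + 1) ^ 4) (N := N) (lo := lo) (L := L)
    (n := n) (fun i hi => by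
      have : (i + 1 + 1) ^ 4 ≤ (i + 1) ^ 4 + 4 * (i + 2) ^ 3 := by nlinarith [sq_nonneg i]
      have : (i + 2) ^ 3 ≤ (N + 1) ^ 3 := Nat.pow_le_pow_left (by omega) 3
      omega) (by simpa [add_comm] using hn) (by
      have : N ^ 4 < (N + 1) ^ 4 := Nat.pow_lt_pow_left N.lt_succ_self (by norm_num)
      omega)
  have := (h (n - (i + 1) ^ 4) (by omega) (by omega)).add (isRepr_pow i.succ_pos 4)
  rwa [Nat.sub_add_cancel (by omega)] at this

lemma isRepr_of_low {n : ℕ} (hn : 2663 ≤ n) (hn' : n < 4000000000) : IsRepr n 21 4 := by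
  have h17 : ∀ n, 31459 ≤ n → n < 31459 + 68558 → IsRepr n 17 4 := fun n h1 h2 => by
    have := (testBit_smallMask (k := 17) (m := n - 17) (by omega)).1
      (testBit_of_land_eq smallMask_land_17 (by omega) (by omega))
    rwa [Nat.sub_add_cancel (by omega)] at this
  have h18 : ∀ n, 31460 ≤ n → n < 31460 + 331776 → IsRepr n 18 4 := fun n h1 h2 =>
    isRepr_succ_of_interval 24 h17 (by norm_num) h1 h2
  have h19 : ∀ n, 31461 ≤ n → n < 31461 + 3111696 → IsRepr n 19 4 := fun n h1 h2 =>
    isRepr_succ_of_interval 42 h18 (by norm_num) h1 h2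
  have h20 : ∀ n, 31462 ≤ n → n < 31462 + 65610000 → IsRepr n 20 4 := fun n h1 h2 =>
    isRepr_succ_of_interval 90 h19 (by norm_num) h1 h2
  by_cases h : n < 10 ^ 5
  · have := (testBit_smallMask (k := 21) (m := n - 21) (by omega)).1
      (testBit_of_land_eq smallMask_land_21 (by omega) (by omega))
    rwa [Nat.sub_add_cancel (by omega)] at this
  · exact isRepr_succ_of_interval 252 h20 (by norm_num) (by omega) (by omega)

end Biquad

namespace Biquad
open Finset

/-- The positive `x < 217` with last decimal digit in `d` and biquadrate congruent modulo `80` to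
that of the first entry of `d`, in decreasing order. -/
def bases (d : List ℕ) : List ℕ :=
  (List.range 217).reverse.filter fun x =>
    Nat.blt 0 x && d.contains (x % 10) && Nat.beq (x ^ 4 % 80) (d.headD 0 ^ 4 % 80)

/-- The sum of the residues modulo `80` of the biquadrates of the elements of `bases d`, `d ∈ ds`. -/
def residueSum (ds : List (List ℕ)) : ℕ := ds.foldr (fun d s => d.headD 0 ^ 4 % 80 + s) 0

/-- The sums of biquadrates of one element from each `bases d`, `d ∈ ds`, as a bit mask: the bit
`i < 27500000` stands for the sum `80 * i + residueSum ds`. -/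
def sumsMask (ds : List (List ℕ)) : ℕ :=
  ds.foldr (fun d m => Nat.land (shiftUnion m ((bases d).map fun x => x ^ 4 / 80))
    (intervalMask 0 27500000)) 1

/-- The union of the masks for `ds ∈ l`, aligned so that the bit `i` stands for the sum
`80 * i + r`, where `r` is the common residue modulo `80`. -/
def unionMask (l : List (List (List ℕ))) : ℕ :=
  l.foldr (fun ds m => Nat.lor (Nat.shiftLeft (sumsMask ds) (residueSum ds / 80)) m) 0

lemma isRepr_of_testBit_sumsMask {i : ℕ} {ds : List (List ℕ)} (h : (sumsMask ds).testBit i = true) :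
    IsRepr (80 * i + residueSum ds) ds.length 4 := by
  induction ds generalizing i with
  | nil =>
    obtain rfl := Nat.testBit_one_eq_true_iff_self_eq_zero.1 h
    exact isRepr_zero 4
  | cons d ds ih =>
    change (shiftUnion (sumsMask ds) _ &&& intervalMask 0 27500000).testBit i = true at h
    rw [Nat.testBit_and, Bool.and_eq_true] at h
    obtain ⟨y, hy, hle, h⟩ := testBit_shiftUnion.1 h.1
    obtain ⟨x, hx, rfl⟩ := List.mem_map.1 hy
    have hx := (List.mem_filter.1 hx).2
    simp only [Bool.and_eq_true, Nat.blt_eq, Nat.beq_eq] at hx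
    have e : 80 * i + residueSum (d :: ds) = 80 * (i - x ^ 4 / 80) + residueSum ds + x ^ 4 := by
      change 80 * i + (d.headD 0 ^ 4 % 80 + residueSum ds) = _
      clear * - hle hx
      omega
    rw [e]
    exact (ih h).add (isRepr_pow hx.1.1 4)

lemma isRepr_of_testBit_unionMask {i r : ℕ} {l : List (List (List ℕ))}
    (hl : ∀ ds ∈ l, ds.length = 6 ∧ residueSum ds % 80 = r)
    (h : (unionMask l).testBit i = true) : IsRepr (80 * i + r) 6 4 := by
  induction l with
  | nil => simp [unionMask] at h
  | cons ds l ih =>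
    change (sumsMask ds <<< (residueSum ds / 80) ||| unionMask l).testBit i = true at h
    rw [Nat.testBit_or, Bool.or_eq_true, Nat.testBit_shiftLeft, Bool.and_eq_true, decide_eq_true_eq] at h
    obtain ⟨hi, h⟩ | h := h
    · obtain ⟨h6, hr⟩ := hl ds (by simp)
      convert isRepr_of_testBit_sumsMask h using 1
      · omega
      · exact h6.symm
    · exact ih (fun ds hds => hl ds (by simp [hds])) h

lemma isRepr_of_unionMask {r n : ℕ} {l : List (List (List ℕ))}
    (hl : ∀ ds ∈ l, ds.length = 6 ∧ residueSum ds % 80 = r)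
    (h : Nat.land (unionMask l) (intervalMask 26000000 1500000) = intervalMask 26000000 1500000)
    (hn : 2080000000 ≤ n) (hn' : n < 2200000000) (hnr : n % 80 = r) : IsRepr n 6 4 := by
  convert isRepr_of_testBit_unionMask hl (testBit_of_land_eq h (i := n / 80) (by omega) (by omega))
    using 1
  omega

set_option maxRecDepth 100000 in
/-- Every `n` of the interval that is `3` modulo `16` is a sum of six positive biquadrates. -/
lemma isRepr_six {n : ℕ} (hn : 2080000000 ≤ n) (hn' : n < 2200000000) (h : n % 16 = 3) :
    IsRepr n 6 4 := by
  obtain h | h | h | h | h : n % 80 = 35 ∨ n % 80 = 51 ∨ n % 80 = 67 ∨ n % 80 = 3 ∨ n % 80 = 19 := by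
    omega
  · exact isRepr_of_unionMask (l := [[[5], [1, 3], [7, 9], [2, 4], [6, 8], [2]]])
      (by decide +kernel) (by decide +kernel) hn hn' h
  · exact isRepr_of_unionMask (l := [[[1, 3], [7, 9], [1], [2, 4], [6, 8], [2]]])
      (by decide +kernel) (by decide +kernel) hn hn' h
  · exact isRepr_of_unionMask (l := [[[2, 4, 6, 8], [5], [1, 3, 7, 9], [0], [0], [5]],
        [[1, 3, 7, 9], [0], [1, 3, 7, 9], [0], [0], [5]],
        [[2, 4, 6, 8], [2, 4, 6, 8], [5], [5], [0], [5]]])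
      (by decide +kernel) (by decide +kernel) hn hn' h
  · exact isRepr_of_unionMask (l := [[[0], [5], [5], [1, 3, 7, 9], [2, 4], [6, 8]]])
      (by decide +kernel) (by decide +kernel) hn hn' h
  · exact isRepr_of_unionMask (l := [[[0], [5], [1, 3], [7, 9], [2, 4], [6, 8]]])
      (by decide +kernel) (by decide +kernel) hn hn' h

end Biquad

namespace Biquad
open Finset

/-- Every `n` in the interval of length `L` from `2080000000 + 16 * k` that is `3 + o` modulo `16`,
`o ≤ k`, is a sum of `6 + k` positive biquadrates. -/
def Covered (k L : ℕ) : Prop :=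
  ∀ n, 2080000000 + 16 * k ≤ n → n < 2080000000 + 16 * k + L → (∃ o ≤ k, n % 16 = (3 + o) % 16) →
    IsRepr n (6 + k) 4

lemma odd_pow_four_mod (i : ℕ) : (2 * i + 1) ^ 4 % 16 = 1 := by
  rw [Nat.pow_mod, show (2 * i + 1) % 16 = 2 * (i % 8) + 1 by omega]
  have : i % 8 < 8 := Nat.mod_lt _ (by norm_num)
  interval_cases i % 8 <;> rfl

lemma even_pow_four_mod (i : ℕ) : (2 * i + 2) ^ 4 % 16 = 0 := by
  rw [show (2 * i + 2) ^ 4 = 16 * (i + 1) ^ 4 by ring, Nat.mul_mod_right]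

lemma pow_four_gap {x N L : ℕ} (hN : 64 * (N + 1) ^ 3 ≤ L) (hx : x ≤ 2 * N) :
    (x + 2) ^ 4 ≤ x ^ 4 + L := by
  have h1 : (x + 2) ^ 4 ≤ x ^ 4 + 8 * (x + 2) ^ 3 := by nlinarith [sq_nonneg x]
  have h2 : (x + 2) ^ 3 ≤ (2 * (N + 1)) ^ 3 := Nat.pow_le_pow_left (by omega) 3
  rw [mul_pow] at h2
  omega

lemma Covered.succ {k L N : ℕ} (h : Covered k L) (hN : 64 * (N + 1) ^ 3 ≤ L) :
    Covered (k + 1) (L + (2 * N + 1) ^ 4 - 16) := by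
  rintro n h1 h2 ⟨o, ho, hn⟩
  have h16 : 16 ≤ L := by
    have : 1 ≤ (N + 1) ^ 3 := Nat.one_le_pow _ _ N.succ_pos
    omega
  obtain ho | rfl := Nat.lt_or_eq_of_le ho
  · have : (2 * N + 1) ^ 4 ≤ (2 * N + 2) ^ 4 := Nat.pow_le_pow_left (by omega) 4
    obtain ⟨i, -, h3, h4⟩ := exists_translate (g := fun i => (2 * i + 2) ^ 4) (N := N)
      (lo := 2080000000 + 16 * k) (L := L) (n := n)
      (fun i hi => pow_four_gap (x := 2 * i + 2) hN (by omega)) (by clear * - h1; omega) (by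
        clear * - this h2 h16
        omega)
    have e := even_pow_four_mod i
    have := (h (n - (2 * i + 2) ^ 4) (by omega) (by omega) ⟨o, by omega, by omega⟩).add
      (isRepr_pow (x := 2 * i + 2) (by omega) 4)
    rwa [Nat.sub_add_cancel (by omega)] at this
  · obtain ⟨i, -, h3, h4⟩ := exists_translate (g := fun i => (2 * i + 1) ^ 4) (N := N)
      (lo := 2080000000 + 16 * k) (L := L) (n := n)
      (fun i hi => pow_four_gap (x := 2 * i + 1) hN (by omega)) (by clear * - h1; omega) (by
        clear * - h2 h16
        omega)
    have e := odd_pow_four_mod i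
    have := (h (n - (2 * i + 1) ^ 4) (by omega) (by omega) ⟨k, le_rfl, by omega⟩).add
      (isRepr_pow (x := 2 * i + 1) (by omega) 4)
    rwa [Nat.sub_add_cancel (by omega)] at this

/-- The length of the interval reached by successively adding biquadrates of numbers up to
`2 * N + 2`, for `N` in the list, or `0` if the gaps become too large. -/
def reach (L : ℕ) : List ℕ → ℕ
  | [] => L
  | N :: l => if 64 * (N + 1) ^ 3 ≤ L then reach (L + (2 * N + 1) ^ 4 - 16) l else 0

lemma Covered.reach {k L : ℕ} (h : Covered k L) (l : List ℕ) : Covered (k + l.length) (reach L l) := by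
  induction l generalizing k L with
  | nil => exact h
  | cons N l ih =>
    rw [Biquad.reach]
    split_ifs with hN
    · rw [List.length_cons, show k + (l.length + 1) = k + 1 + l.length by omega]
      exact ih (h.succ hN)
    · exact fun n h1 h2 => by omega

/-- Every number in the middle range is a sum of 21 positive biquadrates. -/
theorem isRepr_of_middle {n : ℕ} (hn : 2080000240 ≤ n) (hn' : n < 8200000 * (10 ^ 80) ^ 4) :
    IsRepr n 21 4 := by
  have h0 : Covered 0 120000000 := by
    rintro n h1 h2 ⟨o, ho, h⟩
    exact isRepr_six (by omega) (by omega) (by omega)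
  have h15 := h0.reach [122, 386, 177 * 10 ^ 1, 135 * 10 ^ 2, 202 * 10 ^ 3, 746 * 10 ^ 4, 918 * 10 ^ 6,
    562 * 10 ^ 9, 292 * 10 ^ 13, 262 * 10 ^ 18, 105 * 10 ^ 25, 672 * 10 ^ 33, 370 * 10 ^ 45,
    167 * 10 ^ 61, 124 * 10 ^ 82]
  refine h15 n hn (hn'.trans_le (le_trans ?_ (Nat.le_add_left _ _)))
    ⟨(n + 13) % 16, Nat.lt_succ_iff.1 (Nat.mod_lt _ (by norm_num)), by clear * -; omega⟩
  decide +kernel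

theorem isRepr_of_ge {n : ℕ} (hn : 2663 ≤ n) : IsRepr n 21 4 := by
  obtain h | h := lt_or_ge n 4000000000
  · exact isRepr_of_low hn h
  obtain h' | h' := lt_or_ge n (8200000 * (10 ^ 80) ^ 4)
  · exact isRepr_of_middle (le_trans (by norm_num) h) h'
  · exact isRepr_of_large h'

end Biquad

/-- for every `j ≥ 21` and every positive integer `m`, `m + j` is the
sum of exactly `j` positive fourth powers iff `m + 21` is the sum of exactly `21`
positive fourth powers. -/
theorem stmt_15 :
    ∀ j : ℕ, 21 ≤ j → ∀ m : ℕ, 0 < m →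
      (IsRepr (m + j) j 4 ↔ IsRepr (m + 21) 21 4) := by
  intro j hj m _
  by_cases hm : m ≤ 2641
  · exact Biquad.isRepr_iff_of_le hj hm
  · have h : IsRepr (m + 21) 21 4 := Biquad.isRepr_of_ge (by omega)
    obtain ⟨i, rfl⟩ := Nat.exists_eq_add_of_le hj
    exact iff_of_true (h.add_ones i) h
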